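/- The fundamental group π₁(ℂ² \ (H_{B₂} ∪ ℓ₁ ∪ ℓ₂)), where H_{B₂} = h⁻¹({4, 4i}), is isomorphic to ℤ² × F₂, the direct product of a free abelian group of rank 2 and a free group of rank 2. -/

import Mathlib

open Complex

/-- The polynomial map `h(u,v) = v³ - 6v²u + 9vu² - 2u³ + 6u` on `ℂ²`. -/
noncomputable def h : ℂ × ℂ → ℂ :=
  fun p => p.2 ^ 3 - 6 * p.2 ^ 2 * p.1 + 9 * p.2 * p.1 ^ 2 - 2 * p.1 ^ 3 + 6 * p.1

/-- The line `ℓ₁ = {v = 4u}` in `ℂ²`. -/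
def ell₁ : Set (ℂ × ℂ) := {p | p.2 = 4 * p.1}

/-- The line `ℓ₂ = {v = 0}` in `ℂ²`. -/
def ell₂ : Set (ℂ × ℂ) := {p | p.2 = 0}

/-- `W B = ℂ² \ (h⁻¹(B) ∪ ℓ₁ ∪ ℓ₂)`. -/
def W (B : Set ℂ) : Set (ℂ × ℂ) := {p | h p ∉ B ∧ p ∉ ell₁ ∧ p ∉ ell₂}

namespace S15

open Set Filter Topology

noncomputable def fA (ξ : ℂ) : ℂ := (Complex.cosh ξ ^ 3 + 3 * Complex.cosh ξ) / 4
noncomputable def fB (ξ : ℂ) : ℂ := 3 * Complex.sinh ξ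
noncomputable def f (p : ℂ × ℂ) : ℂ := fA p.1 * Complex.exp p.2 ^ 3 + fB p.1 * Complex.exp p.2

def Y : Set (ℂ × ℂ) := {p | f p ≠ 4 ∧ f p ≠ 4 * Complex.I}

noncomputable def sh (p : ℂ × ℂ) (r : ℝ) : ℂ × ℂ := (p.1, p.2 - (r : ℂ))

def Y0 : Set (ℂ × ℂ) := {p | ∀ r : ℝ, 0 ≤ r → sh p r ∈ Y}

lemma continuous_fA : Continuous fA := by
  unfold fA
  exact ((Complex.continuous_cosh.pow 3).add (continuous_const.mul Complex.continuous_cosh)).div_const _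

lemma continuous_fB : Continuous fB := by
  unfold fB
  exact continuous_const.mul Complex.continuous_sinh

lemma continuous_f : Continuous f := by
  unfold f
  have := continuous_fA
  have := continuous_fB
  fun_prop

lemma isOpen_Y : IsOpen Y :=
  (isOpen_ne_fun continuous_f continuous_const).inter (isOpen_ne_fun continuous_f continuous_const)

lemma continuous_sh : Continuous (fun q : (ℂ × ℂ) × ℝ => sh q.1 q.2) := by
  unfold sh
  fun_prop

@[simp] lemma sh_zero (p : ℂ × ℂ) : sh p 0 = p := by simp [sh]

lemma sh_sh (p : ℂ × ℂ) (r s : ℝ) : sh (sh p r) s = sh p (r + s) := by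
  simp [sh, sub_sub]

lemma Y0_sub : Y0 ⊆ Y := fun p hp => by simpa using hp 0 le_rfl

lemma sh_mem_Y0 {p : ℂ × ℂ} (hp : p ∈ Y0) {r : ℝ} (hr : 0 ≤ r) : sh p r ∈ Y0 := by
  intro s hs
  rw [sh_sh]
  exact hp _ (by positivity)

/-- reformulation -/
lemma Y0_of_sh {p : ℂ × ℂ} {r1 : ℝ} (h1 : ∀ r : ℝ, 0 ≤ r → r ≤ r1 → sh p r ∈ Y)
    (h2 : sh p r1 ∈ Y0) : p ∈ Y0 := by
  intro r hr
  by_cases h : r ≤ r1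
  · exact h1 r hr h
  · have := h2 (r - r1) (by linarith)
    rw [sh_sh] at this
    simpa using this

lemma mem_Y_of_norm {p : ℂ × ℂ} (hp : ‖f p‖ < 4) : p ∈ Y := by
  constructor
  · intro h; rw [h] at hp; norm_num at hp
  · intro h; rw [h] at hp; norm_num at hp

lemma f_sh (p : ℂ × ℂ) (r : ℝ) : f (sh p r) =
    fA p.1 * Complex.exp p.2 ^ 3 * (Real.exp (-r) : ℂ) ^ 3 +
      fB p.1 * Complex.exp p.2 * (Real.exp (-r) : ℂ) := by
  simp only [f, sh, Complex.exp_sub]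
  push_cast
  rw [Complex.exp_neg]
  have := Complex.exp_ne_zero (r : ℂ)
  field_simp

noncomputable def M0 (p : ℂ × ℂ) : ℝ := ‖fA p.1 * Complex.exp p.2 ^ 3‖ + ‖fB p.1 * Complex.exp p.2‖

lemma continuous_M0 : Continuous M0 := by
  unfold M0
  have := continuous_fA
  have := continuous_fB
  fun_prop

lemma norm_f_sh (p : ℂ × ℂ) {r : ℝ} (hr : 0 ≤ r) : ‖f (sh p r)‖ ≤ M0 p * Real.exp (-r) := by
  rw [f_sh]
  have h1 : Real.exp (-r) ≤ 1 := by simpa using hr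
  have h0 := Real.exp_pos (-r)
  set s := Real.exp (-r)
  refine (norm_add_le _ _).trans ?_
  rw [M0, add_mul]
  have hs : ‖(s : ℂ)‖ = s := by simp [abs_of_pos h0]
  gcongr ?_ + ?_
  · rw [norm_mul, norm_pow, hs]
    gcongr
    calc s ^ 3 ≤ s ^ 1 := pow_le_pow_of_le_one h0.le h1 (by norm_num)
      _ = s := pow_one s
  · rw [norm_mul, hs]

lemma exists_far (m : ℝ) : ∃ R : ℝ, 0 ≤ R ∧ ∀ p, M0 p ≤ m → ∀ r, R ≤ r → ‖f (sh p r)‖ < 4 := by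
  have : Tendsto (fun r : ℝ => |m| * Real.exp (-r)) atTop (𝓝 (|m| * 0)) :=
    (Real.tendsto_exp_neg_atTop_nhds_zero).const_mul _
  rw [mul_zero] at this
  have h4 : ∀ᶠ r in atTop, |m| * Real.exp (-r) < 4 := this.eventually (gt_mem_nhds (by norm_num))
  obtain ⟨R, hR⟩ := eventually_atTop.1 h4
  refine ⟨max R 0, le_max_right _ _, fun p hp r hr => ?_⟩
  refine (norm_f_sh p ((le_max_right _ _).trans hr)).trans_lt ?_
  refine lt_of_le_of_lt ?_ (hR r ((le_max_left _ _).trans hr))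
  gcongr
  exact hp.trans (le_abs_self m)

/-- tube lemma for shifts -/
lemma tube {p : ℂ × ℂ} {r1 : ℝ} {U : Set (ℂ × ℂ)} (hU : IsOpen U)
    (h1 : ∀ r : ℝ, 0 ≤ r → r ≤ r1 → sh p r ∈ U) :
    ∃ ε > 0, ∀ q ∈ Metric.ball p ε, ∀ r : ℝ, 0 ≤ r → r ≤ r1 → sh q r ∈ U := by
  obtain ⟨V, W, hV, hW, hpV, hrW, hVW⟩ := generalized_tube_lemma (isCompact_singleton (x := p))
    (isCompact_Icc (a := (0 : ℝ)) (b := r1)) (hU.preimage continuous_sh) (by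
      rintro ⟨q, r⟩ ⟨hq, hr⟩
      obtain rfl : q = p := hq
      exact h1 r hr.1 hr.2)
  obtain ⟨ε, hε, hb⟩ := Metric.isOpen_iff.1 hV p (hpV rfl)
  exact ⟨ε, hε, fun q hq r h0 h1 => hVW (Set.mk_mem_prod (hb hq) (hrW ⟨h0, h1⟩))⟩

lemma isOpen_Y0 : IsOpen Y0 := by
  rw [Metric.isOpen_iff]
  intro p hp
  obtain ⟨R, hR0, hR⟩ := exists_far (M0 p + 1)
  obtain ⟨ε, hε, h1⟩ := tube (r1 := R) isOpen_Y (fun r h0 _ => hp r h0)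
  have : ∀ᶠ q in 𝓝 p, M0 q < M0 p + 1 := continuous_M0.continuousAt.eventually (gt_mem_nhds (by linarith))
  obtain ⟨δ, hδ, h2⟩ := Metric.eventually_nhds_iff_ball.1 this
  refine ⟨min ε δ, lt_min hε hδ, fun q hq r hr => ?_⟩
  by_cases h : r ≤ R
  · exact h1 q (Metric.ball_subset_ball (min_le_left _ _) hq) r hr h
  · exact mem_Y_of_norm (hR q (h2 q (Metric.ball_subset_ball (min_le_right _ _) hq)).le r (by linarith))

lemma eventually_Y0 (p : ℂ × ℂ) : ∃ R : ℝ, 0 ≤ R ∧ ∀ r, R ≤ r → sh p r ∈ Y0 := by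
  obtain ⟨R, hR0, hR⟩ := exists_far (M0 p)
  refine ⟨R, hR0, fun r hr s hs => ?_⟩
  rw [sh_sh]
  exact mem_Y_of_norm (hR p le_rfl _ (by linarith))

lemma finite_cubic (a b c : ℂ) (hc : c ≠ 0) : {x : ℂ | a * x ^ 3 + b * x = c}.Finite := by
  classical
  let q : Polynomial ℂ := Polynomial.C a * Polynomial.X ^ 3 + Polynomial.C b * Polynomial.X - Polynomial.C c
  have hq : q ≠ 0 := by
    intro h
    have := congrArg (Polynomial.eval 0) h
    simp [q] at this
    exact hc this
  refine (q.roots.toFinset.finite_toSet).subset fun x hx => ?_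
  have hx' : a * x ^ 3 + b * x = c := hx
  simp [hq, q, Polynomial.IsRoot, hx']

lemma countable_slice (ξ : ℂ) : {η : ℂ | (ξ, η) ∉ Y}.Countable := by
  have h1 : ({x : ℂ | fA ξ * x ^ 3 + fB ξ * x = 4} ∪ {x : ℂ | fA ξ * x ^ 3 + fB ξ * x = 4 * Complex.I}).Countable :=
    ((finite_cubic _ _ _ (by norm_num)).union (finite_cubic _ _ _ (by simp))).countable
  refine (h1.preimage_cexp).mono fun η hη => ?_
  simp only [Set.mem_setOf_eq, Y, not_and_or, not_not, f] at hη
  exact hη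

lemma dense_Y0 {U : Set (ℂ × ℂ)} (hU : IsOpen U) (hne : U.Nonempty) : (U ∩ Y0).Nonempty := by
  obtain ⟨⟨ξ, η⟩, hp⟩ := hne
  have hc : (Complex.im '' {η : ℂ | (ξ, η) ∉ Y}).Countable := (countable_slice ξ).image _
  have hd := hc.dense_compl ℝ
  have hcont : Continuous (fun t : ℝ => ((ξ, (η.re : ℂ) + t * Complex.I) : ℂ × ℂ)) := by fun_prop
  obtain ⟨t, ht1, ht2⟩ := hd.inter_open_nonempty _ (hU.preimage hcont) ⟨η.im, by
    simpa [Complex.re_add_im] using hp⟩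
  refine ⟨_, ht1, fun r hr => ?_⟩
  by_contra hcon
  exact ht2 ⟨_, hcon, by simp⟩

end S15

namespace S15

open Set Filter Topology

structure Rels (R : ℂ × ℂ → ℂ × ℂ → Prop) : Prop where
  symm : ∀ K : Set (ℂ × ℂ), Convex ℝ K → K ⊆ Y → ∀ x ∈ K ∩ Y0, ∀ y ∈ K ∩ Y0, R x y → R y x
  tri : ∀ K : Set (ℂ × ℂ), Convex ℝ K → K ⊆ Y → ∀ x ∈ K ∩ Y0, ∀ y ∈ K ∩ Y0, ∀ z ∈ K ∩ Y0,
    R x y → R y z → R x z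
  seg : ∀ K : Set (ℂ × ℂ), Convex ℝ K → K ⊆ Y0 → ∀ x ∈ K, ∀ y ∈ K, R x y

structure Good (E : Set (ℂ × ℂ)) : Prop where
  isOpen : IsOpen E
  sub : E ⊆ Y
  y0sub : Y0 ⊆ E
  g3 : ∀ κ ε, Metric.ball κ ε ⊆ Y → ∀ M ⊆ E ∩ Metric.ball κ ε, IsPreconnected M →
    ∀ N ⊆ Metric.ball κ ε, IsOpen N → N ⊆ closure M → N ⊆ E
  g4 : ∀ p r1, 0 ≤ r1 → (∀ r : ℝ, 0 ≤ r → r ≤ r1 → sh p r ∈ Y) → sh p r1 ∈ E → p ∈ E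

def EofR (R : ℂ × ℂ → ℂ × ℂ → Prop) : Set (ℂ × ℂ) :=
  {κ | ∃ ε > 0, Metric.ball κ ε ⊆ Y ∧ ∀ y ∈ Metric.ball κ ε ∩ Y0, ∀ y' ∈ Metric.ball κ ε ∩ Y0, R y y'}

lemma Rels.good_aux {R} (hR : Rels R) {κ : ℂ × ℂ} {ε : ℝ} (hV : Metric.ball κ ε ⊆ Y)
    {M : Set (ℂ × ℂ)} (hM : M ⊆ EofR R ∩ Metric.ball κ ε) (hMp : IsPreconnected M)
    {y1 y2 : ℂ × ℂ} (h1 : y1 ∈ Metric.ball κ ε ∩ Y0) (h2 : y2 ∈ Metric.ball κ ε ∩ Y0)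
    (h1M : y1 ∈ closure M) (h2M : y2 ∈ closure M) : R y1 y2 := by
  have hcv := convex_ball (κ) ε
  -- ball around a point in V ∩ Y0
  have hb : ∀ y ∈ Metric.ball κ ε ∩ Y0, ∃ δ > 0, Metric.ball y δ ⊆ Metric.ball κ ε ∩ Y0 := fun y hy =>
    Metric.isOpen_iff.1 (Metric.isOpen_ball.inter isOpen_Y0) y hy
  let Q : ℂ × ℂ → Prop := fun κ' => ∀ᶠ y in 𝓝 κ', y ∈ Y0 → R y1 y
  have hQ : ∀ x ∈ M, ∀ᶠ y in 𝓝[M] x, (Q x → Q y) ∧ (Q y → Q x) := by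
    intro x hx
    obtain ⟨⟨δ, hδ, hδY, hδR⟩, hxV⟩ := hM hx
    have hO : IsOpen (Metric.ball x δ ∩ Metric.ball κ ε) := Metric.isOpen_ball.inter Metric.isOpen_ball
    have hxO : x ∈ Metric.ball x δ ∩ Metric.ball κ ε := ⟨Metric.mem_ball_self hδ, hxV⟩
    have key : ∀ z ∈ Metric.ball x δ ∩ Metric.ball κ ε, Q z → ∀ z' ∈ Metric.ball x δ ∩ Metric.ball κ ε, Q z' := by
      intro z hz hQz z' hz'
      obtain ⟨U, hU, hUo, hzU⟩ := eventually_nhds_iff.1 hQz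
      obtain ⟨y, ⟨hyU, hyO⟩, hy0⟩ := dense_Y0 (hUo.inter hO) ⟨z, hzU, hz⟩
      filter_upwards [hO.mem_nhds hz'] with w hw hw0
      exact hR.tri _ hcv hV _ h1 y ⟨hyO.2, hy0⟩ w ⟨hw.2, hw0⟩ (hU y hyU hy0) (hδR _ ⟨hyO.1, hy0⟩ _ ⟨hw.1, hw0⟩)
    filter_upwards [mem_nhdsWithin_of_mem_nhds (hO.mem_nhds hxO)] with y hy
    exact ⟨fun h => key x hxO h y hy, fun h => key y hy h x hxO⟩
  obtain ⟨δ1, hδ1, hb1⟩ := hb y1 h1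
  obtain ⟨δ2, hδ2, hb2⟩ := hb y2 h2
  obtain ⟨k1, hk1M, hk1⟩ := Metric.mem_closure_iff.1 h1M δ1 hδ1
  obtain ⟨k2, hk2M, hk2⟩ := Metric.mem_closure_iff.1 h2M δ2 hδ2
  rw [dist_comm] at hk1 hk2
  have hQ1 : Q k1 := by
    filter_upwards [Metric.isOpen_ball.mem_nhds (show k1 ∈ Metric.ball y1 δ1 from hk1)] with w hw _
    exact hR.seg _ (convex_ball y1 δ1) (fun _ h => (hb1 h).2) _ (Metric.mem_ball_self hδ1) _ hw
  have hQ2 : Q k2 := by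
    refine hMp.induction₂' (fun x y => Q x → Q y) hQ ?_ hk1M hk2M hQ1
    intro x y z _ _ _ hxy hyz hx
    exact hyz (hxy hx)
  obtain ⟨U, hU, hUo, hzU⟩ := eventually_nhds_iff.1 hQ2
  obtain ⟨y, ⟨hyU, hyO⟩, hy0⟩ := dense_Y0 (hUo.inter Metric.isOpen_ball) ⟨k2, hzU, hk2⟩
  exact hR.tri _ hcv hV _ h1 y ⟨(hb2 hyO).1, hy0⟩ _ h2 (hU y hyU hy0)
    (hR.seg _ (convex_ball y2 δ2) (fun _ h => (hb2 h).2) _ hyO _ (Metric.mem_ball_self hδ2))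

lemma Y0_sub_EofR {R} (hR : Rels R) : Y0 ⊆ EofR R := by
  intro p hp
  obtain ⟨ε, hε, hb⟩ := Metric.isOpen_iff.1 isOpen_Y0 p hp
  exact ⟨ε, hε, hb.trans Y0_sub, fun y hy y' hy' => hR.seg _ (convex_ball p ε) hb _ hy.1 _ hy'.1⟩

lemma EofR_of_open {R} {N : Set (ℂ × ℂ)} (hN : IsOpen N) (hNY : N ⊆ Y)
    (h : ∀ y ∈ N ∩ Y0, ∀ y' ∈ N ∩ Y0, R y y') : N ⊆ EofR R := by
  intro p hp
  obtain ⟨ε, hε, hb⟩ := Metric.isOpen_iff.1 hN p hp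
  exact ⟨ε, hε, hb.trans hNY, fun y hy y' hy' => h _ ⟨hb hy.1, hy.2⟩ _ ⟨hb hy'.1, hy'.2⟩⟩

lemma convex_shbox (K : Set (ℂ × ℂ)) (hK : Convex ℝ K) (r1 : ℝ) :
    Convex ℝ {q | ∃ p ∈ K, ∃ r : ℝ, 0 ≤ r ∧ r ≤ r1 ∧ q = sh p r} := by
  rintro x ⟨p, hp, r, h0, h1, rfl⟩ y ⟨p', hp', r', h0', h1', rfl⟩ a b ha hb hab
  refine ⟨a • p + b • p', hK hp hp' ha hb hab, a * r + b * r', by positivity, ?_, ?_⟩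
  · nlinarith
  · ext <;> simp [sh] <;> ring

lemma Rels.good {R} (hR : Rels R) : Good (EofR R) where
  isOpen := by
    rw [isOpen_iff_mem_nhds]
    rintro κ ⟨ε, hε, hY, h⟩
    exact mem_of_superset (Metric.ball_mem_nhds κ hε) (EofR_of_open Metric.isOpen_ball hY h)
  sub := by
    rintro κ ⟨ε, hε, hY, h⟩
    exact hY (Metric.mem_ball_self hε)
  y0sub := Y0_sub_EofR hR
  g3 := by
    intro κ ε hV M hM hMp N hN hNo hNM
    refine EofR_of_open hNo (hN.trans hV) fun y hy y' hy' => ?_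
    exact hR.good_aux hV hM hMp ⟨hN hy.1, hy.2⟩ ⟨hN hy'.1, hy'.2⟩ (hNM hy.1) (hNM hy'.1)
  g4 := by
    rintro p r1 hr1 h1 ⟨ε, hε, hY, h⟩
    obtain ⟨δ, hδ, hδY⟩ := tube isOpen_Y h1
    have hsub : ∀ q ∈ Metric.ball p (min δ ε), sh q r1 ∈ Metric.ball (sh p r1) ε := by
      intro q hq
      have hq' := Metric.ball_subset_ball (min_le_right _ _) hq
      rw [Metric.mem_ball] at hq' ⊢
      refine lt_of_eq_of_lt ?_ hq'
      rw [Prod.dist_eq, Prod.dist_eq]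
      simp [sh]
    refine ⟨min δ ε, lt_min hδ hε, ?_, ?_⟩
    · intro q hq
      simpa using hδY q (Metric.ball_subset_ball (min_le_left _ _) hq) 0 le_rfl hr1
    · rintro y ⟨hyb, hy0⟩ y' ⟨hyb', hy0'⟩
      set K : Set (ℂ × ℂ) := {q | ∃ p' ∈ Metric.ball p (min δ ε), ∃ r : ℝ, 0 ≤ r ∧ r ≤ r1 ∧ q = sh p' r} with hKdef
      have hK : Convex ℝ K := convex_shbox _ (convex_ball _ _) r1
      have hKY : K ⊆ Y := by
        rintro q ⟨p', hp', r, h0, h1, rfl⟩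
        exact hδY p' (Metric.ball_subset_ball (min_le_left _ _) hp') r h0 h1
      have hvert : ∀ z ∈ Y0, R z (sh z r1) ∧ R (sh z r1) z := by
        intro z hz
        have hc := convex_shbox {z} (convex_singleton z) r1
        have hs : {q | ∃ p ∈ ({z} : Set (ℂ × ℂ)), ∃ r : ℝ, 0 ≤ r ∧ r ≤ r1 ∧ q = sh p r} ⊆ Y0 := by
          rintro q ⟨p', hp', r, h0, h1, rfl⟩
          rw [mem_singleton_iff] at hp'
          subst hp'
          exact sh_mem_Y0 hz h0
        exact ⟨hR.seg _ hc hs _ ⟨z, rfl, 0, le_rfl, hr1, by simp⟩ _ ⟨z, rfl, r1, hr1, le_rfl, rfl⟩,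
          hR.seg _ hc hs _ ⟨z, rfl, r1, hr1, le_rfl, rfl⟩ _ ⟨z, rfl, 0, le_rfl, hr1, by simp⟩⟩
      have m1 : y ∈ K ∩ Y0 := ⟨⟨y, hyb, 0, le_rfl, hr1, by simp⟩, hy0⟩
      have m2 : y' ∈ K ∩ Y0 := ⟨⟨y', hyb', 0, le_rfl, hr1, by simp⟩, hy0'⟩
      have m3 : sh y r1 ∈ K ∩ Y0 := ⟨⟨y, hyb, r1, hr1, le_rfl, rfl⟩, sh_mem_Y0 hy0 hr1⟩
      have m4 : sh y' r1 ∈ K ∩ Y0 := ⟨⟨y', hyb', r1, hr1, le_rfl, rfl⟩, sh_mem_Y0 hy0' hr1⟩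
      have := h _ ⟨hsub y hyb, m3.2⟩ _ ⟨hsub y' hyb', m4.2⟩
      exact hR.tri K hK hKY _ m1 _ m3 _ m2 (hvert y hy0).1 (hR.tri K hK hKY _ m3 _ m4 _ m2 this (hvert y' hy0').2)

end S15

namespace S15

open Set Filter Topology

noncomputable def dE (p : ℂ × ℂ) : ℂ := 3 * (fA p.1 * Complex.exp p.2 ^ 3) + fB p.1 * Complex.exp p.2

lemma contDiff_f : ContDiff ℂ 1 f := by
  unfold f fA fB
  have h1 : ContDiff ℂ 1 (fun p : ℂ × ℂ => Complex.cosh p.1) := by fun_prop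
  have h2 : ContDiff ℂ 1 (fun p : ℂ × ℂ => Complex.sinh p.1) := by fun_prop
  have h3 : ContDiff ℂ 1 (fun p : ℂ × ℂ => Complex.exp p.2) := by fun_prop
  exact ((((h1.pow 3).add (contDiff_const.mul h1)).div_const 4).mul (h3.pow 3)).add
    ((contDiff_const.mul h2).mul h3)

lemma hasDerivAt_f (ξ η : ℂ) : HasDerivAt (fun z => f (ξ, z)) (dE (ξ, η)) η := by
  unfold f dE
  have h := Complex.hasDerivAt_exp η
  refine (((h.pow 3).const_mul (fA ξ)).add (h.const_mul (fB ξ))).congr_deriv ?_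
  simp
  ring

lemma exists_homeo {P : ℂ × ℂ} (hP : dE P ≠ 0) :
    ∃ e : OpenPartialHomeomorph (ℂ × ℂ) (ℂ × ℂ), P ∈ e.source ∧ ∀ p, e p = (p.1, f p) := by
  set L : ℂ × ℂ →L[ℂ] ℂ := fderiv ℂ f P with hL
  have hstrict : HasStrictFDerivAt f L P := contDiff_f.contDiffAt.hasStrictFDerivAt (by norm_num)
  set q := L (0, 1) with hq
  have hq' : q = dE P := by
    have h1 : HasDerivAt (fun z : ℂ => ((P.1, z) : ℂ × ℂ)) (0, 1) P.2 :=
      (hasDerivAt_const P.2 P.1).prodMk (hasDerivAt_id P.2)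
    have h2 : HasDerivAt (fun z => f (P.1, z)) (L (0, 1)) P.2 :=
      hstrict.hasFDerivAt.comp_hasDerivAt (f := fun z : ℂ => ((P.1, z) : ℂ × ℂ)) P.2 h1
    exact h2.unique (hasDerivAt_f P.1 P.2)
  have hq0 : q ≠ 0 := hq' ▸ hP
  have hLadd : ∀ x y : ℂ, L (x, y) = L (x, 0) + y * q := by
    intro x y
    have : ((x, y) : ℂ × ℂ) = (x, 0) + y • (0, 1) := by simp
    rw [this, map_add, map_smul, smul_eq_mul]
  let T : (ℂ × ℂ) →L[ℂ] (ℂ × ℂ) := (ContinuousLinearMap.fst ℂ ℂ ℂ).prod L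
  let T' : (ℂ × ℂ) →L[ℂ] (ℂ × ℂ) := (ContinuousLinearMap.fst ℂ ℂ ℂ).prod
    (q⁻¹ • (ContinuousLinearMap.snd ℂ ℂ ℂ - L.comp ((ContinuousLinearMap.fst ℂ ℂ ℂ).prod 0)))
  let Te : (ℂ × ℂ) ≃L[ℂ] (ℂ × ℂ) := ContinuousLinearEquiv.equivOfInverse T T'
    (by rintro ⟨x, y⟩; simp [T, T', hLadd x y]; field_simp)
    (by rintro ⟨x, y⟩; simp only [T, T', ContinuousLinearMap.prod_apply]; rw [Prod.mk.injEq]; refine ⟨by simp, ?_⟩; rw [hLadd]; simp; field_simp; ring)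
  have hF : HasStrictFDerivAt (fun p : ℂ × ℂ => (p.1, f p)) (Te : (ℂ × ℂ) →L[ℂ] (ℂ × ℂ)) P :=
    hasStrictFDerivAt_fst.prodMk hstrict
  exact ⟨hF.toOpenPartialHomeomorph _, hF.mem_toOpenPartialHomeomorph_source, fun p => rfl⟩

lemma locgraph {P : ℂ × ℂ} (hP : dE P ≠ 0) (hC : P ∉ Y) :
    ∃ ρ > 0, ∃ δ > 0, ∃ g : ℂ → ℂ, ContinuousOn g (Metric.ball P.1 δ) ∧ g P.1 = P.2 ∧
      ∀ ξ ∈ Metric.ball P.1 δ, ∀ ζ : ℂ, ‖ζ‖ < ρ → ((ξ, g ξ + ζ) ∈ Y ↔ ζ ≠ 0) := by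
  obtain ⟨e, heP, he⟩ := exists_homeo hP
  obtain ⟨c, c', hcc, hfP, hY⟩ : ∃ c c' : ℂ, c ≠ c' ∧ f P = c ∧ ∀ p, p ∈ Y ↔ f p ≠ c ∧ f p ≠ c' := by
    have h4 : (4 : ℂ) ≠ 4 * Complex.I := by
      intro h; have := congrArg Complex.re h; simp at this
    by_cases h : f P = 4
    · exact ⟨4, 4 * Complex.I, h4, h, fun p => Iff.rfl⟩
    · refine ⟨4 * Complex.I, 4, h4.symm, ?_, fun p => and_comm⟩
      by_contra h'
      exact hC ⟨h, h'⟩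
  have hO : IsOpen (e.source ∩ {p | f p ≠ c'}) := e.open_source.inter (isOpen_ne_fun continuous_f continuous_const)
  obtain ⟨ε, hε, hb⟩ := Metric.isOpen_iff.1 hO P ⟨heP, by simpa [hfP] using hcc⟩
  have hTo : IsOpen {ξ : ℂ | (ξ, c) ∈ e.target} := e.open_target.preimage (by fun_prop : Continuous fun ξ : ℂ => (ξ, c))
  have heP' : e P = (P.1, c) := by rw [he, hfP]
  have hmem : (P.1, c) ∈ e.target := heP' ▸ e.map_source heP
  set g : ℂ → ℂ := fun ξ => (e.symm (ξ, c)).2 with hg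
  have hgP : g P.1 = P.2 := by
    simp only [hg]; rw [← heP', e.left_inv heP]
  have hcont : ContinuousOn g {ξ : ℂ | (ξ, c) ∈ e.target} := by
    refine continuous_snd.comp_continuousOn ?_
    exact e.continuousOn_symm.comp (by fun_prop : Continuous fun ξ : ℂ => (ξ, c)).continuousOn (fun ξ h => h)
  have hev : ∀ᶠ ξ in 𝓝 P.1, ξ ∈ {ξ : ℂ | (ξ, c) ∈ e.target} ∧ dist (g ξ) P.2 < ε / 2 ∧ dist ξ P.1 < ε := by
    refine Filter.Eventually.and (hTo.mem_nhds hmem) (Filter.Eventually.and ?_ (Metric.ball_mem_nhds _ hε))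
    have := (hcont.continuousAt (hTo.mem_nhds hmem)).eventually (Metric.ball_mem_nhds (g P.1) (half_pos hε))
    simpa [hgP] using this
  obtain ⟨δ, hδ, hδb⟩ := Metric.eventually_nhds_iff_ball.1 hev
  refine ⟨ε / 2, half_pos hε, δ, hδ, g, hcont.mono fun ξ h => (hδb ξ h).1, hgP, fun ξ hξ ζ hζ => ?_⟩
  obtain ⟨h1, h2, h3⟩ := hδb ξ hξ
  have hsym : e.symm (ξ, c) = (ξ, g ξ) := by
    have := e.right_inv h1
    rw [he] at this
    have h5 := congrArg Prod.fst this
    exact Prod.ext h5 rfl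
  have hball : ∀ ζ : ℂ, ‖ζ‖ < ε / 2 → (ξ, g ξ + ζ) ∈ Metric.ball P ε := by
    intro ζ hζ
    rw [Metric.mem_ball, Prod.dist_eq]
    refine max_lt h3 ?_
    calc dist (g ξ + ζ) P.2 ≤ dist (g ξ + ζ) (g ξ) + dist (g ξ) P.2 := dist_triangle _ _ _
      _ < ε / 2 + ε / 2 := by simp only [dist_self_add_left]; linarith
      _ = ε := by ring
  have hfg : f (ξ, g ξ) = c := by
    have := e.right_inv h1
    rw [he, hsym] at this
    exact congrArg Prod.snd this
  rw [hY]
  constructor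
  · rintro ⟨hc, -⟩ rfl
    rw [add_zero] at hc
    exact hc hfg
  · intro h0
    refine ⟨fun hc => h0 ?_, (hb (hball ζ hζ)).2⟩
    have i1 : e (ξ, g ξ + ζ) = e (ξ, g ξ) := by rw [he, he, hfg]; simp only; rw [hc]
    have := e.injOn (hb (hball ζ hζ)).1 (hsym ▸ e.map_target h1) i1
    simpa using congrArg Prod.snd this

structure Loc (S : Set (ℂ × ℂ)) (P : ℂ × ℂ) (g : ℂ → ℂ) (r1 δ : ℝ) : Prop where
  r1pos : 0 < r1
  δpos : 0 < δ
  cont : ContinuousOn g (Metric.ball P.1 δ)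
  base : g P.1 = P.2
  memY : ∀ ξ ∈ Metric.ball P.1 δ, ∀ ζ : ℂ, |ζ.re| < r1 → |ζ.im| < δ → ((ξ, g ξ + ζ) ∈ Y ↔ ζ ≠ 0)
  memS : ∀ ξ ∈ Metric.ball P.1 δ, ∀ ζ : ℂ, |ζ.re| < r1 → |ζ.im| < δ → (ζ.im ≠ 0 ∨ ζ.re < 0) →
    (ξ, g ξ + ζ) ∈ S

lemma exists_Loc {S : Set (ℂ × ℂ)} (hSo : IsOpen S)
    (hS4 : ∀ p r1, 0 ≤ r1 → (∀ r : ℝ, 0 ≤ r → r ≤ r1 → sh p r ∈ Y) → sh p r1 ∈ S → p ∈ S)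
    {P : ℂ × ℂ} (hP : dE P ≠ 0) (hC : P ∉ Y) {r0 : ℝ} (hr0 : 0 < r0)
    (hleft : ∀ r, 0 < r → r < r0 → sh P r ∈ S) : ∃ g r1 δ, Loc S P g r1 δ := by
  obtain ⟨ρ, hρ, δ, hδ, g, hg, hgP, hY⟩ := locgraph hP hC
  set r1 := min (ρ / 2) (r0 / 2) with hr1
  have hr1p : 0 < r1 := lt_min (by linarith) (by linarith)
  have hr1ρ : r1 ≤ ρ / 2 := min_le_left _ _
  obtain ⟨d, hd, hdS⟩ := Metric.isOpen_iff.1 hSo _ (hleft r1 hr1p ((min_le_right _ _).trans_lt (by linarith)))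
  have hev : ∀ᶠ ξ in 𝓝 P.1, dist (g ξ) (P.2) < d / 2 := by
    have := (hg.continuousAt (Metric.ball_mem_nhds _ hδ)).eventually (Metric.ball_mem_nhds (g P.1) (half_pos hd))
    simpa [hgP] using this
  obtain ⟨δ2, hδ2, hδb⟩ := Metric.eventually_nhds_iff_ball.1 hev
  set δ' := min (min δ δ2) (min (d / 2) (ρ / 2)) with hδ'
  have l1 : δ' ≤ δ := (min_le_left _ _).trans (min_le_left _ _)
  have l2 : δ' ≤ δ2 := (min_le_left _ _).trans (min_le_right _ _)
  have l3 : δ' ≤ d / 2 := (min_le_right _ _).trans (min_le_left _ _)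
  have l4 : δ' ≤ ρ / 2 := (min_le_right _ _).trans (min_le_right _ _)
  have hnorm : ∀ ζ : ℂ, |ζ.re| ≤ r1 → |ζ.im| < δ' → ‖ζ‖ < ρ := by
    intro ζ h1 h2
    have := Complex.norm_le_abs_re_add_abs_im ζ
    linarith
  refine ⟨g, r1, δ', hr1p, lt_min (lt_min hδ hδ2) (lt_min (by linarith) (by linarith)),
    hg.mono (Metric.ball_subset_ball l1), hgP, ?_, ?_⟩
  · intro ξ hξ ζ h1 h2
    exact hY ξ (Metric.ball_subset_ball l1 hξ) ζ (hnorm ζ h1.le h2)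
  · intro ξ hξ ζ h1 h2 h3
    rw [abs_lt] at h1
    refine hS4 _ (ζ.re + r1) (by linarith) ?_ (hdS ?_)
    · intro r hr hrr
      have : sh (ξ, g ξ + ζ) r = (ξ, g ξ + (ζ - r)) := by simp [sh, add_sub_assoc]
      rw [this, hY ξ (Metric.ball_subset_ball l1 hξ) _ (hnorm _ ?_ ?_)]
      · intro h0
        have e1 := congrArg Complex.re h0
        have e2 := congrArg Complex.im h0
        simp at e1 e2
        rcases h3 with h3 | h3
        · exact h3 e2
        · linarith
      · simp only [Complex.sub_re, Complex.ofReal_re]; rw [abs_le]; constructor <;> linarith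
      · simpa using h2
    · rw [Metric.mem_ball, Prod.dist_eq]
      have hξ' : dist ξ P.1 < d := by
        have := Metric.mem_ball.1 hξ; linarith
      refine max_lt hξ' ?_
      have e3 : (sh (ξ, g ξ + ζ) (ζ.re + r1)).2 = (g ξ - r1) + ζ.im * Complex.I := by
        apply Complex.ext <;> simp [sh]; ring
      have e4 : (sh P r1).2 = P.2 - r1 := rfl
      rw [e3, e4]
      have e5 := hδb ξ (Metric.ball_subset_ball l2 hξ)
      rw [Complex.dist_eq] at e5 ⊢
      calc ‖g ξ - r1 + ζ.im * Complex.I - (P.2 - r1)‖ = ‖(g ξ - P.2) + ζ.im * Complex.I‖ := by ring_nf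
        _ ≤ ‖g ξ - P.2‖ + ‖ζ.im * Complex.I‖ := norm_add_le _ _
        _ = ‖g ξ - P.2‖ + |ζ.im| := by simp
        _ < d := by linarith

end S15

namespace S15

open Set Filter Topology

def Nbox (g : ℂ → ℂ) (ξ1 : ℂ) (x1 ε : ℝ) : Set (ℂ × ℂ) :=
  {p | p.1 ∈ Metric.ball ξ1 ε ∧ |(p.2 - g p.1).re - x1| < ε ∧ |(p.2 - g p.1).im| < ε}

def Nsgn (g : ℂ → ℂ) (ξ1 : ℂ) (x1 ε σ : ℝ) : Set (ℂ × ℂ) :=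
  {p | p ∈ Nbox g ξ1 x1 ε ∧ 0 < σ * (p.2 - g p.1).im}

lemma isOpen_Nbox {g : ℂ → ℂ} {ξ1 : ℂ} {x1 ε : ℝ} (hg : ContinuousOn g (Metric.ball ξ1 ε)) :
    IsOpen (Nbox g ξ1 x1 ε) := by
  have hc : ContinuousOn (fun p : ℂ × ℂ => p.2 - g p.1) (Metric.ball ξ1 ε ×ˢ univ) :=
    continuousOn_snd.sub (hg.comp continuousOn_fst (fun p hp => hp.1))
  have a1 : IsOpen {z : ℂ | |z.re - x1| < ε} := isOpen_lt (by fun_prop) continuous_const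
  have a2 : IsOpen {z : ℂ | |z.im| < ε} := isOpen_lt (by fun_prop) continuous_const
  have ho : IsOpen ({z : ℂ | |z.re - x1| < ε ∧ |z.im| < ε}) := a1.inter a2
  have := hc.isOpen_inter_preimage (Metric.isOpen_ball.prod isOpen_univ) ho
  convert this using 1
  ext p
  simp [Nbox]

lemma preconn_Nsgn {g : ℂ → ℂ} {ξ1 : ℂ} {x1 ε σ : ℝ} (hg : ContinuousOn g (Metric.ball ξ1 ε)) :
    IsPreconnected (Nsgn g ξ1 x1 ε σ) := by
  have hcv : Convex ℝ ({z : ℂ | |z.re - x1| < ε ∧ |z.im| < ε ∧ 0 < σ * z.im}) := by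
    intro z hz w hw a b ha hb hab
    obtain ⟨h1, h2, h3⟩ := hz
    obtain ⟨k1, k2, k3⟩ := hw
    rw [abs_lt] at h1 h2 k1 k2
    have e1 : (a • z + b • w).re = a * z.re + b * w.re := by simp
    have e2 : (a • z + b • w).im = a * z.im + b * w.im := by simp
    have hb' : b = 1 - a := by linarith
    refine ⟨?_, ?_, ?_⟩
    · rw [e1, abs_lt]; subst hb'
      rcases ha.eq_or_lt with rfl | ha'
      · constructor <;> linarith
      · constructor <;> nlinarith
    · rw [e2, abs_lt]; subst hb'
      rcases ha.eq_or_lt with rfl | ha'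
      · constructor <;> linarith
      · constructor <;> nlinarith
    · rw [e2]
      have : σ * (a * z.im + b * w.im) = a * (σ * z.im) + b * (σ * w.im) := by ring
      rw [this]
      rcases ha.eq_or_lt with rfl | ha'
      · have : b = 1 := by linarith
        subst this; linarith
      · have := mul_pos ha' h3
        have := mul_nonneg hb k3.le
        linarith
  have hp : IsPreconnected (Metric.ball ξ1 ε ×ˢ {z : ℂ | |z.re - x1| < ε ∧ |z.im| < ε ∧ 0 < σ * z.im}) :=
    ((convex_ball ξ1 ε).prod hcv).isPreconnected
  have hc : ContinuousOn (fun p : ℂ × ℂ => (p.1, g p.1 + p.2))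
      (Metric.ball ξ1 ε ×ˢ {z : ℂ | |z.re - x1| < ε ∧ |z.im| < ε ∧ 0 < σ * z.im}) :=
    continuousOn_fst.prodMk ((hg.comp continuousOn_fst (fun p hp => hp.1)).add continuousOn_snd)
  have := hp.image _ hc
  convert this using 1
  ext ⟨a, b⟩
  simp only [Nsgn, Nbox, mem_image, mem_prod, Prod.exists]
  constructor
  · rintro ⟨⟨h1, h2, h3⟩, h4⟩
    exact ⟨a, b - g a, ⟨h1, h2, h3, h4⟩, by simp⟩
  · rintro ⟨a', b', ⟨h1, h2, h3, h4⟩, h5⟩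
    simp only [Prod.mk.injEq] at h5
    obtain ⟨rfl, rfl⟩ := h5
    exact ⟨⟨h1, by simpa using h2, by simpa using h3⟩, by simpa using h4⟩

lemma closure_Nsgn {g : ℂ → ℂ} {ξ1 : ℂ} {x1 ε σ : ℝ} (hσ : |σ| = 1) {p : ℂ × ℂ}
    (hp : p ∈ Nbox g ξ1 x1 ε) (h0 : 0 ≤ σ * (p.2 - g p.1).im) : p ∈ closure (Nsgn g ξ1 x1 ε σ) := by
  rw [Metric.mem_closure_iff]
  intro d hd
  obtain ⟨h1, h2, h3⟩ := hp
  set y := (p.2 - g p.1).im with hy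
  set t := min d (ε - |y|) / 2 with ht
  have ht0 : 0 < t := by
    have : 0 < min d (ε - |y|) := lt_min hd (by linarith)
    linarith
  have htd : t < d := by
    have : min d (ε - |y|) ≤ d := min_le_left _ _
    linarith
  have hty : t < ε - |y| := by
    have : min d (ε - |y|) ≤ (ε - |y|) := min_le_right _ _
    linarith
  have e1 : (p.2 + (σ * t : ℝ) * Complex.I - g p.1).re = (p.2 - g p.1).re := by simp
  have e2 : (p.2 + (σ * t : ℝ) * Complex.I - g p.1).im = y + σ * t := by simp [hy]; ring
  have hst : |σ * t| = t := by rw [abs_mul, hσ, one_mul, abs_of_pos ht0]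
  refine ⟨(p.1, p.2 + (σ * t : ℝ) * Complex.I), ⟨⟨h1, ?_, ?_⟩, ?_⟩, ?_⟩
  · simp only [e1]; exact h2
  · simp only [e2]
    have := abs_add_le y (σ * t)
    linarith
  · simp only [e2]
    have : σ * σ = 1 := by rw [← abs_mul_abs_self, hσ, one_mul]
    nlinarith
  · rw [Prod.dist_eq]
    refine max_lt (by simpa using hd) ?_
    rw [dist_self_add_right, norm_mul, Complex.norm_I, Complex.norm_real, Real.norm_eq_abs, hst, mul_one]
    exact htd

/-- The local box at a cut point. -/
lemma Loc.box {S P g r1 δ} (hL : Loc S P g r1 δ) {ξ1 : ℂ} (hξ : ξ1 ∈ Metric.ball P.1 δ) {x1 : ℝ}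
    (hx0 : 0 < x1) (hx1 : x1 < r1) :
    ∃ ε > 0, ∃ V > 0, Metric.ball (ξ1, g ξ1 + x1) V ⊆ Y ∧ Nbox g ξ1 x1 ε ⊆ Metric.ball (ξ1, g ξ1 + x1) V ∧
      ContinuousOn g (Metric.ball ξ1 ε) ∧
      (∀ p ∈ Nbox g ξ1 x1 ε, (p.2 - g p.1).im ≠ 0 → p ∈ S) ∧
      (∀ p ∈ Nbox g ξ1 x1 ε, 0 < (p.2 - g p.1).re ∧ (p.1, g p.1) ∉ Y) := by
  have hY : (ξ1, g ξ1 + x1) ∈ Y := by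
    rw [hL.memY ξ1 hξ x1 (by simpa [abs_of_pos hx0] using hx1) (by simpa using hL.δpos)]
    exact_mod_cast hx0.ne'
  obtain ⟨V, hV, hVY⟩ := Metric.isOpen_iff.1 isOpen_Y _ hY
  have hO : IsOpen (Metric.ball P.1 δ) := Metric.isOpen_ball
  have hcat : ContinuousAt g ξ1 := hL.cont.continuousAt (hO.mem_nhds hξ)
  have hev : ∀ᶠ ξ in 𝓝 ξ1, ξ ∈ Metric.ball P.1 δ ∧ dist (g ξ) (g ξ1) < V / 4 :=
    Filter.Eventually.and (hO.mem_nhds hξ) (hcat.eventually (Metric.ball_mem_nhds _ (by linarith)))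
  obtain ⟨d, hd, hdb⟩ := Metric.eventually_nhds_iff_ball.1 hev
  set ε := min (min d (V / 4)) (min (min x1 (r1 - x1)) δ) with hε
  have l1 : ε ≤ d := (min_le_left _ _).trans (min_le_left _ _)
  have l2 : ε ≤ V / 4 := (min_le_left _ _).trans (min_le_right _ _)
  have l3 : ε ≤ x1 := (min_le_right _ _).trans ((min_le_left _ _).trans (min_le_left _ _))
  have l4 : ε ≤ r1 - x1 := (min_le_right _ _).trans ((min_le_left _ _).trans (min_le_right _ _))
  have l5 : ε ≤ δ := (min_le_right _ _).trans (min_le_right _ _)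
  have hεp : 0 < ε := lt_min (lt_min hd (by linarith)) (lt_min (lt_min hx0 (by linarith)) hL.δpos)
  have hbb : ∀ ξ ∈ Metric.ball ξ1 ε, ξ ∈ Metric.ball P.1 δ ∧ dist (g ξ) (g ξ1) < V / 4 :=
    fun ξ h => hdb ξ (Metric.ball_subset_ball l1 h)
  refine ⟨ε, hεp, V, hV, hVY, ?_, hL.cont.mono fun ξ h => (hbb ξ h).1, ?_, ?_⟩
  · rintro ⟨ξ, η⟩ ⟨h1, h2, h3⟩
    simp only at h1 h2 h3
    have hb := (hbb ξ h1).2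
    rw [Metric.mem_ball, Prod.dist_eq]
    rw [Metric.mem_ball] at h1
    refine max_lt (by simp only; linarith) ?_
    simp only
    rw [Complex.dist_eq] at hb ⊢
    have e : η - (g ξ1 + x1) = (g ξ - g ξ1) + (η - g ξ - x1) := by ring
    have h5 := Complex.norm_le_abs_re_add_abs_im (η - g ξ - x1)
    have e1 : (η - g ξ - x1).re = (η - g ξ).re - x1 := by simp
    have e2 : (η - g ξ - x1).im = (η - g ξ).im := by simp
    rw [e1, e2] at h5
    have h6 := norm_add_le (g ξ - g ξ1) (η - g ξ - x1)
    rw [e]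
    linarith
  · rintro ⟨ξ, η⟩ ⟨h1, h2, h3⟩ h4
    simp only at h1 h2 h3 h4
    rw [abs_lt] at h2
    have := hL.memS ξ (hbb ξ h1).1 (η - g ξ) (by rw [abs_lt]; constructor <;> linarith) (by linarith) (Or.inl h4)
    simpa using this
  · rintro ⟨ξ, η⟩ ⟨h1, h2, h3⟩
    simp only at h1 h2 h3 ⊢
    rw [abs_lt] at h2
    refine ⟨by linarith, ?_⟩
    have := hL.memY ξ (hbb ξ h1).1 0 (by simpa using hL.r1pos) (by simpa using hL.δpos)
    simpa using this

lemma Nbox_mem {g : ℂ → ℂ} {ξ1 : ℂ} {x1 ε : ℝ} {ξ : ℂ} {x : ℝ} (h1 : ξ ∈ Metric.ball ξ1 ε) (h2 : |x - x1| < ε) :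
    (ξ, g ξ + x) ∈ Nbox g ξ1 x1 ε := by
  refine ⟨h1, by simpa using h2, ?_⟩
  have : 0 < ε := (abs_nonneg _).trans_lt h2
  simpa using this

lemma Good.box {E} (hE : Good E) {g : ℂ → ℂ} {ξ1 : ℂ} {x1 ε V : ℝ} 
    (hVY : Metric.ball (ξ1, g ξ1 + x1) V ⊆ Y) (hN : Nbox g ξ1 x1 ε ⊆ Metric.ball (ξ1, g ξ1 + x1) V)
    (hg : ContinuousOn g (Metric.ball ξ1 ε)) 
    (hS : ∀ p ∈ Nbox g ξ1 x1 ε, (p.2 - g p.1).im ≠ 0 → p ∈ E)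
    {κ : ℂ × ℂ} (hκN : κ ∈ Nbox g ξ1 x1 ε) (hκ0 : (κ.2 - g κ.1).im = 0) (hκE : κ ∈ E) :
    Nbox g ξ1 x1 ε ⊆ E := by
  have hp : ∀ σ : ℝ, |σ| = 1 → IsPreconnected (insert κ (Nsgn g ξ1 x1 ε σ)) := by
    intro σ hσ
    refine (preconn_Nsgn hg).subset_closure (subset_insert _ _) ?_
    exact insert_subset (closure_Nsgn hσ hκN (by rw [hκ0, mul_zero])) subset_closure
  have hM : IsPreconnected (insert κ (Nsgn g ξ1 x1 ε 1) ∪ insert κ (Nsgn g ξ1 x1 ε (-1))) :=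
    (hp 1 (by simp)).union κ (mem_insert _ _) (mem_insert _ _) (hp (-1) (by simp))
  refine hE.g3 _ V hVY _ ?_ hM _ hN (isOpen_Nbox hg) ?_
  · have : ∀ σ : ℝ, insert κ (Nsgn g ξ1 x1 ε σ) ⊆ E ∩ Metric.ball (ξ1, g ξ1 + x1) V := by
      intro σ
      refine insert_subset ⟨hκE, hN hκN⟩ fun p hp => ⟨hS p hp.1 ?_, hN hp.1⟩
      intro h
      have := hp.2
      rw [h, mul_zero] at this
      exact lt_irrefl _ this
    exact union_subset (this 1) (this (-1))
  · intro p hp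
    rcases le_total 0 (p.2 - g p.1).im with h | h
    · refine closure_mono ?_ (closure_Nsgn (σ := 1) (by simp) hp (by simpa using h))
      exact (subset_insert _ _).trans subset_union_left
    · refine closure_mono ?_ (closure_Nsgn (σ := -1) (by simp) hp (by simpa using h))
      exact (subset_insert _ _).trans subset_union_right

lemma Loc.all {E S P g r1 δ} (hE : Good E) (hSE : S ⊆ E) (hL : Loc S P g r1 δ) 
    {ξ ξ' : ℂ} (hξ : ξ ∈ Metric.ball P.1 δ) (hξ' : ξ' ∈ Metric.ball P.1 δ) {x x' : ℝ}
    (hx : x ∈ Ioo 0 r1) (hx' : x' ∈ Ioo 0 r1) (h : (ξ, g ξ + x) ∈ E) : (ξ', g ξ' + x') ∈ E := by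
  have hp : IsPreconnected (Metric.ball P.1 δ ×ˢ Ioo 0 r1) :=
    (convex_ball P.1 δ).isPreconnected.prod isPreconnected_Ioo
  refine hp.induction₂' (fun a b : ℂ × ℝ => (a.1, g a.1 + a.2) ∈ E → (b.1, g b.1 + b.2) ∈ E) ?_ ?_
    (x := (ξ, x)) (y := (ξ', x')) ⟨hξ, hx⟩ ⟨hξ', hx'⟩ h
  · rintro ⟨a, b⟩ ⟨ha, hb⟩
    obtain ⟨ε, hε, V, hV, hVY, hN, hg, hS, -⟩ := hL.box ha hb.1 hb.2
    have : Metric.ball a ε ×ˢ {t : ℝ | |t - b| < ε} ∈ 𝓝 (a, b) := by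
      refine prod_mem_nhds (Metric.ball_mem_nhds a hε) ?_
      exact Metric.ball_mem_nhds b hε
    filter_upwards [mem_nhdsWithin_of_mem_nhds this]
    rintro ⟨a', b'⟩ ⟨h1, h2⟩
    have m1 : (a, g a + b) ∈ Nbox g a b ε := Nbox_mem (Metric.mem_ball_self hε) (by simpa using hε)
    have m2 : (a', g a' + b') ∈ Nbox g a b ε := Nbox_mem h1 h2
    exact ⟨fun h => hE.box hVY hN hg (fun p hp hi => hSE (hS p hp hi)) m1 (by simp) h m2,
      fun h => hE.box hVY hN hg (fun p hp hi => hSE (hS p hp hi)) m2 (by simp) h m1⟩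
  · intro a b c _ _ _ h1 h2 h3
    exact h2 (h1 h3)

def Filled (E : Set (ℂ × ℂ)) (P : ℂ × ℂ) : Prop := ∃ r0 > 0, ∀ r, 0 < r → r < r0 → sh P (-r) ∈ E

/-- Claim C -/
lemma claimC {E : Set (ℂ × ℂ)} (hE : Good E) {P : ℂ × ℂ} (hP : dE P ≠ 0) (hC : P ∉ Y) {r0 : ℝ} (hr0 : 0 < r0)
    (hleft : ∀ r, 0 < r → r < r0 → sh P r ∈ E) :
    ∃ U, IsOpen U ∧ P ∈ U ∧ (∀ Q ∈ U, ∀ Q' ∈ U, Q ∉ Y → Q' ∉ Y → Filled E Q → Filled E Q') ∧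
      ∀ᶠ ξ in 𝓝 P.1, ∃ Q ∈ U, Q ∉ Y ∧ Q.1 = ξ := by
  obtain ⟨g, r1, δ, hL⟩ := exists_Loc hE.isOpen hE.g4 hP hC hr0 hleft
  set U : Set (ℂ × ℂ) := {p | p.1 ∈ Metric.ball P.1 δ ∧ |(p.2 - g p.1).re| < r1 ∧ |(p.2 - g p.1).im| < δ} with hU
  have hUo : IsOpen U := by
    have hc : ContinuousOn (fun p : ℂ × ℂ => p.2 - g p.1) (Metric.ball P.1 δ ×ˢ univ) :=
      continuousOn_snd.sub (hL.cont.comp continuousOn_fst (fun p hp => hp.1))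
    have a1 : IsOpen {z : ℂ | |z.re| < r1} := isOpen_lt (by fun_prop) continuous_const
    have a2 : IsOpen {z : ℂ | |z.im| < δ} := isOpen_lt (by fun_prop) continuous_const
    have ho : IsOpen ({z : ℂ | |z.re| < r1 ∧ |z.im| < δ}) := a1.inter a2
    have := hc.isOpen_inter_preimage (Metric.isOpen_ball.prod isOpen_univ) ho
    convert this using 1
    ext p
    simp [hU]
  have hgr : ∀ Q ∈ U, Q ∉ Y → Q.2 = g Q.1 := by
    rintro ⟨a, b⟩ ⟨h1, h2, h3⟩ hQ
    have := hL.memY a h1 (b - g a) h2 h3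
    simp only [add_sub_cancel] at this
    rw [this, not_not, sub_eq_zero] at hQ
    exact hQ
  refine ⟨U, hUo, ⟨Metric.mem_ball_self hL.δpos, ?_, ?_⟩, ?_, ?_⟩
  · simpa [hL.base] using hL.r1pos
  · simpa [hL.base] using hL.δpos
  · rintro ⟨a, b⟩ hQ ⟨a', b'⟩ hQ' hY hY' ⟨t, ht, hfill⟩
    have e1 : b = g a := hgr _ hQ hY
    have e2 : b' = g a' := hgr _ hQ' hY'
    subst e1 e2
    refine ⟨r1, hL.r1pos, fun r h0 h1 => ?_⟩
    have hm : 0 < min t r1 / 2 := by have := lt_min ht hL.r1pos; linarith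
    have h3 := hfill (min t r1 / 2) hm (by have := min_le_left t r1; linarith)
    have := hL.all hE subset_rfl hQ.1 hQ'.1 (x := min t r1 / 2) (x' := r) ⟨hm, by have := min_le_right t r1; linarith⟩ ⟨h0, h1⟩
      (by simpa [sh] using h3)
    simpa [sh] using this
  · filter_upwards [Metric.ball_mem_nhds P.1 hL.δpos] with ξ hξ
    refine ⟨(ξ, g ξ), ⟨hξ, ?_, ?_⟩, ?_, rfl⟩
    · simpa using hL.r1pos
    · simpa using hL.δpos
    · have := hL.memY ξ hξ 0 (by simpa using hL.r1pos) (by simpa using hL.δpos)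
      simpa using this

/-- visible and nondegenerate -/
def VC : Set (ℂ × ℂ) := {P | P ∉ Y ∧ dE P ≠ 0 ∧ ∀ r : ℝ, 0 < r → sh P r ∈ Y}

lemma VC.left {P} (hP : P ∈ VC) {r : ℝ} (hr : 0 < r) : sh P r ∈ Y0 := by
  intro s hs
  rw [sh_sh]
  exact hP.2.2 _ (by linarith)

lemma filled_preconn {E : Set (ℂ × ℂ)} (hE : Good E) {M : Set (ℂ × ℂ)} (hM : IsPreconnected M) (hMV : M ⊆ VC)
    {P Q : ℂ × ℂ} (hP : P ∈ M) (hQ : Q ∈ M) (h : Filled E P) : Filled E Q := by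
  refine hM.induction₂' (fun a b => Filled E a → Filled E b) ?_ ?_ hP hQ h
  · intro a ha
    obtain ⟨U, hUo, haU, hU, -⟩ := claimC hE (hMV ha).2.1 (hMV ha).1 one_pos
      (fun r hr _ => hE.y0sub (VC.left (hMV ha) hr))
    filter_upwards [mem_nhdsWithin_of_mem_nhds (hUo.mem_nhds haU), self_mem_nhdsWithin] with b hb hbM
    exact ⟨hU a haU b hb (hMV ha).1 (hMV hbM).1, hU b hb a haU (hMV hbM).1 (hMV ha).1⟩
  · intro a b c _ _ _ h1 h2 h3
    exact h2 (h1 h3)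

/-- FL lemma -/
lemma FL {E : Set (ℂ × ℂ)} (hE : Good E) {p : ℂ × ℂ} (hp : p ∈ Y)
    (hF : ∀ r : ℝ, 0 < r → sh p r ∉ Y → Filled E (sh p r)) : p ∈ E := by
  by_contra hpE
  set T : Set ℝ := {r | 0 ≤ r ∧ sh p r ∈ Y ∧ sh p r ∉ E} with hT
  have h0T : (0 : ℝ) ∈ T := ⟨le_rfl, by simpa using hp, by simpa using hpE⟩
  obtain ⟨R, hR0, hR⟩ := eventually_Y0 p
  have hbdd : BddAbove T := ⟨R, fun r hr => by
    by_contra hcon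
    exact hr.2.2 (hE.y0sub (hR r (by linarith)))⟩
  have hlub := isLUB_csSup ⟨0, h0T⟩ hbdd
  set s := sSup T
  have hs0 : 0 ≤ s := hlub.1 h0T
  have hc : Continuous (fun r : ℝ => sh p r) := continuous_sh.comp (by fun_prop : Continuous fun r : ℝ => (p, r))
  -- points close to s from below in T
  have hclose : ∀ d > 0, ∃ r ∈ T, s - d < r ∧ r ≤ s := by
    intro d hd
    obtain ⟨r, hr, h1, h2⟩ := hlub.exists_between (show s - d < s by linarith)
    exact ⟨r, hr, h1, h2⟩
  by_cases hsE : sh p s ∈ E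
  · obtain ⟨d, hd, hb⟩ := Metric.isOpen_iff.1 (hE.isOpen.preimage hc) s hsE
    obtain ⟨r, hr, h1, h2⟩ := hclose d hd
    exact hr.2.2 (hb (by rw [Metric.mem_ball, Real.dist_eq, abs_lt]; constructor <;> linarith))
  · by_cases hsY : sh p s ∈ Y
    · obtain ⟨d, hd, hb⟩ := Metric.isOpen_iff.1 (isOpen_Y.preimage hc) s hsY
      apply hsE
      have hbY : ∀ r, s ≤ r → r < s + d → sh p r ∈ Y := fun r h1 h2 =>
        hb (by rw [Metric.mem_ball, Real.dist_eq, abs_lt]; constructor <;> linarith)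
      refine hE.g4 _ (d / 2) (by linarith) ?_ ?_
      · intro r h1 h2
        rw [sh_sh]
        exact hbY _ (by linarith) (by linarith)
      · rw [sh_sh]
        by_contra hcon
        have : s + d / 2 ∈ T := ⟨by linarith, hbY _ (by linarith) (by linarith), hcon⟩
        have := hlub.1 this
        linarith
    · have hspos : 0 < s := by
        rcases hs0.eq_or_lt with h | h
        · rw [← h] at hsY
          exact absurd (by simpa using hp) hsY
        · exact h
      obtain ⟨r0, hr0, hfill⟩ := hF s hspos hsY
      obtain ⟨r, hr, h1, h2⟩ := hclose r0 hr0
      rcases h2.eq_or_lt with h | h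
      · rw [h] at hr; exact hsY hr.2.1
      · have := hfill (s - r) (by linarith) (by linarith)
        rw [sh_sh] at this
        apply hr.2.2
        convert this using 2
        ring

end S15

namespace S15

open Set Filter Topology

noncomputable def tr (n : ℤ) (p : ℂ × ℂ) : ℂ × ℂ := (p.1, p.2 + n * (2 * Real.pi * Complex.I))

lemma f_tr (n : ℤ) (p : ℂ × ℂ) : f (tr n p) = f p := by
  simp only [f, tr]
  rw [Complex.exp_add, Complex.exp_int_mul_two_pi_mul_I, mul_one]

lemma tr_mem_Y (n : ℤ) (p : ℂ × ℂ) : tr n p ∈ Y ↔ p ∈ Y := by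
  simp only [Y, mem_ofPred_eq, f_tr]

lemma tr_sh (n : ℤ) (p : ℂ × ℂ) (r : ℝ) : sh (tr n p) r = tr n (sh p r) := by
  simp only [sh, tr]; ext <;> simp; ring

lemma tr_tr (n m : ℤ) (p : ℂ × ℂ) : tr n (tr m p) = tr (n + m) p := by
  simp only [tr]; ext <;> simp; ring

lemma tr_zero (p : ℂ × ℂ) : tr 0 p = p := by simp [tr]

def Bad : Set ℂ := {ξ | fA ξ = 0 ∨ 4 * fB ξ ^ 3 + 432 * fA ξ = 0 ∨ 4 * fB ξ ^ 3 - 432 * fA ξ = 0}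

lemma countable_of_poly (q : Polynomial ℂ) (hq : q.eval 1 ≠ 0) (S : Set ℂ)
    (h : ∀ ξ ∈ S, q.eval (Complex.exp ξ) = 0) : S.Countable := by
  classical
  have hq0 : q ≠ 0 := by rintro rfl; simp at hq
  have : (↑q.roots.toFinset : Set ℂ).Countable := (q.roots.toFinset.finite_toSet).countable
  refine this.preimage_cexp.mono fun ξ hξ => ?_
  simp [hq0, Polynomial.IsRoot, h ξ hξ]

lemma fA_exp (ξ : ℂ) : 32 * Complex.exp ξ ^ 3 * fA ξ =
    (Complex.exp ξ ^ 2 + 1) ^ 3 + 12 * Complex.exp ξ ^ 2 * (Complex.exp ξ ^ 2 + 1) := by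
  unfold fA Complex.cosh
  rw [Complex.exp_neg]
  have := Complex.exp_ne_zero ξ
  field_simp
  ring

lemma fB_exp (ξ : ℂ) : 2 * Complex.exp ξ * fB ξ = 3 * (Complex.exp ξ ^ 2 - 1) := by
  unfold fB Complex.sinh
  rw [Complex.exp_neg]
  have := Complex.exp_ne_zero ξ
  field_simp

open Polynomial in
lemma countable_Bad : Bad.Countable := by
  have h1 : {ξ | fA ξ = 0}.Countable := by
    refine countable_of_poly ((X ^ 2 + 1) ^ 3 + 12 * X ^ 2 * (X ^ 2 + 1)) (by simp; norm_num) _ fun ξ hξ => ?_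
    have h := fA_exp ξ
    rw [show fA ξ = 0 from hξ, mul_zero] at h
    simp [← h]
  have h2 : {ξ | 4 * fB ξ ^ 3 + 432 * fA ξ = 0}.Countable := by
    refine countable_of_poly ((X ^ 2 - 1) ^ 3 + ((X ^ 2 + 1) ^ 3 + 12 * X ^ 2 * (X ^ 2 + 1))) (by simp; norm_num) _ fun ξ hξ => ?_
    have h := fA_exp ξ
    have h' := fB_exp ξ
    have h3 : 4 * fB ξ ^ 3 + 432 * fA ξ = 0 := hξ
    simp
    linear_combination -h + (2/27)*(Complex.exp ξ ^ 3 * h3) - (1/27)*((2 * Complex.exp ξ * fB ξ)^2 + (2 * Complex.exp ξ * fB ξ) * (3 * (Complex.exp ξ ^ 2 - 1)) + (3 * (Complex.exp ξ ^ 2 - 1))^2) * h'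
  have h3 : {ξ | 4 * fB ξ ^ 3 - 432 * fA ξ = 0}.Countable := by
    refine countable_of_poly ((X ^ 2 - 1) ^ 3 - ((X ^ 2 + 1) ^ 3 + 12 * X ^ 2 * (X ^ 2 + 1))) (by simp; norm_num) _ fun ξ hξ => ?_
    have h := fA_exp ξ
    have h' := fB_exp ξ
    have h3 : 4 * fB ξ ^ 3 - 432 * fA ξ = 0 := hξ
    simp
    linear_combination h + (2/27)*(Complex.exp ξ ^ 3 * h3) - (1/27)*((2 * Complex.exp ξ * fB ξ)^2 + (2 * Complex.exp ξ * fB ξ) * (3 * (Complex.exp ξ ^ 2 - 1)) + (3 * (Complex.exp ξ ^ 2 - 1))^2) * h'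
  exact h1.union (h2.union h3)

lemma zero_not_Bad : (0 : ℂ) ∉ Bad := by
  simp [Bad, fA, fB]; norm_num

lemma nondeg {P : ℂ × ℂ} (hP : P ∉ Y) (hB : P.1 ∉ Bad) : dE P ≠ 0 := by
  intro h0
  have hx := Complex.exp_ne_zero P.2
  simp only [Bad, mem_ofPred_eq, not_or] at hB
  obtain ⟨hA, h1, h2⟩ := hB
  simp only [Y, mem_ofPred_eq, not_and_or, not_not] at hP
  have hBx : fB P.1 = -3 * fA P.1 * Complex.exp P.2 ^ 2 := by
    have : Complex.exp P.2 * (fB P.1 + 3 * fA P.1 * Complex.exp P.2 ^ 2) = 0 := by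
      rw [dE] at h0; linear_combination h0
    rcases mul_eq_zero.1 this with h | h
    · exact absurd h hx
    · linear_combination h
  rcases hP with h | h
  · apply h1
    rw [f, hBx] at h
    rw [hBx]
    linear_combination (-27 * fA P.1) * (-2 * fA P.1 * Complex.exp P.2 ^ 3 + 4) * h
  · apply h2
    rw [f, hBx] at h
    rw [hBx]
    linear_combination (-27 * fA P.1) * (-2 * fA P.1 * Complex.exp P.2 ^ 3 + 4 * Complex.I) * h + (-27 * fA P.1) * 16 * Complex.I_sq

lemma finite_ray (P : ℂ × ℂ) : {r : ℝ | sh P r ∉ Y}.Finite := by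
  have h1 := ((finite_cubic (fA P.1 * Complex.exp P.2 ^ 3) (fB P.1 * Complex.exp P.2) 4 (by norm_num)).union
    (finite_cubic (fA P.1 * Complex.exp P.2 ^ 3) (fB P.1 * Complex.exp P.2) (4 * Complex.I) (by simp)))
  refine (h1.preimage (f := fun r : ℝ => (Real.exp (-r) : ℂ)) ?_).subset ?_
  · intro a _ b _ hab
    have := Real.exp_injective (Complex.ofReal_injective hab)
    linarith
  · intro r hr
    simp only [Y, mem_ofPred_eq, not_and_or, not_not, f_sh] at hr
    exact hr

lemma small_left (P : ℂ × ℂ) : ∃ r0 > 0, ∀ r, 0 < r → r < r0 → sh P r ∈ Y := by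
  have hf : ({r : ℝ | sh P r ∉ Y} \ {0}).Finite := (finite_ray P).subset sdiff_subset
  have ho : ({r : ℝ | sh P r ∉ Y} \ {0})ᶜ ∈ 𝓝 (0 : ℝ) := hf.isClosed.isOpen_compl.mem_nhds (by simp)
  obtain ⟨ε, hε, hb⟩ := Metric.mem_nhds_iff.1 ho
  refine ⟨ε, hε, fun r h0 h1 => ?_⟩
  by_contra hcon
  exact hb (show r ∈ Metric.ball 0 ε by simpa [abs_of_pos h0] using h1) ⟨hcon, h0.ne'⟩

lemma bound_slice {x : ℂ} (hx : fA x ≠ 0) : ∃ R : ℝ, ∀ᶠ y in 𝓝 x, ∀ η : ℂ, (y, η) ∉ Y → |η.re| ≤ R := by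
  have ha : 0 < ‖fA x‖ := norm_pos_iff.2 hx
  have e1 : ∀ᶠ y in 𝓝 x, ‖fA x‖ / 2 < ‖fA y‖ := continuous_fA.norm.continuousAt.eventually (lt_mem_nhds (by linarith))
  have e2 : ∀ᶠ y in 𝓝 x, ‖fA y‖ < ‖fA x‖ + 1 := continuous_fA.norm.continuousAt.eventually (gt_mem_nhds (by linarith))
  have e3 : ∀ᶠ y in 𝓝 x, ‖fB y‖ < ‖fB x‖ + 1 := continuous_fB.norm.continuousAt.eventually (gt_mem_nhds (by linarith))
  set a := ‖fA x‖
  set b := ‖fB x‖ with hb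
  have hb0 : 0 ≤ b := norm_nonneg _
  obtain ⟨R, hR⟩ : ∃ R : ℝ, 0 ≤ R ∧ (5 + b) / (a / 2) ≤ Real.exp R ∧ (a + b + 2) / 4 ≤ Real.exp R := by
    refine ⟨max 0 (max ((5 + b) / (a / 2)) ((a + b + 2) / 4)), le_max_left _ _, ?_, ?_⟩
    · refine le_trans ?_ (Real.add_one_le_exp _)
      have : (5 + b) / (a / 2) ≤ max 0 (max ((5 + b) / (a / 2)) ((a + b + 2) / 4)) := (le_max_left _ _).trans (le_max_right _ _)
      linarith
    · refine le_trans ?_ (Real.add_one_le_exp _)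
      have : (a + b + 2) / 4 ≤ max 0 (max ((5 + b) / (a / 2)) ((a + b + 2) / 4)) := (le_max_right _ _).trans (le_max_right _ _)
      linarith
  obtain ⟨hR0, hR1, hR2⟩ := hR
  refine ⟨R, ?_⟩
  filter_upwards [e1, e2, e3] with y h1 h2 h3 η hη
  have hn : ‖fA y * Complex.exp η ^ 3 + fB y * Complex.exp η‖ = 4 := by
    simp only [Y, mem_ofPred_eq, not_and_or, not_not, f] at hη
    rcases hη with h | h <;> rw [h] <;> simp
  set t := Real.exp η.re with ht
  have htp : 0 < t := Real.exp_pos _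
  have hnt : ‖Complex.exp η‖ = t := Complex.norm_exp η
  have k1 : 4 ≤ ‖fA y‖ * t ^ 3 + ‖fB y‖ * t := by
    rw [← hn, ← hnt, ← norm_pow, ← norm_mul, ← norm_mul]
    exact norm_add_le _ _
  have k2 : ‖fA y‖ * t ^ 3 ≤ 4 + ‖fB y‖ * t := by
    have := norm_sub_le (fA y * Complex.exp η ^ 3 + fB y * Complex.exp η) (fB y * Complex.exp η)
    rw [add_sub_cancel_right, hn, norm_mul, norm_mul, norm_pow, hnt] at this
    exact this
  have hfy := norm_nonneg (fB y)
  rw [abs_le]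
  constructor
  · rw [← Real.exp_le_exp, ← ht, Real.exp_neg]
    by_cases h : t ≤ 1
    · have t3 : t ^ 3 ≤ t := by nlinarith [pow_pos htp 2]
      have : 4 ≤ (a + b + 2) * t := by nlinarith
      rw [inv_le_comm₀ (Real.exp_pos _) htp]
      refine le_trans ?_ hR2
      rw [inv_eq_one_div, div_le_div_iff₀ htp (by norm_num)]
      linarith
    · push Not at h
      refine le_trans ?_ h.le
      exact inv_le_one_of_one_le₀ (Real.one_le_exp hR0)
  · rw [← Real.exp_le_exp, ← ht]
    by_cases h : t ≤ 1
    · exact h.trans (Real.one_le_exp hR0)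
    · push Not at h
      refine le_trans ?_ hR1
      rw [le_div_iff₀ (by linarith)]
      have h6 : ‖fA y‖ * t ^ 3 ≤ (5 + b) * t := by nlinarith
      have h7 : a / 2 * t ^ 3 ≤ (5 + b) * t := le_trans (by gcongr) h6
      have h8 : a / 2 * t ^ 2 ≤ 5 + b := by
        by_contra hcon
        push Not at hcon
        nlinarith
      nlinarith [mul_pos ha htp]

lemma preconn_ball_diff (c : ℂ) (r : ℝ) {B : Set ℂ} (hB : B.Countable) : IsPreconnected (Metric.ball c r \ B) := by
  rcases le_or_gt r 0 with hr | hr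
  · rw [Metric.ball_eq_empty.2 hr, empty_sdiff]; exact isPreconnected_empty
  let e := OpenPartialHomeomorph.univBall c r
  have hs : e.source = univ := OpenPartialHomeomorph.univBall_source c r
  have ht : e.target = Metric.ball c r := OpenPartialHomeomorph.univBall_target c hr
  have hinj : Function.Injective e := by
    have := e.injOn; rw [hs] at this; exact injOn_univ.1 this
  have hc : (e ⁻¹' B).Countable := hB.preimage_of_injOn hinj.injOn
  have hp : IsPreconnected ((e ⁻¹' B)ᶜ) :=
    (hc.isConnected_compl_of_one_lt_rank (by simp [Complex.rank_real_complex])).isPreconnected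
  have hcont : Continuous e := by
    have := e.continuousOn; rw [hs] at this; exact continuousOn_univ.1 this
  convert hp.image e hcont.continuousOn using 1
  rw [← preimage_compl, image_preimage_eq_inter_range, ← ht]
  have : range e = e.target := by rw [← image_univ, ← hs]; exact e.image_source_eq_target.symm ▸ rfl
  rw [this, sdiff_eq, inter_comm]

theorem global {E : Set (ℂ × ℂ)} (hE : Good E) (hinv : ∀ n p, tr n p ∈ E ↔ p ∈ E)
    (h0 : ∀ P, P ∉ Y → P.1 = 0 → Filled E P) : Y ⊆ E := by
  set GP : ℂ → Prop := fun x => ∀ P, P.1 = x → P ∉ Y → Filled E P with hGP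
  have hFtr : ∀ n P, Filled E (tr n P) → Filled E P := by
    rintro n P ⟨r0, hr0, h⟩
    refine ⟨r0, hr0, fun r h1 h2 => ?_⟩
    have := h r h1 h2
    rwa [tr_sh, hinv] at this
  have hsl : ∀ x, GP x → ∀ p ∈ Y, p.1 = x → p ∈ E := by
    intro x hx p hp hpx
    exact FL hE hp fun r hr hY => hx _ hpx hY
  have hopen : ∀ x ∉ Bad, GP x → ∀ᶠ y in 𝓝 x, GP y := by
    intro x hxB hx
    have hA : fA x ≠ 0 := fun h => hxB (Or.inl h)
    obtain ⟨R, hR⟩ := bound_slice hA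
    set O : Set (ℂ × ℂ) := interior {p | p ∉ Y → Filled E p} with hO
    have hxO : ∀ η : ℂ, (x, η) ∈ O := by
      intro η
      by_cases hY : (x, η) ∈ Y
      · exact mem_interior.2 ⟨Y, fun p hp h => absurd hp h, isOpen_Y, hY⟩
      · obtain ⟨r0, hr0, hleft⟩ := small_left (x, η)
        obtain ⟨U, hUo, hPU, hU, -⟩ := claimC hE (nondeg hY hxB) hY hr0
          (fun r h1 h2 => hsl x hx _ (hleft r h1 h2) rfl)
        exact mem_interior.2 ⟨U, fun Q hQ hQY => hU _ hPU Q hQ hY hQY (hx _ rfl hY), hUo, hPU⟩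
    have hK : IsCompact (Icc (-R) R ×ℂ Icc 0 (2 * Real.pi)) := isCompact_Icc.reProdIm isCompact_Icc
    obtain ⟨V, W, hVo, hWo, hxV, hKW, hVW⟩ := generalized_tube_lemma (isCompact_singleton (x := x)) hK
      (isOpen_interior : IsOpen O) (by
        rintro ⟨a, b⟩ ⟨ha, hb⟩
        obtain rfl : a = x := ha
        exact hxO b)
    filter_upwards [hR, hVo.mem_nhds (hxV rfl)] with y hy hyV
    rintro ⟨y', η⟩ rfl hY
    obtain ⟨n, hn⟩ : ∃ n : ℤ, (η + n * (2 * Real.pi * Complex.I)).im ∈ Icc 0 (2 * Real.pi) := by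
      have h2 : (0 : ℝ) < 2 * Real.pi := by positivity
      have e := existsUnique_add_zsmul_mem_Ico h2 η.im 0
      obtain ⟨n, hn, -⟩ := e
      refine ⟨n, ?_⟩
      have e2 : (η + n * (2 * Real.pi * Complex.I)).im = η.im + n • (2 * Real.pi) := by simp
      rw [e2]
      exact ⟨hn.1, by simpa using hn.2.le⟩
    apply hFtr n
    have hY' : tr n (y', η) ∉ Y := by rwa [tr_mem_Y]
    have hre := hy _ hY'
    have hmem : tr n (y', η) ∈ O := hVW ⟨hyV, hKW ⟨abs_le.1 hre, hn⟩⟩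
    exact interior_subset hmem hY'
  have hclosed : ∀ x ∉ Bad, ¬ GP x → ∀ᶠ y in 𝓝 x, ¬ GP y := by
    intro x hxB hx
    simp only [hGP, not_forall] at hx
    obtain ⟨P, rfl, hPY, hPF⟩ := hx
    set T : Set ℝ := {r | 0 ≤ r ∧ sh P r ∉ Y ∧ ¬ Filled E (sh P r)} with hT
    have hTf : T.Finite := (finite_ray P).subset fun r hr => hr.2.1
    obtain ⟨r, hrT, hrmax⟩ := hTf.exists_maximal ⟨0, le_rfl, by simpa using hPY, by simpa using hPF⟩
    have hrmax' : ∀ s ∈ T, s ≤ r := fun s hs => by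
      by_contra hcon
      exact hcon (hrmax hs (le_of_not_ge hcon))
    set P1 := sh P r with hP1
    obtain ⟨r0, hr0, hleft⟩ := small_left P1
    obtain ⟨U, hUo, hPU, hU, hev⟩ := claimC hE (nondeg hrT.2.1 hxB) hrT.2.1 hr0
      (fun t h1 h2 => FL hE (hleft t h1 h2) fun s hs hsY => by
        by_contra hcon
        rw [sh_sh, sh_sh] at hsY hcon
        have := hrmax' _ ⟨by linarith [hrT.1], hsY, hcon⟩
        linarith)
    filter_upwards [hev] with y hy hGy
    obtain ⟨Q, hQU, hQY, hQy⟩ := hy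
    exact hrT.2.2 (hU Q hQU _ hPU hQY hrT.2.1 (hGy Q hQy hQY))
  have hpre : IsPreconnected (Badᶜ) :=
    (countable_Bad.isConnected_compl_of_one_lt_rank (by simp [Complex.rank_real_complex])).isPreconnected
  have hall : ∀ x ∉ Bad, GP x := by
    intro x hx
    refine hpre.induction₂' (fun a b => GP a → GP b) ?_ ?_ (x := 0) (y := x) zero_not_Bad hx
      (fun P h hY => h0 P hY h)
    · intro a ha
      by_cases h : GP a
      · filter_upwards [mem_nhdsWithin_of_mem_nhds (hopen a ha h)] with b hb
        exact ⟨fun _ => hb, fun _ => h⟩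
      · filter_upwards [mem_nhdsWithin_of_mem_nhds (hclosed a ha h)] with b hb
        exact ⟨fun h' => absurd h' h, fun h' => absurd h' hb⟩
    · intro a b c _ _ _ h1 h2 h3
      exact h2 (h1 h3)
  rintro ⟨ξ, η⟩ hp
  obtain ⟨ε, hε, hb⟩ := Metric.isOpen_iff.1 isOpen_Y _ hp
  have hM : IsPreconnected ((Metric.ball ξ ε \ Bad) ×ˢ Metric.ball η ε) :=
    (preconn_ball_diff ξ ε countable_Bad).prod (convex_ball η ε).isPreconnected
  refine hE.g3 (ξ, η) ε hb _ ?_ hM (Metric.ball (ξ, η) ε) subset_rfl Metric.isOpen_ball ?_ (Metric.mem_ball_self hε)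
  · rintro ⟨a, b⟩ ⟨h1, h2⟩
    have hab : (a, b) ∈ Metric.ball (ξ, η) ε := by
      rw [← ball_prod_same]; exact ⟨h1.1, h2⟩
    exact ⟨hsl a (hall a h1.2) _ (hb hab) rfl, hab⟩
  · rw [closure_prod_eq, ← ball_prod_same]
    refine prod_mono ?_ subset_closure
    exact (countable_Bad.dense_compl ℝ).open_subset_closure_inter Metric.isOpen_ball

end S15

namespace S15

open Set Filter Topology

lemma continuous_tr (n : ℤ) : Continuous (tr n) := by
  unfold tr; fun_prop

lemma dist_tr (n : ℤ) (p q : ℂ × ℂ) : dist (tr n p) (tr n q) = dist p q := by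
  simp [tr, Prod.dist_eq]

lemma tr_mem_Y0 (n : ℤ) (p : ℂ × ℂ) : tr n p ∈ Y0 ↔ p ∈ Y0 := by
  simp only [Y0, mem_ofPred_eq, tr_sh, tr_mem_Y]

lemma tr_neg (n : ℤ) (p : ℂ × ℂ) : tr n (tr (-n) p) = p := by
  rw [tr_tr, add_neg_cancel, tr_zero]

lemma tr_neg' (n : ℤ) (p : ℂ × ℂ) : tr (-n) (tr n p) = p := by
  rw [tr_tr, neg_add_cancel, tr_zero]

lemma Good.tr {E} (hE : Good E) (n : ℤ) : Good (tr n ⁻¹' E) where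
  isOpen := hE.isOpen.preimage (continuous_tr n)
  sub := fun p hp => (tr_mem_Y n p).1 (hE.sub hp)
  y0sub := fun p hp => hE.y0sub ((tr_mem_Y0 n p).2 hp)
  g3 := by
    intro κ ε hV M hM hMp N hN hNo hNM p hp
    refine hE.g3 (S15.tr n κ) ε ?_ (S15.tr n '' M) ?_ (hMp.image _ (continuous_tr n).continuousOn)
      (S15.tr (-n) ⁻¹' N) ?_ (hNo.preimage (continuous_tr _)) ?_ (by simpa [tr_neg'] using hp)
    · intro q hq
      rw [← tr_neg n q, tr_mem_Y]
      apply hV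
      rw [Metric.mem_ball, ← dist_tr n, tr_neg]
      exact hq
    · rintro _ ⟨q, hq, rfl⟩
      refine ⟨(hM hq).1, ?_⟩
      rw [Metric.mem_ball, dist_tr]
      exact (hM hq).2
    · intro q hq
      have := hN hq
      rw [Metric.mem_ball, ← dist_tr n, tr_neg] at this
      exact this
    · intro q hq
      have := hNM hq
      have h2 := image_closure_subset_closure_image (continuous_tr n) (s := M) (mem_image_of_mem _ this)
      rwa [tr_neg] at h2
  g4 := by
    intro p r1 hr1 h1 h2
    refine hE.g4 _ r1 hr1 (fun r h3 h4 => ?_) ?_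
    · rw [tr_sh, tr_mem_Y]; exact h1 r h3 h4
    · rw [tr_sh]; exact h2

def star (E : Set (ℂ × ℂ)) : Set (ℂ × ℂ) := interior {p | ∀ n, tr n p ∈ E}

lemma star_sub (E : Set (ℂ × ℂ)) (n : ℤ) : star E ⊆ tr n ⁻¹' E := fun _ hp => interior_subset hp n

lemma star_of_open {E N : Set (ℂ × ℂ)} (hN : IsOpen N) (h : ∀ n, N ⊆ tr n ⁻¹' E) : N ⊆ star E :=
  interior_maximal (fun _ hp n => h n hp) hN

lemma star_inv (E : Set (ℂ × ℂ)) (m : ℤ) {p : ℂ × ℂ} (hp : p ∈ star E) : tr m p ∈ star E := by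
  refine star_of_open (N := tr (-m) ⁻¹' star E) (isOpen_interior.preimage (continuous_tr _)) ?_ (by
    simpa [tr_neg'] using hp)
  intro n q hq
  have := star_sub E (n + m) hq
  rw [mem_preimage, tr_tr] at this
  simpa using this

lemma Good.star {E} (hE : Good E) : Good (star E) where
  isOpen := isOpen_interior
  sub := fun p hp => (hE.tr 0).sub (star_sub E 0 hp)
  y0sub := star_of_open isOpen_Y0 fun n => (hE.tr n).y0sub
  g3 := by
    intro κ ε hV M hM hMp N hN hNo hNM
    exact star_of_open hNo fun n => (hE.tr n).g3 κ ε hV M (fun p hp => ⟨star_sub E n (hM hp).1, (hM hp).2⟩) hMp N hN hNo hNM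
  g4 := by
    intro p r1 hr1 h1 h2
    obtain ⟨ε, hε, hb⟩ := tube isOpen_Y h1
    have hc : Continuous (fun q : ℂ × ℂ => sh q r1) := continuous_sh.comp (by fun_prop : Continuous fun q : ℂ × ℂ => (q, r1))
    refine star_of_open (N := Metric.ball p ε ∩ (fun q => sh q r1) ⁻¹' S15.star E)
      (Metric.isOpen_ball.inter (isOpen_interior.preimage hc)) ?_ ⟨Metric.mem_ball_self hε, h2⟩
    intro n q hq
    exact (hE.tr n).g4 q r1 hr1 (hb q hq.1) (star_sub E n hq.2)

lemma f_zero (η : ℂ) : f (0, η) = Complex.exp η ^ 3 := by simp [f, fA, fB]; norm_num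

lemma slice_VC {P : ℂ × ℂ} (hP : P ∉ Y) (h0 : P.1 = 0) : P ∈ VC := by
  obtain ⟨a, η⟩ := P
  obtain rfl : a = 0 := h0
  refine ⟨hP, ?_, ?_⟩
  · have := Complex.exp_ne_zero η
    have e : fA 0 = 1 := by simp [fA]; norm_num
    simp [dE, fB, e]
  · intro r hr
    apply mem_Y_of_norm
    rw [sh, f_zero, Complex.exp_sub, div_pow, norm_div]
    have : ‖Complex.exp η ^ 3‖ = 4 := by
      rw [← f_zero]
      simp only [Y, mem_ofPred_eq, not_and_or, not_not] at hP
      rcases hP with h | h <;> rw [h] <;> simp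
    rw [this, norm_pow, Complex.norm_exp, Complex.ofReal_re]
    have h1 : 1 < Real.exp r := Real.one_lt_exp_iff.2 hr
    rw [div_lt_iff₀ (by positivity)]
    have : 1 < Real.exp r ^ 3 := one_lt_pow₀ h1 (by norm_num)
    linarith

theorem global' {E : Set (ℂ × ℂ)} (hE : Good E)
    (h0 : ∀ P, P ∉ Y → P.1 = 0 → Filled E P) : Y ⊆ E := by
  have : Y ⊆ star E := by
    refine global hE.star (fun n p => ⟨fun h => ?_, star_inv E n⟩) ?_
    · have := star_inv E (-n) h
      rwa [tr_neg'] at this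
    · intro P hPY hP0
      have hV := slice_VC hPY hP0
      obtain ⟨g, r1, δ, hL⟩ := exists_Loc isOpen_Y0 (fun p r1 _ h1 h2 => Y0_of_sh h1 h2) hV.2.1 hPY one_pos
        (fun r h1 _ => VC.left hV h1)
      refine ⟨r1, hL.r1pos, fun r h1 h2 => ?_⟩
      obtain ⟨ε, hε, V, hVp, hVY, hN, hg, hS, -⟩ := hL.box (Metric.mem_ball_self hL.δpos) h1 h2
      have e : (P.1, g P.1 + r) = sh P (-r) := by simp [sh, hL.base]
      have hκN : (P.1, g P.1 + r) ∈ Nbox g P.1 r ε := Nbox_mem (Metric.mem_ball_self hε) (by simpa using hε)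
      rw [← e]
      refine star_of_open (isOpen_Nbox hg) (fun n => ?_) hκN
      refine (hE.tr n).box hVY hN hg (fun p hp hi => (hE.tr n).y0sub (hS p hp hi)) hκN (by simp) ?_
      have hκY : (P.1, g P.1 + r) ∈ Y := hVY (Metric.mem_ball_self hVp)
      refine FL hE ((tr_mem_Y n _).2 hκY) fun s hs hsY => h0 _ hsY hP0
  intro p hp
  simpa [tr_zero] using star_sub E 0 (this hp)

end S15

namespace S15

open Set Filter Topology

noncomputable def Pt (α β : ℂ) : ℂ × ℂ := ((β - α) / 2, (α + β) / 2)

lemma continuous_Pt : Continuous (fun q : ℂ × ℂ => Pt q.1 q.2) := by unfold Pt; fun_prop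

lemma fA_Pt (α β : ℂ) : fA (Pt α β).1 * Complex.exp (Pt α β).2 ^ 3 =
    ((Complex.exp α + Complex.exp β) / 2) ^ 3 - 3 * ((Complex.exp α + Complex.exp β) / 2) *
      ((Complex.exp β - Complex.exp α) / 4) ^ 2 := by
  have h1 : Complex.exp α = Complex.exp (α / 2) ^ 2 := by rw [← Complex.exp_nat_mul]; congr 1; push_cast; ring
  have h2 : Complex.exp β = Complex.exp (β / 2) ^ 2 := by rw [← Complex.exp_nat_mul]; congr 1; push_cast; ring
  have e1 : Complex.exp ((β - α) / 2) = Complex.exp (β / 2) / Complex.exp (α / 2) := by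
    rw [← Complex.exp_sub]; congr 1; ring
  have e2 : Complex.exp (-((β - α) / 2)) = Complex.exp (α / 2) / Complex.exp (β / 2) := by
    rw [← Complex.exp_sub]; congr 1; ring
  have e3 : Complex.exp ((α + β) / 2) = Complex.exp (α / 2) * Complex.exp (β / 2) := by
    rw [← Complex.exp_add]; congr 1; ring
  have n1 := Complex.exp_ne_zero (α / 2)
  have n2 := Complex.exp_ne_zero (β / 2)
  simp only [fA, Pt, Complex.cosh, e1, e2, e3]
  rw [h1, h2]
  generalize Complex.exp (α / 2) = x at *
  generalize Complex.exp (β / 2) = y at *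
  field_simp
  ring

lemma fB_Pt (α β : ℂ) : fB (Pt α β).1 * Complex.exp (Pt α β).2 =
    6 * ((Complex.exp β - Complex.exp α) / 4) := by
  have h1 : Complex.exp α = Complex.exp (α / 2) ^ 2 := by rw [← Complex.exp_nat_mul]; congr 1; push_cast; ring
  have h2 : Complex.exp β = Complex.exp (β / 2) ^ 2 := by rw [← Complex.exp_nat_mul]; congr 1; push_cast; ring
  have e1 : Complex.exp ((β - α) / 2) = Complex.exp (β / 2) / Complex.exp (α / 2) := by
    rw [← Complex.exp_sub]; congr 1; ring
  have e2 : Complex.exp (-((β - α) / 2)) = Complex.exp (α / 2) / Complex.exp (β / 2) := by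
    rw [← Complex.exp_sub]; congr 1; ring
  have e3 : Complex.exp ((α + β) / 2) = Complex.exp (α / 2) * Complex.exp (β / 2) := by
    rw [← Complex.exp_add]; congr 1; ring
  have n1 := Complex.exp_ne_zero (α / 2)
  have n2 := Complex.exp_ne_zero (β / 2)
  simp only [fB, Pt, Complex.sinh, e1, e2, e3]
  rw [h1, h2]
  generalize Complex.exp (α / 2) = x at *
  generalize Complex.exp (β / 2) = y at *
  field_simp
  ring

def Vis (u : ℂ) : Prop := ¬(u.im = 0 ∧ 1 ≤ u.re) ∧ (u.im ≤ 2/3 ∨ 0 ≤ u.re)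

lemma VC_of_vis {P : ℂ × ℂ} {u : ℂ} (h4 : f P = 4) (hu : fB P.1 * Complex.exp P.2 = 6 * u) (hv : Vis u) : P ∈ VC := by
  have hA : fA P.1 * Complex.exp P.2 ^ 3 = 4 - 6 * u := by
    rw [f, hu] at h4
    linear_combination h4
  refine ⟨fun h => h.1 h4, ?_, ?_⟩
  · have : dE P = 12 - 12 * u := by
      unfold dE
      linear_combination 3 * hA + hu
    rw [this]
    intro h0
    have : u = 1 := by linear_combination (-1/12 : ℂ) * h0
    exact hv.1 (by simp [this])
  · intro r hr
    have hf := f_sh P r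
    rw [hA, hu] at hf
    set s : ℝ := Real.exp (-r) with hs
    have hs0 : 0 < s := Real.exp_pos _
    have hs1 : s < 1 := by rw [hs, Real.exp_lt_one_iff]; linarith
    have hf' : f (sh P r) = (4 - 6 * u) * (s : ℂ) ^ 3 + 6 * u * s := by
      rw [hf]
    refine ⟨fun h => ?_, fun h => ?_⟩
    · rw [hf'] at h
      have h1 : ((s : ℂ) - 1) * ((4 - 6 * u) * (s * (s + 1)) + 4) = 0 := by linear_combination h
      rcases mul_eq_zero.1 h1 with h2 | h2
      · have : (s : ℂ) = 1 := by linear_combination h2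
        have : s = 1 := by exact_mod_cast this
        linarith
      · have hre := congrArg Complex.re h2
        have him := congrArg Complex.im h2
        simp at hre him
        have hp : 0 < s * (s + 1) := by positivity
        have him' : u.im = 0 := by
          rcases him with h | h
          · exact h
          · rcases h with h | h
            · linarith
            · linarith
        refine hv.1 ⟨him', ?_⟩
        by_contra hc
        push Not at hc
        nlinarith
    · rw [hf'] at h
      have hre := congrArg Complex.re h
      have him := congrArg Complex.im h
      have e3 : (s : ℂ) ^ 3 = ((s ^ 3 : ℝ) : ℂ) := by push_cast; rfl
      rw [e3] at hre him
      simp only [Complex.add_re, Complex.add_im, Complex.re_mul_ofReal, Complex.im_mul_ofReal, Complex.sub_re, Complex.sub_im] at hre him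
      simp at hre him
      have hq : 0 < s * (1 - s ^ 2) := by
        have : s ^ 2 < 1 := by nlinarith
        apply mul_pos hs0; linarith
      have hq1 : s * (1 - s ^ 2) < 1 := by nlinarith [sq_nonneg s, mul_pos hs0 hs0]
      have him2 : u.im * (6 * (s * (1 - s ^ 2))) = 4 := by nlinarith
      have hre2 : u.re * (6 * (s * (1 - s ^ 2))) = - 4 * s ^ 3 := by nlinarith
      rcases hv.2 with h | h
      · nlinarith
      · have : 0 < s ^ 3 := by positivity
        have := mul_nonneg h (by linarith : 0 ≤ 6 * (s * (1 - s ^ 2)))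
        linarith

noncomputable def DD (n : ℂ) : ℂ := 3 * n ^ 2 - n ^ 3 - 2
noncomputable def aa (n : ℂ) : ℂ := (4 * n ^ 3 - 6 * n - 4) / DD n
noncomputable def bb (n : ℂ) : ℂ := 6 * (2 - n) / DD n
noncomputable def uu (n : ℂ) : ℂ := (4 - n ^ 3) / DD n

lemma VC_Pt {α β n : ℂ} (hD : DD n ≠ 0) (ha : Complex.exp α = aa n) (hb : Complex.exp β = bb n) (hv : Vis (uu n)) :
    Pt α β ∈ VC := by
  refine VC_of_vis (u := uu n) ?_ ?_ hv
  · rw [f, fA_Pt, fB_Pt, ha, hb, aa, bb]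
    field_simp
    unfold DD
    ring
  · rw [fB_Pt, ha, hb, aa, bb, uu]
    field_simp
    ring

end S15

namespace S15

open Set Filter Topology

/-- all lifts over n are filled -/
def AF (E : Set (ℂ × ℂ)) (n : ℂ) : Prop := ∀ α β, Complex.exp α = aa n → Complex.exp β = bb n → Filled E (Pt α β)

lemma exists_log_path {g : unitInterval → ℂ} (hg : Continuous g) (h0 : ∀ t, g t ≠ 0) {α : ℂ} (hα : Complex.exp α = g 1) :
    ∃ L : unitInterval → ℂ, Continuous L ∧ (∀ t, Complex.exp (L t) = g t) ∧ L 1 = α := by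
  have hc := Complex.isCoveringMap_exp
  let γ : C(unitInterval, {z : ℂ // z ≠ 0}) := ⟨fun t => ⟨g t, h0 t⟩, by fun_prop⟩
  obtain ⟨L0, hL0⟩ : ∃ z, Complex.exp z = g 0 := ⟨Complex.log (g 0), Complex.exp_log (h0 0)⟩
  have h00 : γ 0 = ⟨Complex.exp L0, Complex.exp_ne_zero _⟩ := Subtype.ext hL0.symm
  let Γ := hc.liftPath γ L0 h00
  have hΓ : ∀ t, Complex.exp (Γ t) = g t := fun t => by
    have := congrFun (hc.liftPath_lifts (γ := γ) (e := L0) (γ_0 := h00)) t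
    exact congrArg Subtype.val this
  refine ⟨fun t => Γ t + (α - Γ 1), by fun_prop, fun t => ?_, by ring⟩
  have : Complex.exp (Γ 1) ≠ 0 := Complex.exp_ne_zero _
  rw [Complex.exp_add, Complex.exp_sub, hα, hΓ, hΓ, div_self (h0 1), mul_one]

lemma AF_path {E} (hE : Good E) {γ : unitInterval → ℂ} (hγ : Continuous γ) (hD : ∀ t, DD (γ t) ≠ 0)
    (ha : ∀ t, aa (γ t) ≠ 0) (hb : ∀ t, bb (γ t) ≠ 0) (hv : ∀ t, Vis (uu (γ t))) (h0 : AF E (γ 0)) : AF E (γ 1) := by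
  intro α β hα hβ
  have hDc : Continuous fun t => DD (γ t) := by unfold DD; fun_prop
  obtain ⟨La, cLa, eLa, La1⟩ := exists_log_path (g := fun t => aa (γ t)) (by unfold aa; exact Continuous.div (by fun_prop) hDc hD) ha hα
  obtain ⟨Lb, cLb, eLb, Lb1⟩ := exists_log_path (g := fun t => bb (γ t)) (by unfold bb; exact Continuous.div (by fun_prop) hDc hD) hb hβ
  have hM : IsPreconnected (range fun t => Pt (La t) (Lb t)) := 
    isPreconnected_range (continuous_Pt.comp (cLa.prodMk cLb))
  have := filled_preconn hE hM (by rintro _ ⟨t, rfl⟩; exact VC_Pt (hD t) (eLa t) (eLb t) (hv t))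
    (mem_range_self 0) (mem_range_self 1) (h0 _ _ (eLa 0) (eLb 0))
  simpa only [La1, Lb1] using this

lemma vis_open {n0 : ℂ} (hD : DD n0 ≠ 0) (h1 : (uu n0).re < 1) (h2 : (uu n0).im = 0) :
    ∀ᶠ n in 𝓝 n0, DD n ≠ 0 ∧ Vis (uu n) := by
  have cD : ContinuousAt DD n0 := by unfold DD; fun_prop
  have cu : ContinuousAt uu n0 := by
    unfold uu
    exact ContinuousAt.div (by fun_prop) cD hD
  have e1 := cD.eventually_ne hD
  have e2 := (Complex.continuous_re.continuousAt.comp cu).eventually_lt continuousAt_const h1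
  have e3 := (Complex.continuous_im.continuousAt.comp cu).eventually_lt (continuousAt_const (y := (2/3 : ℝ))) (by
    simp [h2])
  filter_upwards [e1, e2, e3] with n h1 h2 h3
  exact ⟨h1, fun h => absurd h.2 (not_le.2 h2), Or.inl h3.le⟩

lemma DD_real {n : ℝ} (h1 : 1 < n) (h2 : n ≤ 2) : 0 < 3 * n ^ 2 - n ^ 3 - 2 := by
  have : 3 * n ^ 2 - n ^ 3 - 2 = (n - 1) * (2 + n * (2 - n)) := by ring
  rw [this]
  apply mul_pos (by linarith)
  nlinarith

lemma DD_ofReal (n : ℝ) : DD n = ((3 * n ^ 2 - n ^ 3 - 2 : ℝ) : ℂ) := by unfold DD; push_cast; ring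

lemma uu_ofReal (n : ℝ) : uu n = (((4 - n ^ 3) / (3 * n ^ 2 - n ^ 3 - 2) : ℝ) : ℂ) := by
  unfold uu; rw [DD_ofReal]; push_cast; ring

lemma aa_ofReal (n : ℝ) : aa n = (((4 * n ^ 3 - 6 * n - 4) / (3 * n ^ 2 - n ^ 3 - 2) : ℝ) : ℂ) := by
  unfold aa; rw [DD_ofReal]; push_cast; ring

lemma bb_ofReal (n : ℝ) : bb n = ((6 * (2 - n) / (3 * n ^ 2 - n ^ 3 - 2) : ℝ) : ℂ) := by
  unfold bb; rw [DD_ofReal]; push_cast; ring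

lemma uu_real {n : ℝ} (h1 : 1.42 ≤ n) (h2 : n ≤ 2) : (uu n).re < 1 ∧ (uu n).im = 0 := by
  rw [uu_ofReal]
  refine ⟨?_, Complex.ofReal_im _⟩
  rw [Complex.ofReal_re, div_lt_one (DD_real (by norm_num at h1; linarith) h2)]
  nlinarith

lemma exists_na : ∃ n : ℝ, 1.42 < n ∧ n < 1.5 ∧ 2 * n ^ 3 - 3 * n - 2 = 0 := by
  have hc : ContinuousOn (fun n : ℝ => 2 * n ^ 3 - 3 * n - 2) (Icc 1.42 1.5) := by fun_prop
  have := intermediate_value_Ioo (by norm_num) hc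
  obtain ⟨n, hn, h⟩ := this (show (0 : ℝ) ∈ _ by norm_num)
  exact ⟨n, hn.1, hn.2, h⟩

end S15

namespace S15

open Set Filter Topology

lemma winding {E} (hE : Good E) {n0 σ : ℂ} (mA mB : ℕ) {A B : ℂ → ℂ} (hA : ContinuousAt A 0) (hB : ContinuousAt B 0)
    (hA0 : A 0 ∈ Complex.slitPlane) (hB0 : B 0 ∈ Complex.slitPlane)
    (ha : ∀ᶠ z in 𝓝 (0 : ℂ), aa (n0 + σ * z) = z ^ mA * A z) (hb : ∀ᶠ z in 𝓝 (0 : ℂ), bb (n0 + σ * z) = z ^ mB * B z)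
    (cA : ∀ᶠ z in 𝓝 (0 : ℂ), ContinuousAt A z) (cB : ∀ᶠ z in 𝓝 (0 : ℂ), ContinuousAt B z)
    (hD : DD n0 ≠ 0) (h1 : (uu n0).re < 1) (h2 : (uu n0).im = 0) :
    ∃ ρ > 0, ∀ z : ℂ, z ≠ 0 → ‖z‖ < ρ → ∀ α β, Complex.exp α = aa (n0 + σ * z) → Complex.exp β = bb (n0 + σ * z) →
      (Filled E (Pt α β) ↔ Filled E (Pt (α + mA * (2 * Real.pi * I)) (β + mB * (2 * Real.pi * I)))) := by
  have hv : ∀ᶠ z in 𝓝 (0 : ℂ), DD (n0 + σ * z) ≠ 0 ∧ Vis (uu (n0 + σ * z)) := by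
    have : Tendsto (fun z : ℂ => n0 + σ * z) (𝓝 0) (𝓝 n0) := by
      have : ContinuousAt (fun z : ℂ => n0 + σ * z) 0 := by fun_prop
      simpa [ContinuousAt] using this
    exact this.eventually (vis_open hD h1 h2)
  have sA := hA.eventually (Complex.isOpen_slitPlane.mem_nhds hA0)
  have sB := hB.eventually (Complex.isOpen_slitPlane.mem_nhds hB0)
  obtain ⟨ρ, hρ, H⟩ := Metric.eventually_nhds_iff.1 (hv.and (sA.and (sB.and (ha.and (hb.and (cA.and cB))))))
  refine ⟨ρ, hρ, fun z hz hzρ α β hα hβ => ?_⟩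
  obtain ⟨τ0, rfl⟩ : ∃ τ, Complex.exp τ = z := ⟨_, Complex.exp_log hz⟩
  let T : Set ℂ := {τ | τ.re < Real.log ρ}
  have hT : Convex ℝ T := convex_halfSpace_re_lt _
  have hTn : ∀ τ ∈ T, dist (Complex.exp τ) 0 < ρ := by
    intro τ hτ
    rw [dist_zero_right, Complex.norm_exp]
    exact (Real.lt_log_iff_exp_lt hρ).1 hτ
  have h0T : τ0 ∈ T := by
    rw [Complex.norm_exp] at hzρ
    exact (Real.lt_log_iff_exp_lt hρ).2 hzρ
  set CA := α - (mA * τ0 + Complex.log (A (Complex.exp τ0))) with hCA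
  set CB := β - (mB * τ0 + Complex.log (B (Complex.exp τ0))) with hCB
  let gA : ℂ → ℂ := fun τ => mA * τ + Complex.log (A (Complex.exp τ)) + CA
  let gB : ℂ → ℂ := fun τ => mB * τ + Complex.log (B (Complex.exp τ)) + CB
  have eCA : Complex.exp CA = 1 := by
    obtain ⟨-, s1, s2, a1, b1, -, -⟩ := H (hTn τ0 h0T)
    rw [hCA, Complex.exp_sub, hα, a1, Complex.exp_add, Complex.exp_log (Complex.slitPlane_ne_zero s1), Complex.exp_nat_mul]
    exact div_self (mul_ne_zero (pow_ne_zero _ (Complex.exp_ne_zero _)) (Complex.slitPlane_ne_zero s1))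
  have eCB : Complex.exp CB = 1 := by
    obtain ⟨-, s1, s2, a1, b1, -, -⟩ := H (hTn τ0 h0T)
    rw [hCB, Complex.exp_sub, hβ, b1, Complex.exp_add, Complex.exp_log (Complex.slitPlane_ne_zero s2), Complex.exp_nat_mul]
    exact div_self (mul_ne_zero (pow_ne_zero _ (Complex.exp_ne_zero _)) (Complex.slitPlane_ne_zero s2))
  have hc : ContinuousOn (fun τ => Pt (gA τ) (gB τ)) T := by
    intro τ hτ
    obtain ⟨-, s1, s2, a1, b1, c1, c2⟩ := H (hTn τ hτ)
    have cgA : ContinuousAt gA τ := by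
      have : ContinuousAt (fun τ => A (Complex.exp τ)) τ :=
        ContinuousAt.comp (f := Complex.exp) (g := A) c1 Complex.continuous_exp.continuousAt
      have := this.clog s1
      fun_prop
    have cgB : ContinuousAt gB τ := by
      have : ContinuousAt (fun τ => B (Complex.exp τ)) τ :=
        ContinuousAt.comp (f := Complex.exp) (g := B) c2 Complex.continuous_exp.continuousAt
      have := this.clog s2
      fun_prop
    exact (continuous_Pt.continuousAt.comp (cgA.prodMk cgB)).continuousWithinAt
  have hM : IsPreconnected ((fun τ => Pt (gA τ) (gB τ)) '' T) := hT.isPreconnected.image _ hc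
  have hMV : ((fun τ => Pt (gA τ) (gB τ)) '' T) ⊆ VC := by
    rintro _ ⟨τ, hτ, rfl⟩
    obtain ⟨⟨hD, hv⟩, s1, s2, a1, b1, -, -⟩ := H (hTn τ hτ)
    refine VC_Pt hD ?_ ?_ hv
    · rw [a1, Complex.exp_add, Complex.exp_add, eCA, Complex.exp_log (Complex.slitPlane_ne_zero s1), Complex.exp_nat_mul, mul_one]
    · rw [b1, Complex.exp_add, Complex.exp_add, eCB, Complex.exp_log (Complex.slitPlane_ne_zero s2), Complex.exp_nat_mul, mul_one]
  have h1T : τ0 + 2 * Real.pi * I ∈ T := by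
    show (τ0 + 2 * Real.pi * I).re < _
    have : (τ0 + 2 * Real.pi * I).re = τ0.re := by simp
    rw [this]; exact h0T
  have m0 := mem_image_of_mem (fun τ => Pt (gA τ) (gB τ)) h0T
  have m1 := mem_image_of_mem (fun τ => Pt (gA τ) (gB τ)) h1T
  have q0 : Pt (gA τ0) (gB τ0) = Pt α β := by
    congr 1 <;> simp only [gA, gB, hCA, hCB] <;> ring
  have q1 : Pt (gA (τ0 + 2 * Real.pi * I)) (gB (τ0 + 2 * Real.pi * I)) = Pt (α + mA * (2 * Real.pi * I)) (β + mB * (2 * Real.pi * I)) := by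
    have : Complex.exp (τ0 + 2 * Real.pi * I) = Complex.exp τ0 := Complex.exp_periodic τ0
    congr 1 <;> simp only [gA, gB, hCA, hCB, this] <;> ring
  simp only [q0] at m0
  simp only [q1] at m1
  exact ⟨filled_preconn hE hM hMV m0 m1, filled_preconn hE hM hMV m1 m0⟩

end S15

namespace S15

open Set Filter Topology

def LF (E : Set (ℂ × ℂ)) (k l : ℤ) (n : ℝ) : Prop :=
  Filled E (Pt (Complex.log (aa n) + k * (2 * Real.pi * I)) (Complex.log (bb n) + l * (2 * Real.pi * I)))

lemma aa_pos {na n : ℝ} (h1 : 1.42 < na) (h3 : 2 * na ^ 3 - 3 * na - 2 = 0) (hn : na < n) (hn2 : n < 2) :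
    0 < (4 * n ^ 3 - 6 * n - 4) / (3 * n ^ 2 - n ^ 3 - 2) := by
  norm_num at h1
  apply div_pos _ (DD_real (by linarith) hn2.le)
  have : 4 * n ^ 3 - 6 * n - 4 = (n - na) * (4 * n ^ 2 + 4 * na * n + 4 * na ^ 2 - 6) := by
    linear_combination 2 * h3
  rw [this]
  apply mul_pos (by linarith)
  nlinarith

lemma bb_pos {n : ℝ} (h1 : 1 < n) (hn2 : n < 2) :
    0 < 6 * (2 - n) / (3 * n ^ 2 - n ^ 3 - 2) := 
  div_pos (by linarith) (DD_real h1 hn2.le)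

lemma exp_lift {w : ℂ} (hw : w ≠ 0) (k : ℤ) : Complex.exp (Complex.log w + k * (2 * Real.pi * I)) = w := by
  rw [Complex.exp_add, Complex.exp_log hw, Complex.exp_int_mul_two_pi_mul_I, mul_one]

lemma LF_move {E} (hE : Good E) {na : ℝ} (h1 : 1.42 < na) (h3 : 2 * na ^ 3 - 3 * na - 2 = 0) {k l : ℤ} {n n' : ℝ}
    (hn : n ∈ Ioo na 2) (hn' : n' ∈ Ioo na 2) (h : LF E k l n) : LF E k l n' := by
  have h1' : (1 : ℝ) < na := by norm_num at h1; linarith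
  have sl : ∀ m ∈ Ioo na 2, DD (m : ℂ) ≠ 0 ∧ aa (m : ℂ) ∈ Complex.slitPlane ∧ bb (m : ℂ) ∈ Complex.slitPlane := by
    intro m hm
    refine ⟨?_, ?_, ?_⟩
    · rw [DD_ofReal]; exact_mod_cast (DD_real (h1'.trans hm.1) hm.2.le).ne'
    · rw [aa_ofReal]; exact Complex.ofReal_mem_slitPlane.2 (aa_pos h1 h3 hm.1 hm.2)
    · rw [bb_ofReal]; exact Complex.ofReal_mem_slitPlane.2 (bb_pos (h1'.trans hm.1) hm.2)
  have hc : ContinuousOn (fun m : ℝ => Pt (Complex.log (aa m) + k * (2 * Real.pi * I)) (Complex.log (bb m) + l * (2 * Real.pi * I))) (Ioo na 2) := by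
    intro m hm
    obtain ⟨hD, s1, s2⟩ := sl m hm
    have cD : ContinuousAt (fun m : ℝ => DD m) m := by unfold DD; fun_prop
    have ca : ContinuousAt (fun m : ℝ => aa m) m := by
      unfold aa; exact ContinuousAt.div (by fun_prop) cD hD
    have cb : ContinuousAt (fun m : ℝ => bb m) m := by
      unfold bb; exact ContinuousAt.div (by fun_prop) cD hD
    have := ca.clog s1
    have := cb.clog s2
    exact (continuous_Pt.continuousAt.comp (f := fun m : ℝ => (Complex.log (aa m) + k * (2 * Real.pi * I), Complex.log (bb m) + l * (2 * Real.pi * I))) (by fun_prop)).continuousWithinAt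
  refine filled_preconn hE (isPreconnected_Ioo.image _ hc) ?_ (mem_image_of_mem _ hn) (mem_image_of_mem _ hn') h
  rintro _ ⟨m, hm, rfl⟩
  obtain ⟨hD, s1, s2⟩ := sl m hm
  obtain ⟨u1, u2⟩ := uu_real (h1.le.trans hm.1.le) hm.2.le
  exact VC_Pt hD (exp_lift (Complex.slitPlane_ne_zero s1) k) (exp_lift (Complex.slitPlane_ne_zero s2) l)
    (vis_open hD u1 u2).self_of_nhds.2

lemma LF_all {E} (hE : Good E) {na : ℝ} (h1 : 1.42 < na) (h2 : na < 1.5) (h3 : 2 * na ^ 3 - 3 * na - 2 = 0) {n : ℝ}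
    (hn : n ∈ Ioo na 2) (h : LF E 0 0 n) (k l : ℤ) : LF E k l n := by
  have h1' : (1 : ℝ) < na := by norm_num at h1; linarith
  have h2' : na < 2 := by norm_num at h2; linarith
  have DDc : ∀ z, ContinuousAt DD z := fun z => by unfold DD; fun_prop
  have D1 : DD na ≠ 0 := by rw [DD_ofReal]; exact_mod_cast (DD_real h1' h2'.le).ne'
  have D2 : DD (2 : ℝ) ≠ 0 := by rw [DD_ofReal]; norm_num
  have DDe : ∀ (n0 σ : ℂ), DD n0 ≠ 0 → ∀ᶠ z in 𝓝 (0 : ℂ), DD (n0 + σ * z) ≠ 0 := by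
    intro n0 σ h0
    have : ContinuousAt (fun z : ℂ => DD (n0 + σ * z)) 0 := by unfold DD; fun_prop
    exact this.eventually_ne (by simpa using h0)
  -- invariance in k
  have K : ∀ k l, LF E k l n ↔ LF E (k + 1) l n := by
    obtain ⟨ρ, hρ, H⟩ := winding hE (n0 := na) (σ := 1) 1 0
      (A := fun z => (4 * (na + 1 * z) ^ 2 + 4 * na * (na + 1 * z) + 4 * na ^ 2 - 6) / DD (na + 1 * z))
      (B := fun z => bb (na + 1 * z))
      (by
        refine ContinuousAt.div (by fun_prop) (by unfold DD; fun_prop) (by simpa using D1))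
      (by
        unfold bb
        refine ContinuousAt.div (by fun_prop) (by unfold DD; fun_prop) (by simpa using D1))
      (by
        simp only [mul_zero, add_zero]
        rw [DD_ofReal]
        have : (4 * (na : ℂ) ^ 2 + 4 * na * na + 4 * na ^ 2 - 6) / ((3 * na ^ 2 - na ^ 3 - 2 : ℝ) : ℂ) = 
          (((12 * na ^ 2 - 6) / (3 * na ^ 2 - na ^ 3 - 2) : ℝ) : ℂ) := by push_cast; ring
        rw [this]
        exact Complex.ofReal_mem_slitPlane.2 (div_pos (by nlinarith) (DD_real h1' h2'.le)))
      (by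
        simp only [mul_zero, add_zero]
        rw [bb_ofReal]
        exact Complex.ofReal_mem_slitPlane.2 (bb_pos h1' h2'))
      (by
        have h3' : 2 * (na : ℂ) ^ 3 - 3 * na - 2 = 0 := by exact_mod_cast h3
        refine Eventually.of_forall fun z => ?_
        unfold aa
        rw [pow_one, mul_div_assoc']
        congr 1
        linear_combination 2 * h3')
      (by simp)
      (by
        filter_upwards [DDe na 1 D1] with z hz
        exact ContinuousAt.div (by fun_prop) (by unfold DD; fun_prop) hz)
      (by
        filter_upwards [DDe na 1 D1] with z hz
        unfold bb
        exact ContinuousAt.div (by fun_prop) (by unfold DD; fun_prop) hz)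
      D1 (uu_real h1.le h2'.le).1 (uu_real h1.le h2'.le).2
    set m : ℝ := min ρ (2 - na) / 2 with hm
    have mp : 0 < m := by have := lt_min hρ (by linarith : 0 < 2 - na); positivity
    have m1 : m < ρ := by have := min_le_left ρ (2 - na); linarith
    have m2 : na + m < 2 := by have := min_le_right ρ (2 - na); linarith
    have hmem : na + m ∈ Ioo na 2 := ⟨by linarith, m2⟩
    have e : ((na : ℂ) + 1 * (m : ℂ)) = ((na + m : ℝ) : ℂ) := by push_cast; ring
    have := H m (by exact_mod_cast mp.ne') (by simpa [abs_of_pos mp] using m1)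
    rw [e] at this
    have key : ∀ k l, LF E k l (na + m) ↔ LF E (k + 1) l (na + m) := by
      intro k l
      have h := this _ _ (exp_lift (w := aa ((na + m : ℝ) : ℂ)) ?_ k) (exp_lift (w := bb ((na + m : ℝ) : ℂ)) ?_ l)
      · unfold LF
        rw [h]
        push_cast
        ring_nf
      · rw [aa_ofReal]; exact_mod_cast (aa_pos h1 h3 hmem.1 hmem.2).ne'
      · rw [bb_ofReal]; exact_mod_cast (bb_pos (h1'.trans hmem.1) hmem.2).ne'
    intro k l
    exact ⟨fun h => LF_move hE h1 h3 hmem hn ((key k l).1 (LF_move hE h1 h3 hn hmem h)),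
      fun h => LF_move hE h1 h3 hmem hn ((key k l).2 (LF_move hE h1 h3 hn hmem h))⟩
  have L : ∀ k l, LF E k l n ↔ LF E k (l + 1) n := by
    obtain ⟨ρ, hρ, H⟩ := winding hE (n0 := (2 : ℝ)) (σ := -1) 0 1
      (B := fun z => 6 / DD ((2 : ℝ) + -1 * z))
      (A := fun z => aa ((2 : ℝ) + -1 * z))
      (by
        unfold aa
        refine ContinuousAt.div (by fun_prop) (by unfold DD; fun_prop) (by simpa using D2))
      (by
        refine ContinuousAt.div (by fun_prop) (by unfold DD; fun_prop) (by simpa using D2))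
      (by
        simp only [mul_zero, add_zero]
        rw [aa_ofReal]
        exact Complex.ofReal_mem_slitPlane.2 (by norm_num))
      (by
        simp only [mul_zero, add_zero]
        rw [DD_ofReal]
        have : (6 : ℂ) / ((3 * 2 ^ 2 - 2 ^ 3 - 2 : ℝ) : ℂ) = ((3 : ℝ) : ℂ) := by push_cast; norm_num
        rw [this]
        exact Complex.ofReal_mem_slitPlane.2 (by norm_num))
      (by simp)
      (by
        refine Eventually.of_forall fun z => ?_
        unfold bb
        rw [pow_one, mul_div_assoc']
        congr 1
        push_cast
        ring)
      (by
        filter_upwards [DDe (2 : ℝ) (-1) D2] with z hz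
        unfold aa
        exact ContinuousAt.div (by fun_prop) (by unfold DD; fun_prop) hz)
      (by
        filter_upwards [DDe (2 : ℝ) (-1) D2] with z hz
        exact ContinuousAt.div (by fun_prop) (by unfold DD; fun_prop) hz)
      D2 (uu_real (by norm_num) (by norm_num)).1 (uu_real (by norm_num) (by norm_num)).2
    set m : ℝ := min ρ (2 - na) / 2 with hm
    have mp : 0 < m := by have := lt_min hρ (by linarith : 0 < 2 - na); positivity
    have m1 : m < ρ := by have := min_le_left ρ (2 - na); linarith
    have m2 : na < 2 - m := by have := min_le_right ρ (2 - na); linarith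
    have hmem : 2 - m ∈ Ioo na 2 := ⟨m2, by linarith⟩
    have e : (((2 : ℝ) : ℂ) + -1 * (m : ℂ)) = ((2 - m : ℝ) : ℂ) := by push_cast; ring
    have := H m (by exact_mod_cast mp.ne') (by simpa [abs_of_pos mp] using m1)
    rw [e] at this
    have key : ∀ k l, LF E k l (2 - m) ↔ LF E k (l + 1) (2 - m) := by
      intro k l
      have h := this _ _ (exp_lift (w := aa ((2 - m : ℝ) : ℂ)) ?_ k) (exp_lift (w := bb ((2 - m : ℝ) : ℂ)) ?_ l)
      · unfold LF
        rw [h]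
        push_cast
        ring_nf
      · rw [aa_ofReal]; exact_mod_cast (aa_pos h1 h3 hmem.1 hmem.2).ne'
      · rw [bb_ofReal]; exact_mod_cast (bb_pos (h1'.trans hmem.1) hmem.2).ne'
    intro k l
    exact ⟨fun h => LF_move hE h1 h3 hmem hn ((key k l).1 (LF_move hE h1 h3 hn hmem h)),
      fun h => LF_move hE h1 h3 hmem hn ((key k l).2 (LF_move hE h1 h3 hn hmem h))⟩
  have s1 : ∀ k, LF E k 0 n := by
    intro k
    induction k using Int.induction_on with
    | zero => exact h
    | succ i hi => exact (K _ _).1 hi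
    | pred i hi => rw [K]; simpa using hi
  induction l using Int.induction_on with
  | zero => exact s1 k
  | succ i hi => exact (L _ _).1 hi
  | pred i hi => rw [L]; simpa using hi

end S15

namespace S15

open Set Filter Topology

noncomputable def cc : ℝ := Real.exp (Real.log 4 / 3)

lemma cc3 : cc ^ 3 = 4 := by
  rw [cc, ← Real.exp_nat_mul]
  have : ((3 : ℕ) : ℝ) * (Real.log 4 / 3) = Real.log 4 := by push_cast; ring
  rw [this, Real.exp_log (by norm_num)]

lemma cc_pos : 0 < cc := Real.exp_pos _

lemma cc_lo : 1.58 < cc := by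
  have := cc3; have := cc_pos
  by_contra h
  push Not at h
  norm_num at h
  nlinarith [mul_nonneg (sub_nonneg.2 h) (by nlinarith : 0 ≤ cc ^ 2 + cc * (79/50) + (79/50) ^ 2)]

lemma cc_hi : cc < 1.6 := by
  have := cc3; have := cc_pos
  by_contra h
  push Not at h
  norm_num at h
  nlinarith [mul_nonneg (sub_nonneg.2 h) (by nlinarith : 0 ≤ cc ^ 2 + cc * (8/5) + (8/5) ^ 2)]

set_option maxHeartbeats 1000000 in
lemma circle_facts {C S : ℝ} (h1 : C ^ 2 + S ^ 2 = 1) (hS : 0 ≤ S) (hC : -1/2 ≤ C) {n : ℂ}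
    (hn : n = cc * (C + S * I) ^ 2) : DD n ≠ 0 ∧ aa n ≠ 0 ∧ bb n ≠ 0 ∧ Vis (uu n) := by
  have c3 : (cc : ℂ) ^ 3 = 4 := by exact_mod_cast cc3
  have clo := cc_lo
  have chi := cc_hi
  norm_num at clo chi
  have c2 : 7.48 < 3 * cc ^ 2 := by norm_num; nlinarith
  norm_num at c2
  set q : ℂ := C + S * I with hq
  set p : ℂ := C - S * I with hp
  have h1' : (C : ℂ) ^ 2 + (S : ℂ) ^ 2 = 1 := by exact_mod_cast h1
  have hqp : q * p = 1 := by
    rw [hq, hp]; linear_combination h1' - S ^ 2 * Complex.I_sq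
  have hq0 : q ≠ 0 := left_ne_zero_of_mul_eq_one hqp
  have hqn : ‖q‖ = 1 := by
    have : ‖q‖ ^ 2 = 1 := by
      rw [← Complex.normSq_eq_norm_sq, hq, Complex.normSq_add_mul_I, h1]
    have h0 := norm_nonneg q
    nlinarith
  have hnn : ‖n‖ = cc := by
    rw [hn, norm_mul, norm_pow, hqn, Complex.norm_real, Real.norm_of_nonneg cc_pos.le]; ring
  have hn3 : n ^ 3 = 4 * q ^ 6 := by rw [hn]; linear_combination q ^ 6 * c3
  set R : ℝ := C * (3 * cc ^ 2 + 18 - 24 * C ^ 2) with hR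
  set J : ℝ := S * (3 * cc ^ 2 - 6 + 8 * S ^ 2) with hJ
  set s3 : ℝ := S * (3 - 4 * S ^ 2) with hs3
  have hEq : (R : ℂ) + J * I = 3 * cc ^ 2 * q - 4 * q ^ 3 - 2 * p ^ 3 := by
    apply Complex.ext
    · simp [hR, hJ, hq, hp, pow_succ]
      linear_combination (-18 * C) * h1
    · simp [hR, hJ, hq, hp, pow_succ]
      linear_combination (6 * S) * h1
  have hs3q : 4 * (p ^ 3 - q ^ 3) = -8 * I * s3 := by
    apply Complex.ext
    · simp [hs3, hq, hp, pow_succ]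
      try ring
    · simp [hs3, hq, hp, pow_succ]
      linear_combination (-24 * S) * h1
  have hDE : DD n = q ^ 3 * (R + J * I) := by
    have : q ^ 3 * p ^ 3 = 1 := by rw [← mul_pow, hqp, one_pow]
    rw [hEq]
    unfold DD
    rw [hn3, hn]
    linear_combination 2 * this
  have hRJ : 0 < R ^ 2 + J ^ 2 := by
    rcases hS.eq_or_lt with h | h
    · have hC2 : C ^ 2 = 1 := by rw [← h] at h1; linarith
      have : R ≠ 0 := by
        rw [hR, hC2]
        refine mul_ne_zero (by intro h; rw [h] at hC2; norm_num at hC2) (by nlinarith)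
      positivity
    · have : 0 < J := mul_pos h (by nlinarith)
      positivity
  have hE0 : (R : ℂ) + J * I ≠ 0 := by
    intro h
    have h1 := congrArg Complex.re h
    have h2 := congrArg Complex.im h
    simp at h1 h2
    rw [h1, h2] at hRJ
    norm_num at hRJ
  have hD : DD n ≠ 0 := by rw [hDE]; exact mul_ne_zero (pow_ne_zero _ hq0) hE0
  refine ⟨hD, ?_, ?_, ?_⟩
  · unfold aa
    refine div_ne_zero (fun h => ?_) hD
    have e : 16 * q ^ 6 = 6 * n + 4 := by rw [hn3] at h; linear_combination h
    have e2 := congrArg norm e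
    have e3 : ‖16 * q ^ 6‖ = 16 := by simp [hqn]
    have e4 : ‖6 * n + 4‖ ≤ 6 * cc + 4 := by
      refine (norm_add_le _ _).trans ?_
      simp [hnn]
    linarith
  · unfold bb
    refine div_ne_zero (mul_ne_zero (by norm_num) (fun h => ?_)) hD
    have : n = 2 := by linear_combination -h
    rw [this] at hnn
    norm_num at hnn
    linarith
  · have hu : uu n * (R + J * I) = -8 * I * s3 := by
      rw [← hs3q]
      unfold uu
      rw [hDE, hn3]
      field_simp
      have : q ^ 3 * p ^ 3 = 1 := by rw [← mul_pow, hqp, one_pow]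
      linear_combination (-1 : ℂ) * this
    set u := uu n
    have r1 := congrArg Complex.re hu
    have r2 := congrArg Complex.im hu
    simp at r1 r2
    have q1 : u.re * (R ^ 2 + J ^ 2) = -8 * s3 * J := by linear_combination R * r1 + J * r2
    have q2 : u.im * (R ^ 2 + J ^ 2) = -8 * s3 * R := by linear_combination R * r2 - J * r1
    have hJ0 : 0 ≤ J := mul_nonneg hS (by nlinarith)
    have hRf : 0 < 3 * cc ^ 2 + 18 - 24 * C ^ 2 := by nlinarith [sq_nonneg S]
    by_cases hcase : S ^ 2 < 3/4
    · have hC0 : 0 ≤ C := by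
        by_contra h
        push Not at h
        nlinarith
      have hR0 : 0 ≤ R := mul_nonneg hC0 hRf.le
      have hs0 : 0 ≤ s3 := mul_nonneg hS (by linarith)
      have u1 : u.re ≤ 0 := by
        by_contra h
        push Not at h
        have := mul_pos h hRJ
        linarith [mul_nonneg hs0 hJ0]
      have u2 : u.im ≤ 0 := by
        by_contra h
        push Not at h
        have := mul_pos h hRJ
        linarith [mul_nonneg hs0 hR0]
      exact ⟨fun h => by linarith [h.2], Or.inl (by linarith)⟩
    · push Not at hcase
      have hs0 : s3 ≤ 0 := mul_nonpos_of_nonneg_of_nonpos hS (by linarith)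
      have u1 : 0 ≤ u.re := by
        by_contra h
        push Not at h
        have := mul_neg_of_neg_of_pos h hRJ
        linarith [mul_nonneg (neg_nonneg.2 hs0) hJ0]
      refine ⟨?_, Or.inr u1⟩
      rintro ⟨h0, hge⟩
      rw [h0] at q2
      have : s3 = 0 ∨ R = 0 := by
        have : s3 * R = 0 := by linarith
        exact mul_eq_zero.1 this
      rcases this with h | h
      · rw [h] at q1
        have := mul_pos (by linarith : 0 < u.re) hRJ
        linarith
      · have hC0 : C = 0 := by
          rcases mul_eq_zero.1 h with h | h
          · exact h
          · linarith
        have hS1 : S = 1 := by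
          rw [hC0] at h1; nlinarith
        rw [h] at q1
        have hJ' : J = 3 * cc ^ 2 + 2 := by rw [hJ, hS1]; ring
        have hs' : s3 = -1 := by rw [hs3, hS1]; ring
        rw [hs'] at q1
        have hJ2 : 9 < J := by linarith
        clear_value J R s3 u
        have : u.re * J = 8 := by
          have : (u.re * J - 8) * J = 0 := by linear_combination q1
          rcases mul_eq_zero.1 this with h | h
          · linarith
          · linarith
        have := mul_le_mul_of_nonneg_right hge hJ0
        linarith

end S15

namespace S15

open Set Filter Topology

lemma AF_cc {E} (hE : Good E) (h0 : Filled E (0, ((Real.log 4 / 3 : ℝ) : ℂ))) : AF E cc := by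
  obtain ⟨na, h1, h2, h3⟩ := exists_na
  have clo := cc_lo
  have chi := cc_hi
  have hm : cc ∈ Ioo na 2 := by norm_num at *; constructor <;> linarith
  have c3 := cc3
  have ea : (4 * cc ^ 3 - 6 * cc - 4) / (3 * cc ^ 2 - cc ^ 3 - 2) = cc := by
    rw [div_eq_iff (DD_real (by norm_num at *; linarith) hm.2.le).ne']
    linear_combination (4 + cc - 3) * c3
  have eb : 6 * (2 - cc) / (3 * cc ^ 2 - cc ^ 3 - 2) = cc := by
    rw [div_eq_iff (DD_real (by norm_num at *; linarith) hm.2.le).ne']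
    linear_combination (cc - 3) * c3
  have ea' : aa cc = cc := by rw [aa_ofReal, ea]
  have eb' : bb cc = cc := by rw [bb_ofReal, eb]
  have hlog : Complex.log (cc : ℂ) = ((Real.log 4 / 3 : ℝ) : ℂ) := by
    rw [← Complex.ofReal_log cc_pos.le, cc, Real.log_exp]
  have hL : LF E 0 0 cc := by
    unfold LF
    rw [ea', eb', hlog]
    convert h0 using 1
    simp [Pt]
  intro α β hα hβ
  have cn : (cc : ℂ) ≠ 0 := by exact_mod_cast cc_pos.ne'
  rw [ea', ← Complex.exp_log cn] at hα
  rw [eb', ← Complex.exp_log cn] at hβ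
  obtain ⟨k, rfl⟩ := Complex.exp_eq_exp_iff_exists_int.1 hα
  obtain ⟨l, rfl⟩ := Complex.exp_eq_exp_iff_exists_int.1 hβ
  have := LF_all hE h1 h2 h3 hm hL k l
  unfold LF at this
  rwa [ea', eb'] at this

lemma AF_circle {E} (hE : Good E) (h0 : AF E cc) {φ : ℝ} (h1 : 0 ≤ φ) (h2 : φ ≤ 2 * Real.pi / 3) :
    AF E (cc * Complex.exp (2 * φ * I)) := by
  let γ : unitInterval → ℂ := fun t => cc * (Real.cos (t * φ) + Real.sin (t * φ) * I) ^ 2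
  have hγ : Continuous γ := by
    have := Real.continuous_cos
    have := Real.continuous_sin
    fun_prop
  have hpi := Real.pi_pos
  have F : ∀ t, DD (γ t) ≠ 0 ∧ aa (γ t) ≠ 0 ∧ bb (γ t) ≠ 0 ∧ Vis (uu (γ t)) := by
    intro t
    have ht0 := t.2.1
    have ht1 := t.2.2
    have b1 : 0 ≤ (t : ℝ) * φ := by positivity
    have b2 : (t : ℝ) * φ ≤ 2 * Real.pi / 3 := (mul_le_of_le_one_left h1 ht1).trans h2
    refine circle_facts (C := Real.cos (t * φ)) (S := Real.sin (t * φ)) (Real.cos_sq_add_sin_sq _) 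
      (Real.sin_nonneg_of_nonneg_of_le_pi b1 (by linarith)) ?_ rfl
    have : Real.cos (2 * Real.pi / 3) = -1/2 := by
      have e : 2 * Real.pi / 3 = Real.pi - Real.pi / 3 := by ring
      rw [e, Real.cos_pi_sub, Real.cos_pi_div_three]; norm_num
    rw [← this]
    exact Real.cos_le_cos_of_nonneg_of_le_pi b1 (by linarith) b2
  have := AF_path hE hγ (fun t => (F t).1) (fun t => (F t).2.1) (fun t => (F t).2.2.1) (fun t => (F t).2.2.2)
    (by simpa [γ] using h0)
  convert this using 1
  simp only [γ]
  rw [Complex.ofReal_cos, Complex.ofReal_sin, ← Complex.exp_mul_I, ← Complex.exp_nat_mul]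
  congr 2
  simp
  ring

lemma filled_four {E} (hE : Good E) (h0 : Filled E (0, ((Real.log 4 / 3 : ℝ) : ℂ))) {η : ℂ}
    (h4 : f (0, η) = 4) : Filled E (0, η) := by
  rw [f_zero] at h4
  have hP : (0, η) = Pt η η := by simp [Pt]
  rw [hP]
  have hAF : AF E (Complex.exp η) := by
    have h5 : Complex.exp (3 * (η - (Real.log 4 / 3 : ℝ))) = 1 := by
      have : Complex.exp (3 * (η - (Real.log 4 / 3 : ℝ))) = Complex.exp η ^ 3 / Complex.exp ((Real.log 4 : ℝ) : ℂ) := by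
        rw [← Complex.exp_nat_mul, ← Complex.exp_sub]; congr 1; push_cast; ring
      rw [this, h4, ← Complex.ofReal_exp, Real.exp_log (by norm_num)]; norm_num
    obtain ⟨k, hk⟩ := Complex.exp_eq_one_iff.1 h5
    have hη : η = (Real.log 4 / 3 : ℝ) + k * (2 * Real.pi * I) / 3 := by linear_combination hk / 3
    have hpi := Real.pi_pos
    have h3 : k = 3 * (k / 3) + k % 3 := (Int.mul_ediv_add_emod k 3).symm
    have l0 : 0 ≤ k % 3 := Int.emod_nonneg _ (by norm_num)
    have l1 : k % 3 < 3 := Int.emod_lt_of_pos _ (by norm_num)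
    generalize k / 3 = d at h3
    generalize k % 3 = e at h3 l0 l1
    have := AF_circle hE (AF_cc hE h0) (φ := e * Real.pi / 3) (by positivity) (by
      have : (e : ℝ) ≤ 2 := by exact_mod_cast (by omega : e ≤ 2)
      nlinarith)
    convert this using 1
    rw [cc, Complex.ofReal_exp, ← Complex.exp_add]
    rw [Complex.exp_eq_exp_iff_exists_int]
    refine ⟨d, ?_⟩
    rw [hη, h3]
    push_cast
    ring
  have hD : DD (Complex.exp η) ≠ 0 := by
    unfold DD
    rw [h4]
    intro h
    have e2 : Complex.exp η ^ 2 = 2 := by linear_combination h / 3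
    have : (Complex.exp η ^ 3) ^ 2 = (Complex.exp η ^ 2) ^ 3 := by ring
    rw [h4, e2] at this
    norm_num at this
  refine hAF _ _ ?_ ?_
  · unfold aa
    rw [eq_div_iff hD]
    unfold DD
    linear_combination (-4 - Complex.exp η + 3) * h4
  · unfold bb
    rw [eq_div_iff hD]
    unfold DD
    linear_combination (- Complex.exp η + 3) * h4

end S15

namespace S15

open Set Filter Topology ComplexConjugate

lemma conj4 : conj (4 : ℂ) = 4 := map_ofNat _ 4
lemma conj2 : conj (2 : ℂ) = 2 := map_ofNat _ 2

noncomputable def sg (p : ℂ × ℂ) : ℂ × ℂ := (-(conj p.1), conj p.2 - Real.pi / 2 * I)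

lemma sg_sg (p : ℂ × ℂ) : sg (sg p) = p := by
  ext <;> simp [sg, conj2]

lemma continuous_sg : Continuous sg := by
  unfold sg
  have := Complex.continuous_conj
  fun_prop

lemma f_sg (p : ℂ × ℂ) : f (sg p) = I * conj (f p) := by
  have e : Complex.exp (conj p.2 - Real.pi / 2 * I) = -I * conj (Complex.exp p.2) := by
    rw [sub_eq_add_neg, Complex.exp_add, ← Complex.exp_conj, Complex.exp_neg, Complex.exp_pi_div_two_mul_I, Complex.inv_I]
    ring
  have c : Complex.cosh (-(conj p.1)) = conj (Complex.cosh p.1) := by rw [Complex.cosh_neg, Complex.cosh_conj]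
  have s : Complex.sinh (-(conj p.1)) = -conj (Complex.sinh p.1) := by rw [Complex.sinh_neg, Complex.sinh_conj]
  simp only [f, sg, e, fA, fB, c, s, map_add, map_mul, map_div₀, map_pow]
  have : (-I * conj (Complex.exp p.2)) ^ 3 = I * conj (Complex.exp p.2) ^ 3 := by
    rw [mul_pow]; congr 1
    linear_combination (-I) * Complex.I_sq
  rw [this]
  simp only [map_ofNat]
  ring

lemma sg_mem_Y (p : ℂ × ℂ) : sg p ∈ Y ↔ p ∈ Y := by
  simp only [Y, mem_ofPred_eq, f_sg]
  have h1 : I * conj (f p) = 4 ↔ f p = 4 * I := by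
    constructor
    · intro h
      have h2 := congrArg (fun z => conj z) h
      simp [conj4] at h2
      linear_combination I * h2 + f p * Complex.I_sq
    · intro h; rw [h]; simp [conj4]; linear_combination (-4 : ℂ) * Complex.I_sq
  have h2 : I * conj (f p) = 4 * I ↔ f p = 4 := by
    constructor
    · intro h
      have h1 : conj (f p) = 4 := by
        apply mul_left_cancel₀ Complex.I_ne_zero; linear_combination h
      have h2 := congrArg (fun z => conj z) h1
      simpa [conj4] using h2
    · intro h; rw [h, conj4]; ring
  rw [Ne, Ne, h1, h2, and_comm]

lemma sg_sh (p : ℂ × ℂ) (r : ℝ) : sh (sg p) r = sg (sh p r) := by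
  ext
  · simp [sg, sh]
  · simp [sg, sh]; ring

lemma sg_mem_Y0 (p : ℂ × ℂ) : sg p ∈ Y0 ↔ p ∈ Y0 := by
  simp only [Y0, mem_ofPred_eq, sg_sh, sg_mem_Y]

lemma dist_sg (p q : ℂ × ℂ) : dist (sg p) (sg q) = dist p q := by
  simp only [sg, Prod.dist_eq, dist_neg_neg, dist_sub_right, Complex.dist_conj_conj]

lemma Good.sg {E} (hE : Good E) : Good (sg ⁻¹' E) where
  isOpen := hE.isOpen.preimage continuous_sg
  sub := fun p hp => (sg_mem_Y p).1 (hE.sub hp)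
  y0sub := fun p hp => hE.y0sub ((sg_mem_Y0 p).2 hp)
  g3 := by
    intro κ ε hV M hM hMp N hN hNo hNM p hp
    refine hE.g3 (S15.sg κ) ε ?_ (S15.sg '' M) ?_ (hMp.image _ continuous_sg.continuousOn)
      (S15.sg ⁻¹' N) ?_ (hNo.preimage continuous_sg) ?_ (by simpa [sg_sg] using hp)
    · intro q hq
      rw [← sg_mem_Y]
      apply hV
      rw [Metric.mem_ball, ← dist_sg, sg_sg]
      exact hq
    · rintro _ ⟨q, hq, rfl⟩
      refine ⟨(hM hq).1, ?_⟩
      rw [Metric.mem_ball, dist_sg]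
      exact (hM hq).2
    · intro q hq
      have := hN hq
      rw [Metric.mem_ball, ← dist_sg, sg_sg] at this
      exact this
    · intro q hq
      have := hNM hq
      have h2 := image_closure_subset_closure_image continuous_sg (s := M) (mem_image_of_mem _ this)
      rwa [sg_sg] at h2
  g4 := by
    intro p r1 hr1 h1 h2
    refine hE.g4 _ r1 hr1 (fun r h3 h4 => ?_) ?_
    · rw [sg_sh, sg_mem_Y]; exact h1 r h3 h4
    · rw [sg_sh]; exact h2

lemma filled_sg {E} {P} : Filled (sg ⁻¹' E) P ↔ Filled E (sg P) := by
  simp only [Filled, mem_preimage, sg_sh]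

noncomputable def L0 : ℝ := Real.log 4 / 3

theorem global2 {E : Set (ℂ × ℂ)} (hE : Good E) (h0 : Filled E (0, (L0 : ℂ)))
    (h1 : Filled E (0, (L0 : ℂ) - Real.pi / 2 * I)) : Y ⊆ E := by
  refine global' hE ?_
  rintro ⟨a, η⟩ hP hP0
  obtain rfl : a = 0 := hP0
  simp only [Y, mem_ofPred_eq, not_and_or, not_not] at hP
  rcases hP with h | h
  · exact filled_four hE h0 h
  · have e : sg (sg (0, η)) = (0, η) := sg_sg _
    rw [← e, ← filled_sg]
    have e2 : sg (0, η) = (0, (sg (0, η)).2) := by simp [sg]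
    rw [e2]
    refine filled_four hE.sg ?_ ?_
    · rw [filled_sg]
      convert h1 using 1
      simp only [sg, map_zero, neg_zero, Complex.conj_ofReal, L0]
    · rw [← e2, f_sg, h]
      simp [conj4]
      linear_combination (-4 : ℂ) * Complex.I_sq

end S15

namespace S15

open Set Filter Topology ComplexConjugate

noncomputable def kp (L t : ℝ) : ℂ × ℂ := (0, (L : ℂ) + (t : ℂ) * I)

lemma slice_Y0 {η : ℂ} (h1 : Real.sin (3 * η.im) ≠ 0) (h2 : Real.cos (3 * η.im) ≠ 0) : ((0 : ℂ), η) ∈ Y0 := by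
  intro r _
  have e : f (sh (0, η) r) = Complex.exp (3 * (η - r)) := by
    rw [sh, f_zero, ← Complex.exp_nat_mul]; norm_num
  have hre : (f (sh (0, η) r)).re = Real.exp (3 * (η - r)).re * Real.cos (3 * η.im) := by
    rw [e, Complex.exp_re]; simp
  have him : (f (sh (0, η) r)).im = Real.exp (3 * (η - r)).re * Real.sin (3 * η.im) := by
    rw [e, Complex.exp_im]; simp
  refine ⟨fun h => ?_, fun h => ?_⟩
  · rw [h] at him
    simp at him
    exact h1 him
  · rw [h] at hre
    simp at hre
    exact h2 hre

def Ang (ψ : ℝ) : Prop := ∀ t : ℝ, t ≠ 0 → |t| < Real.pi / 6 → Real.sin (3 * (ψ + t)) ≠ 0 ∧ Real.cos (3 * (ψ + t)) ≠ 0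

lemma sc_ne {s : ℝ} (h0 : s ≠ 0) (h1 : |s| < Real.pi / 2) : Real.sin s ≠ 0 ∧ Real.cos s ≠ 0 := by
  have hpi := Real.pi_pos
  rw [abs_lt] at h1
  refine ⟨?_, (Real.cos_pos_of_mem_Ioo ⟨by linarith, h1.2⟩).ne'⟩
  intro h
  exact h0 ((Real.sin_eq_zero_iff_of_lt_of_lt (by linarith) (by linarith)).1 h)

lemma ang0 : Ang 0 := by
  intro t h0 h1
  have : |3 * t| < Real.pi / 2 := by rw [abs_mul]; norm_num; linarith
  simpa using sc_ne (by simpa using h0) this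

lemma ang1 : Ang (-(Real.pi / 2)) := by
  intro t h0 h1
  have h : |3 * t| < Real.pi / 2 := by rw [abs_mul]; norm_num; linarith
  obtain ⟨a, b⟩ := sc_ne (by simpa using h0) h
  have e : 3 * (-(Real.pi / 2) + t) = 3 * t + Real.pi / 2 - 2 * Real.pi := by ring
  rw [e, Real.sin_sub_two_pi, Real.cos_sub_two_pi, Real.sin_add_pi_div_two, Real.cos_add_pi_div_two]
  exact ⟨b, neg_ne_zero.2 a⟩

lemma slice_big {η : ℂ} (h : L0 < η.re) : ((0 : ℂ), η) ∈ Y := by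
  have h1 : 4 < ‖f (0, η)‖ := by
    rw [f_zero, norm_pow, Complex.norm_exp, ← cc3]
    have : cc < Real.exp η.re := Real.exp_lt_exp.2 h
    have := cc_pos
    gcongr
  constructor <;> intro h2 <;> rw [h2] at h1 <;> simp at h1

lemma filled_cross {R} (hR : Rels R) {ψ : ℝ} (hψ : Ang ψ) (hQ : kp L0 ψ ∉ Y) {L t : ℝ} (hL : L0 < L)
    (ht : 0 < t) (ht1 : t < Real.pi / 6) (hRk : R (kp L (ψ + t)) (kp L (ψ - t))) : Filled (EofR R) (kp L0 ψ) := by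
  have hV := slice_VC hQ rfl
  obtain ⟨g, r1, δ, hLoc⟩ := exists_Loc isOpen_Y0 (fun p r1 _ h1 h2 => Y0_of_sh h1 h2) hV.2.1 hQ one_pos
    (fun r h1 _ => VC.left hV h1)
  refine ⟨r1, hLoc.r1pos, fun r h1 h2 => ?_⟩
  obtain ⟨ε, hε, V, hVp, hVY, hN, hg, hS, hcut⟩ := hLoc.box (Metric.mem_ball_self hLoc.δpos) h1 h2
  have hb : g 0 = (L0 : ℂ) + ψ * I := by
    have := hLoc.base; simpa [kp] using this
  have e : ((kp L0 ψ).1, g (kp L0 ψ).1 + r) = sh (kp L0 ψ) (-r) := by simp [sh, hLoc.base]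
  have hκN : ((kp L0 ψ).1, g (kp L0 ψ).1 + r) ∈ Nbox g (kp L0 ψ).1 r ε := Nbox_mem (Metric.mem_ball_self hε) (by simpa using hε)
  rw [← e]
  have hne : ∀ p ∈ Nbox g (kp L0 ψ).1 r ε, p ∈ Y0 → (p.2 - g p.1).im ≠ 0 := by
    intro p hp hp0 him
    obtain ⟨c1, c2⟩ := hcut p hp
    have := hp0 (p.2 - g p.1).re c1.le
    apply c2
    have e3 : (((p.2 - g p.1).re : ℝ) : ℂ) = p.2 - g p.1 := by
      apply Complex.ext <;> simp_all
    have e2 : sh p (p.2 - g p.1).re = (p.1, g p.1) := by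
      rw [sh, e3]; simp
    rwa [e2] at this
  have same : ∀ σ : ℝ, |σ| = 1 → ∀ y ∈ Nsgn g (kp L0 ψ).1 r ε σ, ∀ y' ∈ Nsgn g (kp L0 ψ).1 r ε σ, R y y' := by
    have sub : ∀ σ : ℝ, ∀ y ∈ Nsgn g (kp L0 ψ).1 r ε σ, y ∈ Y0 := by
      intro σ y hy
      refine hS y hy.1 fun h => ?_
      have := hy.2
      rw [h, mul_zero] at this
      exact lt_irrefl _ this
    intro σ hσ y hy y' hy'
    exact hR.good_aux hVY (M := Nsgn g (kp L0 ψ).1 r ε σ) (fun p hp => ⟨Y0_sub_EofR hR (sub σ p hp), hN hp.1⟩) (preconn_Nsgn hg)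
      ⟨hN hy.1, sub σ y hy⟩ ⟨hN hy'.1, sub σ y' hy'⟩ (subset_closure hy) (subset_closure hy')
  -- the crossing points
  set s : ℝ := min (ε / 2) t with hs
  have s0 : 0 < s := lt_min (by linarith) ht
  have s1 : s < ε := (min_le_left _ _).trans_lt (by linarith)
  have s2 : s < Real.pi / 6 := (min_le_right _ _).trans_lt ht1
  have yN : ∀ s' : ℝ, |s'| < ε → kp (L0 + r) (ψ + s') ∈ Nbox g (kp L0 ψ).1 r ε := by
    intro s' hs'
    refine ⟨by simpa [kp] using hε, ?_, ?_⟩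
    · simpa [kp, hb] using hε
    · simpa [kp, hb] using hs'
  have yim : ∀ s' : ℝ, ((kp (L0 + r) (ψ + s')).2 - g (kp (L0 + r) (ψ + s')).1).im = s' := by
    intro s'; simp [kp, hb]
  have kY0 : ∀ L' s' : ℝ, s' ≠ 0 → |s'| < Real.pi / 6 → kp L' (ψ + s') ∈ Y0 := by
    intro L' s' h0 h6
    have := hψ s' h0 h6
    apply slice_Y0 <;> simp [kp] <;> tauto
  have mv : ∀ σ : ℝ, |σ| = 1 → R (kp (L0 + r) (ψ + σ * s)) (kp L (ψ + σ * t)) := by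
    intro σ hσ
    have hσ2 : σ * σ = 1 := by rw [← abs_mul_abs_self, hσ]; norm_num
    let K : Set (ℂ × ℂ) := {p | p.1 = 0 ∧ 0 < σ * (p.2.im - ψ) ∧ σ * (p.2.im - ψ) < Real.pi / 6}
    have hK : Convex ℝ K := by
      intro p hp q hq a b ha hb hab
      obtain ⟨p1, p2, p3⟩ := hp
      obtain ⟨q1, q2, q3⟩ := hq
      refine ⟨by simp [p1, q1], ?_⟩
      have e : σ * ((a • p + b • q).2.im - ψ) = a * (σ * (p.2.im - ψ)) + b * (σ * (q.2.im - ψ)) := by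
        simp
        linear_combination (σ * ψ) * hab
      rw [e]
      obtain rfl : b = 1 - a := by linarith
      exact (convex_Ioo (0:ℝ) (Real.pi / 6)) ⟨p2, p3⟩ ⟨q2, q3⟩ ha hb hab
    refine hR.seg K hK ?_ _ ?_ _ ?_
    · rintro ⟨a, η⟩ ⟨p1, p2, p3⟩
      obtain rfl : a = 0 := p1
      simp only at p2 p3
      have h6 : |η.im - ψ| < Real.pi / 6 := by
        have : |σ * (η.im - ψ)| = |η.im - ψ| := by rw [abs_mul, hσ, one_mul]
        rw [← this, abs_of_pos p2]; exact p3
      have h0 : η.im - ψ ≠ 0 := by rintro h; rw [h, mul_zero] at p2; exact lt_irrefl _ p2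
      have := hψ _ h0 h6
      rw [add_sub_cancel] at this
      exact slice_Y0 this.1 this.2
    · refine ⟨rfl, ?_⟩
      have : σ * ((kp (L0 + r) (ψ + σ * s)).2.im - ψ) = s := by simp [kp]; linear_combination s * hσ2
      rw [this]; exact ⟨s0, s2⟩
    · refine ⟨rfl, ?_⟩
      have : σ * ((kp L (ψ + σ * t)).2.im - ψ) = t := by simp [kp]; linear_combination t * hσ2
      rw [this]; exact ⟨ht, ht1⟩
  have cross : R (kp (L0 + r) (ψ + s)) (kp (L0 + r) (ψ + -s)) := by
    let K : Set (ℂ × ℂ) := {p | p.1 = 0 ∧ L0 < p.2.re}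
    have hK : Convex ℝ K := by
      intro p hp q hq a b ha hb hab
      obtain ⟨p1, p2⟩ := hp
      obtain ⟨q1, q2⟩ := hq
      refine ⟨by simp [p1, q1], ?_⟩
      have e : (a • p + b • q).2.re = a * p.2.re + b * q.2.re := by simp
      rw [e]
      exact (convex_Ioi L0) p2 q2 ha hb hab
    have hKY : K ⊆ Y := by
      rintro ⟨a, η⟩ ⟨p1, p2⟩
      obtain rfl : a = 0 := p1
      exact slice_big p2
    have hm : ∀ L' s' : ℝ, L0 < L' → s' ≠ 0 → |s'| < Real.pi / 6 → kp L' (ψ + s') ∈ K ∩ Y0 := by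
      intro L' s' hL' h0 h6
      exact ⟨⟨rfl, by simpa [kp] using hL'⟩, kY0 L' s' h0 h6⟩
    have a1 := hm (L0 + r) s (by linarith) s0.ne' (by rwa [abs_of_pos s0])
    have a2 := hm (L0 + r) (-s) (by linarith) (neg_ne_zero.2 s0.ne') (by rwa [abs_neg, abs_of_pos s0])
    have a3 := hm L t hL ht.ne' (by rwa [abs_of_pos ht])
    have a4 := hm L (-t) hL (neg_ne_zero.2 ht.ne') (by rwa [abs_neg, abs_of_pos ht])
    have m1 := mv 1 (by simp)
    have m2 := mv (-1) (by simp)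
    simp only [one_mul, neg_mul] at m1 m2
    rw [sub_eq_add_neg] at hRk
    exact hR.tri K hK hKY _ a1 _ a3 _ a2 m1 (hR.tri K hK hKY _ a3 _ a4 _ a2 hRk (hR.symm K hK hKY _ a2 _ a4 m2))
  have ball := convex_ball ((kp L0 ψ).1, g (kp L0 ψ).1 + (r : ℂ)) V
  have p1 : kp (L0 + r) (ψ + s) ∈ Nsgn g (kp L0 ψ).1 r ε 1 := ⟨yN s (by rwa [abs_of_pos s0]), by rw [yim]; simpa using s0⟩
  have p2 : kp (L0 + r) (ψ + -s) ∈ Nsgn g (kp L0 ψ).1 r ε (-1) := ⟨yN (-s) (by rwa [abs_neg, abs_of_pos s0]), by rw [yim]; simpa using s0⟩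
  have b1 : kp (L0 + r) (ψ + s) ∈ Metric.ball ((kp L0 ψ).1, g (kp L0 ψ).1 + (r : ℂ)) V ∩ Y0 := ⟨hN p1.1, kY0 _ _ s0.ne' (by rwa [abs_of_pos s0])⟩
  have b2 : kp (L0 + r) (ψ + -s) ∈ Metric.ball ((kp L0 ψ).1, g (kp L0 ψ).1 + (r : ℂ)) V ∩ Y0 :=
    ⟨hN p2.1, kY0 _ _ (neg_ne_zero.2 s0.ne') (by rwa [abs_neg, abs_of_pos s0])⟩
  have opp : ∀ y ∈ Nsgn g (kp L0 ψ).1 r ε 1, ∀ y' ∈ Nsgn g (kp L0 ψ).1 r ε (-1), y ∈ Y0 → y' ∈ Y0 → R y y' := by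
    intro y hy y' hy' hy0 hy0'
    have c1 := (⟨hN hy.1, hy0⟩ : y ∈ Metric.ball ((kp L0 ψ).1, g (kp L0 ψ).1 + (r : ℂ)) V ∩ Y0)
    have c2 := (⟨hN hy'.1, hy0'⟩ : y' ∈ Metric.ball ((kp L0 ψ).1, g (kp L0 ψ).1 + (r : ℂ)) V ∩ Y0)
    exact hR.tri _ ball hVY _ c1 _ b1 _ c2 (same 1 (by simp) _ hy _ p1)
      (hR.tri _ ball hVY _ b1 _ b2 _ c2 cross (same (-1) (by simp) _ p2 _ hy'))
  refine EofR_of_open (isOpen_Nbox hg) (hN.trans hVY) ?_ hκN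
  rintro y ⟨hy, hy0⟩ y' ⟨hy', hy0'⟩
  have i1 := hne y hy hy0
  have i2 := hne y' hy' hy0'
  have c1 := (⟨hN hy, hy0⟩ : y ∈ Metric.ball ((kp L0 ψ).1, g (kp L0 ψ).1 + (r : ℂ)) V ∩ Y0)
  have c2 := (⟨hN hy', hy0'⟩ : y' ∈ Metric.ball ((kp L0 ψ).1, g (kp L0 ψ).1 + (r : ℂ)) V ∩ Y0)
  rcases lt_or_gt_of_ne i1 with j1 | j1 <;> rcases lt_or_gt_of_ne i2 with j2 | j2
  · exact same (-1) (by simp) _ ⟨hy, by linarith⟩ _ ⟨hy', by linarith⟩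
  · exact hR.symm _ ball hVY _ c2 _ c1 (opp _ ⟨hy', by linarith⟩ _ ⟨hy, by linarith⟩ hy0' hy0)
  · exact opp _ ⟨hy, by linarith⟩ _ ⟨hy', by linarith⟩ hy0 hy0'
  · exact same 1 (by simp) _ ⟨hy, by linarith⟩ _ ⟨hy', by linarith⟩

theorem EofR_eq {R} (hR : Rels R) {L t : ℝ} (hL : L0 < L) (ht : 0 < t) (ht1 : t < Real.pi / 6) 
    (h1 : R (kp L (0 + t)) (kp L (0 - t))) 
    (h2 : R (kp L (-(Real.pi / 2) + t)) (kp L (-(Real.pi / 2) - t))) : Y ⊆ EofR R := by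
  have n1 : kp L0 0 ∉ Y := by
    intro h
    apply h.1
    rw [kp, f_zero]
    simp only [Complex.ofReal_zero, zero_mul, add_zero]
    rw [← Complex.ofReal_exp, ← Complex.ofReal_pow]
    have := cc3
    rw [cc] at this
    rw [L0, this]; norm_num
  have es : sg (kp L0 0) = kp L0 (-(Real.pi / 2)) := by
    simp [sg, kp]; ring
  have n2 : kp L0 (-(Real.pi / 2)) ∉ Y := by rw [← es, sg_mem_Y]; exact n1
  refine global2 hR.good ?_ ?_
  · have := filled_cross hR ang0 n1 hL ht ht1 h1
    simpa [kp] using this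
  · have := filled_cross hR ang1 n2 hL ht ht1 h2
    convert this using 1
    simp [kp]; ring

end S15

namespace S15

open Set Filter Topology

local notation "PQ" => Path.Homotopic.Quotient

section gpd
variable {X : Type*} [TopologicalSpace X] {x y z w : X}

lemma pq_assoc (p : PQ x y) (q : PQ y z) (r : PQ z w) :
    (p.trans q).trans r = p.trans (q.trans r) :=
  CategoryTheory.Category.assoc (obj := FundamentalGroupoid X)
    (W := FundamentalGroupoid.mk x) (X := FundamentalGroupoid.mk y)
    (Y := FundamentalGroupoid.mk z) (Z := FundamentalGroupoid.mk w) p q r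

lemma pq_refl_trans (p : PQ x y) : (Path.Homotopic.Quotient.refl x).trans p = p :=
  CategoryTheory.Category.id_comp (obj := FundamentalGroupoid X)
    (X := FundamentalGroupoid.mk x) (Y := FundamentalGroupoid.mk y) p

lemma pq_trans_refl (p : PQ x y) : p.trans (Path.Homotopic.Quotient.refl y) = p :=
  CategoryTheory.Category.comp_id (obj := FundamentalGroupoid X)
    (X := FundamentalGroupoid.mk x) (Y := FundamentalGroupoid.mk y) p

lemma pq_symm_trans (p : PQ x y) : p.symm.trans p = Path.Homotopic.Quotient.refl y :=
  CategoryTheory.Groupoid.inv_comp (obj := FundamentalGroupoid X)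
    (X := FundamentalGroupoid.mk x) (Y := FundamentalGroupoid.mk y) p

lemma pq_trans_symm (p : PQ x y) : p.trans p.symm = Path.Homotopic.Quotient.refl x :=
  CategoryTheory.Groupoid.comp_inv (obj := FundamentalGroupoid X)
    (X := FundamentalGroupoid.mk x) (Y := FundamentalGroupoid.mk y) p

lemma pq_symm_trans_a (p : PQ x y) (q : PQ y z) : p.symm.trans (p.trans q) = q := by
  rw [← pq_assoc, pq_symm_trans, pq_refl_trans]

lemma pq_trans_symm_a (p : PQ x y) (q : PQ x z) : p.trans (p.symm.trans q) = q := by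
  rw [← pq_assoc, pq_trans_symm, pq_refl_trans]

lemma pq_symm_eq {p : PQ x y} {q : PQ y x} (hh : p.trans q = Path.Homotopic.Quotient.refl x) :
    p.symm = q := by
  rw [← pq_trans_refl p.symm, ← hh, pq_symm_trans_a]

lemma pq_trans_rev (p : PQ x y) (q : PQ y z) : (p.trans q).symm = q.symm.trans p.symm := by
  apply pq_symm_eq
  rw [pq_assoc, pq_trans_symm_a, pq_trans_symm]

lemma pq_symm_symm (p : PQ x y) : p.symm.symm = p := by
  apply pq_symm_eq
  rw [pq_symm_trans]
end gpd

/-- affine homotopy inside a convex subset -/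
lemma homK {K : Set (ℂ × ℂ)} (hK : Convex ℝ K) (hKY : K ⊆ Y) {x y : Y} (p q : Path x y)
    (hp : ∀ t, (p t).1 ∈ K) (hq : ∀ t, (q t).1 ∈ K) : p.Homotopic q := by
  refine ⟨⟨⟨⟨fun s => ⟨AffineMap.lineMap (p s.2).1 (q s.2).1 (s.1 : ℝ), ?_⟩, ?_⟩, ?_, ?_⟩, ?_⟩⟩
  · apply hKY
    exact hK.segment_subset (hp s.2) (hq s.2) (by
      rw [segment_eq_image_lineMap]; exact ⟨s.1, s.1.2, rfl⟩)
  · apply Continuous.subtype_mk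
    simp only [AffineMap.lineMap_apply_module]
    fun_prop
  · intro t; ext <;> simp
  · intro t; ext <;> simp
  · rintro s t (rfl | rfl) <;> ext <;> simp

noncomputable def segP (x y : Y) (hs : segment ℝ x.1 y.1 ⊆ Y) : Path x y where
  toFun t := ⟨AffineMap.lineMap x.1 y.1 (t : ℝ), hs (by
      rw [segment_eq_image_lineMap]; exact ⟨t, t.2, rfl⟩)⟩
  continuous_toFun := by
    apply Continuous.subtype_mk
    simp only [AffineMap.lineMap_apply_module]
    fun_prop
  source' := by ext <;> simp
  target' := by ext <;> simp

lemma segP_mem {K : Set (ℂ × ℂ)} (hK : Convex ℝ K) {x y : Y} (hs : segment ℝ x.1 y.1 ⊆ Y)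
    (hx : x.1 ∈ K) (hy : y.1 ∈ K) (t) : (segP x y hs t).1 ∈ K :=
  hK.segment_subset hx hy (by rw [segment_eq_image_lineMap]; exact ⟨t, t.2, rfl⟩)

noncomputable def sgm (x y : Y) (hs : segment ℝ x.1 y.1 ⊆ Y) : PQ x y := .mk (segP x y hs)

lemma segY {K : Set (ℂ × ℂ)} (hK : Convex ℝ K) (hKY : K ⊆ Y) {x y : ℂ × ℂ}
    (hx : x ∈ K) (hy : y ∈ K) : segment ℝ x y ⊆ Y := (hK.segment_subset hx hy).trans hKY

lemma sgm_of_path {K : Set (ℂ × ℂ)} (hK : Convex ℝ K) (hKY : K ⊆ Y) {x y : Y} (p : Path x y)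
    (hp : ∀ t, (p t).1 ∈ K) (hs : segment ℝ x.1 y.1 ⊆ Y) :
    Path.Homotopic.Quotient.mk p = sgm x y hs := by
  have hx : x.1 ∈ K := by simpa using hp 0
  have hy : y.1 ∈ K := by simpa using hp 1
  exact Path.Homotopic.Quotient.eq.2 (homK hK hKY _ _ hp (segP_mem hK hs hx hy))

lemma sgm_tri {K : Set (ℂ × ℂ)} (hK : Convex ℝ K) (hKY : K ⊆ Y) {x y z : Y}
    (hx : x.1 ∈ K) (hy : y.1 ∈ K) (hz : z.1 ∈ K) (h1 : segment ℝ x.1 y.1 ⊆ Y)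
    (h2 : segment ℝ y.1 z.1 ⊆ Y) (h3 : segment ℝ x.1 z.1 ⊆ Y) :
    (sgm x y h1).trans (sgm y z h2) = sgm x z h3 := by
  rw [sgm, sgm, ← Path.Homotopic.Quotient.mk_trans]
  apply sgm_of_path hK hKY
  intro t
  rw [Path.trans_apply]
  split_ifs
  · exact segP_mem hK h1 hx hy _
  · exact segP_mem hK h2 hy hz _

lemma sgm_self (x : Y) (h1 : segment ℝ x.1 x.1 ⊆ Y) :
    sgm x x h1 = Path.Homotopic.Quotient.refl x := by
  have hK : ({x.1} : Set (ℂ × ℂ)) ⊆ Y := by simp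
  rw [← sgm_of_path (convex_singleton x.1) hK (Path.refl x) (by simp) h1]
  rfl

lemma sgm_symm (x y : Y) (h1 : segment ℝ x.1 y.1 ⊆ Y) (h2 : segment ℝ y.1 x.1 ⊆ Y) :
    (sgm x y h1).symm = sgm y x h2 := by
  apply pq_symm_eq
  have hK : Convex ℝ (segment ℝ x.1 y.1) := convex_segment _ _
  have := sgm_tri hK h1 (left_mem_segment ℝ _ _) (right_mem_segment ℝ _ _)
    (left_mem_segment ℝ _ _) h1 h2 (by simp)
  rw [this, sgm_self]

/-- half strips -/
def strip (K : Set (ℂ × ℂ)) (r : ℝ) : Set (ℂ × ℂ) := {q | ∃ p ∈ K, ∃ s : ℝ, r ≤ s ∧ q = sh p s}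

lemma convex_strip {K : Set (ℂ × ℂ)} (hK : Convex ℝ K) (r : ℝ) : Convex ℝ (strip K r) := by
  rintro _ ⟨p, hp, s, hs, rfl⟩ _ ⟨p', hp', s', hs', rfl⟩ a b ha hb hab
  refine ⟨a • p + b • p', hK hp hp' ha hb hab, a * s + b * s', ?_, ?_⟩
  · have h1 := mul_le_mul_of_nonneg_left hs ha
    have h2 := mul_le_mul_of_nonneg_left hs' hb
    have : a * r + b * r = r := by rw [← add_mul, hab, one_mul]
    linarith
  · ext
    · simp [sh]
    · simp [sh]; ring

lemma strip_sub {K : Set (ℂ × ℂ)} (hK : K ⊆ Y0) : strip K 0 ⊆ Y := by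
  rintro _ ⟨p, hp, s, hs, rfl⟩
  exact hK hp s hs

lemma self_strip {K : Set (ℂ × ℂ)} {p} (hp : p ∈ K) : p ∈ strip K 0 := ⟨p, hp, 0, le_rfl, by simp⟩

lemma sh_strip {K : Set (ℂ × ℂ)} {p} (hp : p ∈ K) {r s : ℝ} (hs : r ≤ s) : sh p s ∈ strip K r :=
  ⟨p, hp, s, hs, rfl⟩

def Far (ρ r : ℝ) : Prop := 0 ≤ r ∧ ∀ p : ℂ × ℂ, ‖p‖ ≤ ρ → ∀ s, r ≤ s → ‖f (sh p s)‖ < 4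

lemma exists_Far (ρ : ℝ) : ∃ r, Far ρ r := by
  obtain ⟨m, hm⟩ := (isCompact_closedBall (0 : ℂ × ℂ) ρ).bddAbove_image continuous_M0.continuousOn
  obtain ⟨R, h0, hR⟩ := exists_far m
  refine ⟨R, h0, fun p hp s hs => hR p (hm ⟨p, by simpa using hp, rfl⟩) s hs⟩

lemma Far.mono {ρ ρ' r r' : ℝ} (hF : Far ρ r) (h1 : ρ' ≤ ρ) (h2 : r ≤ r') : Far ρ' r' :=
  ⟨hF.1.trans h2, fun p hp s hs => hF.2 p (hp.trans h1) s (h2.trans hs)⟩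

lemma Far.sub {ρ r : ℝ} (hF : Far ρ r) : strip (Metric.closedBall 0 ρ) r ⊆ Y := by
  rintro _ ⟨p, hp, s, hs, rfl⟩
  exact mem_Y_of_norm (hF.2 p (by simpa using hp) s hs)

lemma cvx_far (ρ r : ℝ) : Convex ℝ (strip (Metric.closedBall (0 : ℂ × ℂ) ρ) r) :=
  convex_strip (convex_closedBall _ _) _

lemma zero_mem_Y0 : (0 : ℂ × ℂ) ∈ Y0 := by
  intro r hr
  apply mem_Y_of_norm
  have : sh 0 r = (0, -(r : ℂ)) := by simp [sh]
  rw [this, f_zero, norm_pow, Complex.norm_exp]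
  simp only [neg_re, ofReal_re]
  have : Real.exp (-r) ≤ 1 := by simpa using hr
  have h2 : Real.exp (-r) ^ 3 ≤ 1 := pow_le_one₀ (Real.exp_pos _).le this
  linarith

noncomputable abbrev pt (y : ℂ × ℂ) (hy : y ∈ Y0) (r : ℝ) (hr : 0 ≤ r) : Y := ⟨sh y r, hy r hr⟩
noncomputable abbrev p0 (y : ℂ × ℂ) (hy : y ∈ Y0) : Y := ⟨y, Y0_sub hy⟩
noncomputable abbrev bp : Y := p0 0 zero_mem_Y0

lemma seg_vert {y : ℂ × ℂ} (hy : y ∈ Y0) {r s : ℝ} (hr : 0 ≤ r) (hs : 0 ≤ s) :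
    segment ℝ (sh y r) (sh y s) ⊆ Y := by
  have hK : ({y} : Set (ℂ × ℂ)) ⊆ Y0 := by simpa using hy
  exact segY (convex_strip (convex_singleton y) 0) (strip_sub hK) (sh_strip (mem_singleton _) hr) (sh_strip (mem_singleton _) hs)

lemma seg_vert0 {y : ℂ × ℂ} (hy : y ∈ Y0) {r : ℝ} (hr : 0 ≤ r) : segment ℝ y (sh y r) ⊆ Y := by
  simpa using seg_vert hy le_rfl hr
lemma seg_vert1 {y : ℂ × ℂ} (hy : y ∈ Y0) {r : ℝ} (hr : 0 ≤ r) : segment ℝ (sh y r) y ⊆ Y := by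
  simpa using seg_vert hy hr le_rfl

lemma far_mem {y : ℂ × ℂ} {r s : ℝ} {ρ : ℝ} (hρ : ‖y‖ ≤ ρ) (hrs : r ≤ s) :
    sh y s ∈ strip (Metric.closedBall 0 ρ) r := sh_strip (by simpa using hρ) hrs

lemma seg_far {y y' : ℂ × ℂ} {r ρ : ℝ} (hF : Far ρ r) (h1 : ‖y‖ ≤ ρ) (h2 : ‖y'‖ ≤ ρ) :
    segment ℝ (sh y r) (sh y' r) ⊆ Y :=
  segY (cvx_far ρ r) hF.sub (far_mem h1 le_rfl) (far_mem h2 le_rfl)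

noncomputable def tau' (y : ℂ × ℂ) (hy : y ∈ Y0) (r : ℝ) (hF : Far ‖y‖ r) : PQ bp (p0 y hy) :=
  (sgm bp (pt 0 zero_mem_Y0 r hF.1) (seg_vert0 zero_mem_Y0 hF.1)).trans
    ((sgm (pt 0 zero_mem_Y0 r hF.1) (pt y hy r hF.1) (seg_far hF (by simp) le_rfl)).trans
      (sgm (pt y hy r hF.1) (p0 y hy) (seg_vert1 hy hF.1)))

lemma tau'_le (y : ℂ × ℂ) (hy : y ∈ Y0) (r s : ℝ) (hF : Far ‖y‖ r) (hG : Far ‖y‖ s) (hrs : r ≤ s) :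
    tau' y hy r hF = tau' y hy s hG := by
  have h0Y : ({0} : Set (ℂ × ℂ)) ⊆ Y0 := by simpa using zero_mem_Y0
  have hyY : ({y} : Set (ℂ × ℂ)) ⊆ Y0 := by simpa using hy
  have hr := hF.1
  have hs := hG.1
  unfold tau'
  have e1 := sgm_tri (convex_strip (convex_singleton 0) 0) (strip_sub h0Y)
    (x := bp) (y := pt 0 zero_mem_Y0 r hr) (z := pt 0 zero_mem_Y0 s hs)
    (self_strip (mem_singleton _)) (sh_strip (mem_singleton _) hr) (sh_strip (mem_singleton _) hs) (seg_vert0 zero_mem_Y0 hr)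
    (seg_vert zero_mem_Y0 hr hs) (seg_vert0 zero_mem_Y0 hs)
  have e2 := sgm_tri (convex_strip (convex_singleton y) 0) (strip_sub hyY)
    (x := pt y hy s hs) (y := pt y hy r hr) (z := p0 y hy)
    (sh_strip (mem_singleton _) hs) (sh_strip (mem_singleton _) hr) (self_strip (mem_singleton _)) (seg_vert hy hs hr)
    (seg_vert1 hy hr) (seg_vert1 hy hs)
  have hz : ‖(0 : ℂ × ℂ)‖ ≤ ‖y‖ := by simp
  have c := cvx_far ‖y‖ r
  have sb := hF.sub
  have m1 : (pt 0 zero_mem_Y0 r hr).1 ∈ _ := far_mem (r := r) hz le_rfl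
  have m2 : (pt 0 zero_mem_Y0 s hs).1 ∈ _ := far_mem (r := r) hz hrs
  have m3 : (pt y hy r hr).1 ∈ _ := far_mem (r := r) (le_refl ‖y‖) le_rfl
  have m4 : (pt y hy s hs).1 ∈ _ := far_mem (r := r) (le_refl ‖y‖) hrs
  have e3 := sgm_tri c sb m1 m2 m4 (segY c sb m1 m2) (segY c sb m2 m4) (segY c sb m1 m4)
  have e4 := sgm_tri c sb m1 m4 m3 (segY c sb m1 m4) (segY c sb m4 m3) (segY c sb m1 m3)
  rw [← e1, ← e2, ← e4, ← e3]
  simp only [pq_assoc]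

noncomputable def tau (y : ℂ × ℂ) (hy : y ∈ Y0) : PQ bp (p0 y hy) :=
  tau' y hy _ (exists_Far ‖y‖).choose_spec

lemma tau_eq (y : ℂ × ℂ) (hy : y ∈ Y0) (r : ℝ) (hF : Far ‖y‖ r) : tau y hy = tau' y hy r hF := by
  have hG := (exists_Far ‖y‖).choose_spec
  rcases le_total r (exists_Far ‖y‖).choose with hh | hh
  · exact (tau'_le y hy _ _ hF hG hh).symm
  · exact tau'_le y hy _ _ hG hF hh

lemma tau_seg {K : Set (ℂ × ℂ)} (hK : Convex ℝ K) (hKY : K ⊆ Y0) {y z : ℂ × ℂ} (hy : y ∈ K)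
    (hz : z ∈ K) (hs : segment ℝ y z ⊆ Y) :
    (tau y (hKY hy)).trans (sgm (p0 y (hKY hy)) (p0 z (hKY hz)) hs) = tau z (hKY hz) := by
  obtain ⟨r, hF⟩ := exists_Far (max ‖y‖ ‖z‖)
  rw [tau_eq _ _ r (hF.mono (le_max_left _ _) le_rfl), tau_eq _ _ r (hF.mono (le_max_right _ _) le_rfl)]
  have hr := hF.1
  have cK := convex_strip hK 0
  have sK := strip_sub hKY
  have c := cvx_far (max ‖y‖ ‖z‖) r
  have sb := hF.sub
  have hyY := hKY hy
  have hzY := hKY hz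
  have n1 : (p0 y hyY).1 ∈ _ := self_strip hy
  have n2 : (p0 z hzY).1 ∈ _ := self_strip hz
  have n3 : (pt y hyY r hr).1 ∈ _ := sh_strip (r := 0) hy hr
  have n4 : (pt z hzY r hr).1 ∈ _ := sh_strip (r := 0) hz hr
  have m1 : (pt 0 zero_mem_Y0 r hr).1 ∈ _ := far_mem (r := r) (ρ := max ‖y‖ ‖z‖) (by simp) le_rfl
  have m2 : (pt y hyY r hr).1 ∈ _ := far_mem (r := r) (le_max_left ‖y‖ ‖z‖) le_rfl
  have m3 : (pt z hzY r hr).1 ∈ _ := far_mem (r := r) (le_max_right ‖y‖ ‖z‖) le_rfl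
  have e1 := sgm_tri cK sK n3 n1 n2 (segY cK sK n3 n1) (segY cK sK n1 n2) (segY cK sK n3 n2)
  have e2 := sgm_tri cK sK n3 n4 n2 (segY cK sK n3 n4) (segY cK sK n4 n2) (segY cK sK n3 n2)
  have e3 := sgm_tri c sb m1 m2 m3 (segY c sb m1 m2) (segY c sb m2 m3) (segY c sb m1 m3)
  unfold tau'
  rw [pq_assoc, pq_assoc, e1, ← e2, ← e3]
  simp only [pq_assoc]

lemma tau_bp : tau 0 zero_mem_Y0 = Path.Homotopic.Quotient.refl bp := by
  obtain ⟨r, hF⟩ := exists_Far ‖(0 : ℂ × ℂ)‖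
  rw [tau_eq _ _ r hF, tau', sgm_self, pq_refl_trans]

  rw [← sgm_symm bp (pt 0 zero_mem_Y0 r hF.1) (seg_vert0 zero_mem_Y0 hF.1)]
  exact pq_trans_symm _

end S15

namespace S15

open Set Filter Topology

local notation "PQ" => Path.Homotopic.Quotient

noncomputable def dd (y z : ℂ × ℂ) (hy : y ∈ Y0) (hz : z ∈ Y0) (hs : segment ℝ y z ⊆ Y) :
    PQ bp bp :=
  (tau y hy).trans ((sgm (p0 y hy) (p0 z hz) hs).trans (tau z hz).symm)

lemma dd_symm (y z : ℂ × ℂ) (hy : y ∈ Y0) (hz : z ∈ Y0) (hs : segment ℝ y z ⊆ Y)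
    (hs' : segment ℝ z y ⊆ Y) : (dd y z hy hz hs).symm = dd z y hz hy hs' := by
  unfold dd
  rw [pq_trans_rev, pq_trans_rev, pq_symm_symm, sgm_symm (p0 y hy) (p0 z hz) hs hs', pq_assoc]

lemma dd_tri {K : Set (ℂ × ℂ)} (hK : Convex ℝ K) (hKY : K ⊆ Y) (x y z : ℂ × ℂ)
    (hxK : x ∈ K) (hyK : y ∈ K) (hzK : z ∈ K)
    (hx : x ∈ Y0) (hy : y ∈ Y0) (hz : z ∈ Y0) (h1 : segment ℝ x y ⊆ Y)
    (h2 : segment ℝ y z ⊆ Y) (h3 : segment ℝ x z ⊆ Y) :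
    (dd x y hx hy h1).trans (dd y z hy hz h2) = dd x z hx hz h3 := by
  unfold dd
  rw [← sgm_tri hK hKY (x := p0 x hx) (y := p0 y hy) (z := p0 z hz) hxK hyK hzK h1 h2 h3]
  simp only [pq_assoc, pq_symm_trans_a]

lemma dd_one {K : Set (ℂ × ℂ)} (hK : Convex ℝ K) (hKY : K ⊆ Y0) (x y : ℂ × ℂ)
    (hxK : x ∈ K) (hyK : y ∈ K) (hs : segment ℝ x y ⊆ Y) :
    dd x y (hKY hxK) (hKY hyK) hs = Path.Homotopic.Quotient.refl bp := by
  unfold dd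
  rw [← pq_assoc, tau_seg hK hKY hxK hyK, pq_trans_symm]

abbrev GY := FundamentalGroup Y bp

def RH (H : Subgroup GY) (y z : ℂ × ℂ) : Prop :=
  ∃ hy hz hs, FundamentalGroup.fromPath (dd y z hy hz hs) ∈ H

lemma mul_tr {H : Subgroup GY} {p q : PQ bp bp} (hp : FundamentalGroup.fromPath p ∈ H)
    (hq : FundamentalGroup.fromPath q ∈ H) : FundamentalGroup.fromPath (p.trans q) ∈ H :=
  H.mul_mem hq hp

lemma rels_RH (H : Subgroup GY) : Rels (RH H) where
  symm := by
    rintro K hK hKY x hx y hy ⟨h1, h2, h3, h4⟩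
    refine ⟨h2, h1, by rwa [segment_symm], ?_⟩
    rw [← dd_symm x y h1 h2 h3]
    exact H.inv_mem h4
  tri := by
    rintro K hK hKY x hx y hy z hz ⟨h1, h2, h3, h4⟩ ⟨h1', h2', h3', h4'⟩
    refine ⟨h1, h2', segY hK hKY hx.1 hz.1, ?_⟩
    rw [← dd_tri hK hKY x y z hx.1 hy.1 hz.1 h1 h2 h2' h3 h3' _]
    exact mul_tr h4 h4'
  seg := by
    rintro K hK hKY x hx y hy
    refine ⟨hKY hx, hKY hy, segY hK (hKY.trans Y0_sub) hx hy, ?_⟩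
    rw [dd_one hK hKY x y hx hy]
    exact H.one_mem

/-- the invariant along a path -/
def TT (H : Subgroup GY) {x : Y} (p : PQ bp x) : Prop :=
  ∃ ε > 0, Metric.ball x.1 ε ⊆ Y ∧ ∀ y (hy : y ∈ Y0), y ∈ Metric.ball x.1 ε →
    ∀ hs : segment ℝ x.1 y ⊆ Y,
    FundamentalGroup.fromPath (p.trans ((sgm x (p0 y hy) hs).trans (tau y hy).symm)) ∈ H

lemma TT_step (H : Subgroup GY) {κ : ℂ × ℂ} {ε : ℝ} (hV : Metric.ball κ ε ⊆ Y)
    (hR : ∀ y ∈ Metric.ball κ ε ∩ Y0, ∀ y' ∈ Metric.ball κ ε ∩ Y0, RH H y y')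
    {x x' : Y} (p : PQ bp x) (q : Path x x') (hq : ∀ t, (q t).1 ∈ Metric.ball κ ε)
    (hT : TT H p) : TT H (p.trans (.mk q)) := by
  obtain ⟨δ, hδ, hδY, hδT⟩ := hT
  have hx : x.1 ∈ Metric.ball κ ε := by simpa using hq 0
  have hx' : x'.1 ∈ Metric.ball κ ε := by simpa using hq 1
  have cv := convex_ball κ ε
  obtain ⟨y0, ⟨h1, h2⟩, h3⟩ := dense_Y0 (U := Metric.ball x.1 δ ∩ Metric.ball κ ε)
    (Metric.isOpen_ball.inter Metric.isOpen_ball) ⟨x.1, Metric.mem_ball_self hδ, hx⟩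
  obtain ⟨ε', hε', hsub⟩ := Metric.isOpen_iff.1 (Metric.isOpen_ball (x := κ) (ε := ε)) x'.1 hx'
  refine ⟨ε', hε', hsub.trans hV, fun y hy hyb hs => ?_⟩
  have hyV := hsub hyb
  obtain ⟨_, _, h6, h7⟩ := hR y0 ⟨h2, h3⟩ y ⟨hyV, hy⟩
  have a1 := hδT y0 h3 h1 (segY cv hV hx h2)
  have e0 := sgm_of_path cv hV q hq (segY cv hV hx hx')
  have e1 := sgm_tri cv hV (x := x) (y := x') (z := p0 y hy) hx hx' hyV (segY cv hV hx hx') hs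
    (segY cv hV hx hyV)
  have e2 := sgm_tri cv hV (x := x) (y := p0 y0 h3) (z := p0 y hy) hx h2 hyV (segY cv hV hx h2) h6
    (segY cv hV hx hyV)
  have := mul_tr a1 h7
  convert this using 1
  simp only [FundamentalGroup.fromPath, FundamentalGroup.fromArrow, dd]
  rw [e0, pq_assoc, ← pq_assoc (sgm x x' _), e1, ← e2]
  simp only [pq_assoc, pq_symm_trans_a]

lemma TT_refl (H : Subgroup GY) : TT H (Path.Homotopic.Quotient.refl bp) := by
  obtain ⟨ε, hε, hsub⟩ := Metric.isOpen_iff.1 isOpen_Y0 0 zero_mem_Y0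
  refine ⟨ε, hε, hsub.trans Y0_sub, fun y hy hyb hs => ?_⟩
  have := tau_seg (convex_ball 0 ε) hsub (Metric.mem_ball_self hε) hyb hs
  rw [tau_bp] at this
  rw [← pq_assoc]
  erw [this]
  rw [pq_trans_symm]
  exact H.one_mem

theorem all_mem (H : Subgroup GY) (hE : Y ⊆ EofR (RH H)) (g : PQ bp bp) :
    FundamentalGroup.fromPath g ∈ H := by
  obtain ⟨γ, rfl⟩ := Path.Homotopic.Quotient.mk_surjective g
  have hE' : ∀ κ ∈ Y, ∃ ε > 0, Metric.ball κ ε ⊆ Y ∧ ∀ y ∈ Metric.ball κ ε ∩ Y0,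
      ∀ y' ∈ Metric.ball κ ε ∩ Y0, RH H y y' := fun κ hκ => hE hκ
  choose! e he heY heR using hE'
  obtain ⟨t, t0, tm, ⟨N, hN⟩, ht⟩ := exists_monotone_Icc_subset_open_cover_unitInterval
    (c := fun κ : Y => {s | (γ s).1 ∈ Metric.ball κ.1 (e κ.1)})
    (fun κ => Metric.isOpen_ball.preimage (by fun_prop))
    (fun s _ => mem_iUnion.2 ⟨γ s, Metric.mem_ball_self (he _ (γ s).2)⟩)
  have key : ∀ n, TT H (.mk ((γ.subpath 0 (t n)).cast γ.source.symm rfl)) := by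
    intro n
    induction n with
    | zero =>
      have := TT_refl H
      have h2 : ∀ s, s = 0 → TT H (.mk ((γ.subpath 0 s).cast γ.source.symm rfl)) := by
        rintro s rfl
        have h3 : ∀ (x : Y) (hx : bp = x) (q : Path x x), q = Path.refl x →
            TT H (.mk (q.cast hx rfl)) := by
          rintro x rfl q rfl
          exact this
        exact h3 _ _ _ (Path.subpath_self γ 0)
      exact h2 _ t0
    | succ n ih =>
      obtain ⟨κ, hκ⟩ := ht n
      have := TT_step H (heY _ κ.2) (heR _ κ.2) _ (γ.subpath (t n) (t (n+1))) (by
        intro s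
        have : γ.subpath (t n) (t (n+1)) s ∈ range (γ.subpath (t n) (t (n+1))) := ⟨s, rfl⟩
        rw [Path.range_subpath_of_le γ _ _ (tm (Nat.le_succ n))] at this
        obtain ⟨u, hu, hu2⟩ := this
        rw [← hu2]
        exact hκ hu) ih
      convert this using 1
      rw [← Path.Homotopic.Quotient.mk_trans, Path.Homotopic.Quotient.eq]
      have h4 := Path.Homotopic.pathCast
        ⟨Path.Homotopy.subpathTransSubpath γ 0 (t n) (t (n+1))⟩ γ.source.symm (rfl : γ (t (n+1)) = _)
      exact h4.symm
  have h1 := key N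
  have h2 : ∀ s, s = 1 → TT H (.mk ((γ.subpath 0 s).cast γ.source.symm rfl)) →
      TT H (.mk γ) := by
    rintro s rfl hh
    have h3 : ∀ (x : Y) (hx : bp = x) (q : Path bp x), q = γ.cast rfl hx.symm →
            TT H (.mk q) → TT H (.mk γ) := by
      rintro x rfl q rfl
      exact id
    refine h3 _ γ.target.symm _ ?_ hh
    rw [Path.subpath_zero_one]
    rfl
  obtain ⟨ε, hε, hsub, hT⟩ := h2 _ (hN N le_rfl) h1
  have := hT 0 zero_mem_Y0 (Metric.mem_ball_self hε) (by
    simpa using Y0_sub zero_mem_Y0)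
  rw [tau_bp] at this
  erw [sgm_self] at this
  have e : (Path.Homotopic.Quotient.refl bp).symm = Path.Homotopic.Quotient.refl bp := rfl
  rw [e, pq_refl_trans, pq_trans_refl] at this
  exact this

/-- any point is joined to the base point -/
theorem joined_bp (x : Y) : Nonempty (Path bp x) := by
  obtain ⟨ε, hε, hsub⟩ := Metric.isOpen_iff.1 isOpen_Y x.1 x.2
  obtain ⟨y0, h1, h3⟩ := dense_Y0 (U := Metric.ball x.1 ε)
    Metric.isOpen_ball ⟨x.1, Metric.mem_ball_self hε⟩
  have h2 := segY (convex_ball _ _) hsub h1 (Metric.mem_ball_self hε)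
  obtain ⟨γ, -⟩ := Path.Homotopic.Quotient.mk_surjective
    ((tau y0 h3).trans (sgm (p0 y0 h3) x h2))
  exact ⟨γ⟩

end S15

namespace S15

open Set Filter Topology

local notation "PQ" => Path.Homotopic.Quotient

abbrev G2 := FreeGroup (Fin 2)
instance instTopG2 : TopologicalSpace G2 := ⊥
instance instDiscG2 : DiscreteTopology G2 := ⟨rfl⟩

abbrev XX := {z : ℂ // z ≠ 4 ∧ z ≠ 4 * Complex.I}

/-- the three charts -/
def chS : Fin 3 → Set XX
  | 0 => {z | ¬ (z.1.im = 0 ∧ 4 ≤ z.1.re) ∧ ¬ (z.1.re = 0 ∧ 4 ≤ z.1.im)}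
  | 1 => {z | 4 < z.1.re ∧ z.1.im < z.1.re}
  | 2 => {z | 4 < z.1.im ∧ z.1.re < z.1.im}

open scoped Classical in
noncomputable def chg : Fin 3 → XX → G2
  | 0 => fun _ => 1
  | 1 => fun z => if z.1.im < 0 then (FreeGroup.of 0)⁻¹ else 1
  | 2 => fun z => if z.1.re < 0 then FreeGroup.of 1 else 1

lemma isOpen_chS : ∀ i, IsOpen (chS i) := by
  have hre : Continuous (fun z : XX => z.1.re) := by fun_prop
  have him : Continuous (fun z : XX => z.1.im) := by fun_prop
  intro i
  fin_cases i
  · have a1 : IsClosed {z : XX | z.1.im = 0 ∧ 4 ≤ z.1.re} :=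
      (isClosed_eq him continuous_const).inter (isClosed_le continuous_const hre)
    have a2 : IsClosed {z : XX | z.1.re = 0 ∧ 4 ≤ z.1.im} :=
      (isClosed_eq hre continuous_const).inter (isClosed_le continuous_const him)
    exact a1.isOpen_compl.inter a2.isOpen_compl
  · exact (isOpen_lt continuous_const hre).inter (isOpen_lt him hre)
  · exact (isOpen_lt continuous_const him).inter (isOpen_lt hre him)

open scoped Classical in
noncomputable def chI (z : XX) : Fin 3 :=
  if z ∈ chS 0 then 0 else if z.1.im = 0 then 1 else 2

lemma mem_chI (z : XX) : z ∈ chS (chI z) := by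
  unfold chI
  split_ifs with h0 h1
  · exact h0
  · have : ¬ (¬ (z.1.im = 0 ∧ 4 ≤ z.1.re) ∧ ¬ (z.1.re = 0 ∧ 4 ≤ z.1.im)) := h0
    have h4 : 4 ≤ z.1.re := by
      by_contra hc
      apply this
      constructor
      · rintro ⟨-, h⟩; exact hc h
      · rintro ⟨-, h⟩; linarith
    have h5 : z.1.re ≠ 4 := fun h => z.2.1 (Complex.ext (by simpa using h) (by simpa using h1))
    refine ⟨lt_of_le_of_ne h4 h5.symm, by linarith⟩
  · have : ¬ (¬ (z.1.im = 0 ∧ 4 ≤ z.1.re) ∧ ¬ (z.1.re = 0 ∧ 4 ≤ z.1.im)) := h0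
    have h4 : z.1.re = 0 ∧ 4 ≤ z.1.im := by
      by_contra hc
      exact this ⟨fun h => h1 h.1, hc⟩
    have h5 : z.1.im ≠ 4 := fun h => z.2.2 (Complex.ext (by simpa using h4.1) (by simpa using h))
    exact ⟨lt_of_le_of_ne h4.2 h5.symm, by linarith⟩

lemma chg_loc : ∀ i, ∀ z ∈ chS i ∩ chS 0, ∀ᶠ w in 𝓝 z, chg i w = chg i z := by
  have hre : Continuous (fun z : XX => z.1.re) := by fun_prop
  have him : Continuous (fun z : XX => z.1.im) := by fun_prop
  intro i z hz
  fin_cases i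
  · exact Eventually.of_forall fun _ => rfl
  · have hz1 : 4 < z.1.re ∧ z.1.im < z.1.re := hz.1
    have h0 : z.1.im ≠ 0 := fun h => hz.2.1 ⟨h, hz1.1.le⟩
    rcases lt_or_gt_of_ne h0 with hh | hh
    · filter_upwards [him.continuousAt.eventually (gt_mem_nhds hh)] with w hw
      simp [chg, hw, hh]
    · filter_upwards [him.continuousAt.eventually (lt_mem_nhds hh)] with w hw
      simp [chg, not_lt.2 hw.le, not_lt.2 hh.le]
  · have hz1 : 4 < z.1.im ∧ z.1.re < z.1.im := hz.1
    have h0 : z.1.re ≠ 0 := fun h => hz.2.2 ⟨h, hz1.1.le⟩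
    rcases lt_or_gt_of_ne h0 with hh | hh
    · filter_upwards [hre.continuousAt.eventually (gt_mem_nhds hh)] with w hw
      simp [chg, hw, hh]
    · filter_upwards [hre.continuousAt.eventually (lt_mem_nhds hh)] with w hw
      simp [chg, not_lt.2 hw.le, not_lt.2 hh.le]

lemma chg_loc2 (i j : Fin 3) (z : XX) (hz : z ∈ chS i ∩ chS j) :
    ∀ᶠ w in 𝓝 z, (chg i w)⁻¹ * chg j w = (chg i z)⁻¹ * chg j z := by
  by_cases hij : i = j
  · subst hij; simp
  have h0 : z ∈ chS 0 := by
    by_cases hi : i = 0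
    · rw [hi] at hz; exact hz.1
    by_cases hj : j = 0
    · rw [hj] at hz; exact hz.2
    exfalso
    fin_cases i <;> fin_cases j <;> simp [chS] at hz hi hj hij
    · linarith
    · linarith
  filter_upwards [chg_loc i z ⟨hz.1, h0⟩, chg_loc j z ⟨hz.2, h0⟩] with w h1 h2
  rw [h1, h2]

noncomputable def ZZ : FiberBundleCore (Fin 3) XX G2 where
  baseSet := chS
  isOpen_baseSet := isOpen_chS
  indexAt := chI
  mem_baseSet_at := mem_chI
  coordChange i j x v := v * ((chg i x)⁻¹ * chg j x)
  coordChange_self i x _ v := by simp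
  continuousOn_coordChange i j := by
    rintro ⟨z, v⟩ ⟨hz, -⟩
    apply ContinuousAt.continuousWithinAt
    have h1 : ∀ᶠ w in 𝓝 (z, v), w.2 = v :=
      (continuous_snd (X := XX) (Y := G2)).continuousAt (x := (z, v)) |>.eventually
        (show ∀ᶠ u in 𝓝 v, u = v by rw [nhds_discrete, eventually_pure])
    have h2 := (continuous_fst (X := XX) (Y := G2)).continuousAt (x := (z, v)) |>.eventually (chg_loc2 i j z hz)
    refine ContinuousAt.congr (f := fun _ => v * ((chg i z)⁻¹ * chg j z)) continuousAt_const ?_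
    filter_upwards [h1, h2] with w e1 e2
    rw [e1, e2]
  coordChange_comp i j k x _ v := by simp [mul_assoc]

abbrev EE := ZZ.TotalSpace
noncomputable abbrev prE : EE → XX := ZZ.proj

lemma cov_prE : IsCoveringMap prE := FiberBundle.isCoveringMap (F := G2) (E := ZZ.Fiber)

def mkE (z : XX) (v : G2) : EE := ⟨z, v⟩
def cE (e : EE) : G2 := e.2

noncomputable instance actE : MulAction G2 EE where
  smul g e := mkE e.1 (g * cE e)
  one_smul e := by
    change mkE e.1 (1 * cE e) = e
    rw [one_mul]; rfl
  mul_smul g g' e := by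
    change mkE e.1 (g * g' * cE e) = mkE e.1 (g * (g' * cE e))
    rw [mul_assoc]

lemma smul_mkE (g : G2) (z : XX) (v : G2) : g • mkE z v = mkE z (g * v) := rfl

lemma mkE_inj {z : XX} {v w : G2} (hh : mkE z v = mkE z w) : v = w := by
  exact congrArg cE hh

lemma cont_smulE (g : G2) : Continuous (fun e : EE => g • e) := by
  rw [continuous_iff_continuousAt]
  intro e
  rw [FiberBundle.continuousAt_totalSpace]
  constructor
  · exact (FiberBundle.continuous_proj G2 ZZ.Fiber).continuousAt
  · have h1 := (FiberBundle.continuousAt_totalSpace G2 (E := ZZ.Fiber) (fun e' : EE => e') (x₀ := e)).1 continuousAt_id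
    have h2 : ContinuousAt (fun v : G2 => g * v) ((trivializationAt G2 ZZ.Fiber e.proj) e).2 :=
      continuous_of_discreteTopology.continuousAt
    refine (ContinuousAt.comp (f := fun e' : EE => ((trivializationAt G2 ZZ.Fiber e.proj) e').2) h2 h1.2).congr ?_
    refine Eventually.of_forall fun e' => ?_
    change g * (cE e' * _) = (g * cE e') * _
    rw [mul_assoc]
    rfl

theorem qcov : IsQuotientCoveringMap prE G2 := by
  rw [isQuotientCoveringMap_iff_isCoveringMap_and]
  refine ⟨cov_prE, fun z => ⟨mkE z 1, rfl⟩, ⟨cont_smulE⟩, ⟨?_⟩, ?_⟩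
  · rintro a b e hh
    exact mul_right_cancel (b := cE e) (mkE_inj (z := e.1) hh)
  · rintro ⟨z, v⟩ ⟨w, u⟩
    constructor
    · intro hh
      have : z = w := hh
      subst this
      refine ⟨cE (mkE z v) * (cE (mkE z u))⁻¹, ?_⟩
      change mkE z ((cE (mkE z v) * (cE (mkE z u))⁻¹) * cE (mkE z u)) = mkE z (cE (mkE z v))
      congr 1
      simp
    · rintro ⟨g, hg⟩
      exact (congrArg prE hg).symm

lemma chI_zero {z : XX} (hz : z ∈ chS 0) : chI z = 0 := by simp [chI, hz]

/-- monodromy of a path inside a chart -/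
lemma mono_chart (i : Fin 3) {x y : XX} (γ : Path x y) (hγ : ∀ t, γ t ∈ chS i)
    (hx : x ∈ chS 0) (hy : y ∈ chS 0) (v : G2) :
    qcov.isCoveringMap.monodromy (.mk γ) ⟨mkE x v, rfl⟩ = ⟨mkE y (v * chg i x * (chg i y)⁻¹), rfl⟩ := by
  have e0 : (ZZ.localTriv i).toOpenPartialHomeomorph.symm (x, v * chg i x) = mkE x v := by
    rw [FiberBundleCore.localTriv_symm_apply]
    change mkE x (v * chg i x * ((chg i x)⁻¹ * chg (chI x) x)) = _
    rw [chI_zero hx]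
    simp [chg]
  have e1 : (ZZ.localTriv i).toOpenPartialHomeomorph.symm (y, v * chg i x)
      = mkE y (v * chg i x * (chg i y)⁻¹) := by
    rw [FiberBundleCore.localTriv_symm_apply]
    change mkE y (v * chg i x * ((chg i y)⁻¹ * chg (chI y) y)) = _
    rw [chI_zero hy]
    simp [chg]
  let Γ : Path (mkE x v) (mkE y (v * chg i x * (chg i y)⁻¹)) :=
    { toFun := fun t => (ZZ.localTriv i).toOpenPartialHomeomorph.symm (γ t, v * chg i x)
      continuous_toFun := by
        refine (ZZ.localTriv i).toOpenPartialHomeomorph.symm.continuousOn.comp_continuous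
          (by fun_prop) (fun t => ?_)
        rw [OpenPartialHomeomorph.symm_source, FiberBundleCore.mem_localTriv_target]
        exact hγ t
      source' := by simp only [Path.source]; exact e0
      target' := by simp only [Path.target]; exact e1 }
  refine qcov.isCoveringMap.monodromy_eq_of_map_eq (ex := ⟨mkE x v, rfl⟩)
    (ey := ⟨mkE y (v * chg i x * (chg i y)⁻¹), rfl⟩) (.mk Γ) ?_
  rfl

end S15

namespace S15

open Set Filter Topology

local notation "PQ" => Path.Homotopic.Quotient

noncomputable def fm : C(Y, XX) := ⟨fun p => ⟨f p.1, p.2⟩, by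
  have := continuous_f
  apply Continuous.subtype_mk
  fun_prop⟩

def Mo {x y : Y} (q : PQ x y) (v w : G2) : Prop :=
  qcov.isCoveringMap.monodromy (q.map fm) ⟨mkE (fm x) v, rfl⟩ = ⟨mkE (fm y) w, rfl⟩

lemma pq_map_trans {A B : Type*} [TopologicalSpace A] [TopologicalSpace B] (g : C(A, B))
    {x y z : A} (p : PQ x y) (q : PQ y z) : (p.trans q).map g = (p.map g).trans (q.map g) := by
  obtain ⟨p, rfl⟩ := Path.Homotopic.Quotient.mk_surjective p
  obtain ⟨q, rfl⟩ := Path.Homotopic.Quotient.mk_surjective q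
  rw [← Path.Homotopic.Quotient.mk_trans, ← Path.Homotopic.Quotient.mk_map, Path.map_trans]
  rfl

lemma Mo.trans {x y z : Y} {p : PQ x y} {q : PQ y z} {u v w : G2} (h1 : Mo p u v) (h2 : Mo q v w) :
    Mo (p.trans q) u w := by
  unfold Mo at *
  rw [pq_map_trans, IsCoveringMap.monodromy_trans_apply, h1, h2]

lemma Mo.symm {x y : Y} {p : PQ x y} {v w : G2} (h1 : Mo p v w) : Mo p.symm w v := by
  unfold Mo at *
  rw [← h1, ← IsCoveringMap.monodromy_trans_apply, ← pq_map_trans, pq_trans_symm]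
  exact congrFun (IsCoveringMap.monodromy_refl _) _

lemma Mo_seg (i : Fin 3) (x y : Y) (hs : segment ℝ x.1 y.1 ⊆ Y) (hx : fm x ∈ chS 0) (hy : fm y ∈ chS 0)
    (hh : ∀ p : Y, p.1 ∈ segment ℝ x.1 y.1 → fm p ∈ chS i) (v : G2) :
    Mo (sgm x y hs) v (v * chg i (fm x) * (chg i (fm y))⁻¹) := by
  unfold Mo
  exact mono_chart i ((segP x y hs).map fm.continuous) (fun t => hh _
    (segP_mem (convex_segment _ _) hs (left_mem_segment ℝ _ _) (right_mem_segment ℝ _ _) t)) hx hy v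

lemma Mo_seg0 (x y : Y) (hs : segment ℝ x.1 y.1 ⊆ Y)
    (hh : ∀ p : Y, p.1 ∈ segment ℝ x.1 y.1 → fm p ∈ chS 0) (v : G2) :
    Mo (sgm x y hs) v v := by
  have := Mo_seg 0 x y hs (hh x (left_mem_segment ℝ _ _)) (hh y (right_mem_segment ℝ _ _)) hh v
  simpa [chg] using this

lemma chS0_of_norm {p : Y} (hp : ‖f p.1‖ < 4) : fm p ∈ chS 0 := by
  change ¬ ((f p.1).im = 0 ∧ 4 ≤ (f p.1).re) ∧ ¬ ((f p.1).re = 0 ∧ 4 ≤ (f p.1).im)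
  have h1 := (Complex.re_le_norm (f p.1))
  have h2 := (Complex.im_le_norm (f p.1))
  constructor
  · rintro ⟨-, h⟩; linarith
  · rintro ⟨-, h⟩; linarith

lemma seg_sh {y : ℂ × ℂ} {r s : ℝ} {p : ℂ × ℂ} (hr : 0 ≤ r) (hs : 0 ≤ s)
    (hp : p ∈ segment ℝ (sh y r) (sh y s)) : ∃ u : ℝ, 0 ≤ u ∧ p = sh y u := by
  have := (convex_strip (convex_singleton y) 0).segment_subset (sh_strip (mem_singleton _) hr)
    (sh_strip (mem_singleton _) hs) hp
  obtain ⟨q, hq, u, hu, rfl⟩ := this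
  rw [mem_singleton_iff] at hq
  subst hq
  exact ⟨u, hu, rfl⟩

lemma norm_ray0 {r : ℝ} (hr : 0 ≤ r) : ‖f (sh 0 r)‖ < 4 := by
  have : sh 0 r = (0, -(r : ℂ)) := by simp [sh]
  rw [this, f_zero, norm_pow, Complex.norm_exp]
  simp only [neg_re, ofReal_re]
  have : Real.exp (-r) ≤ 1 := by simpa using hr
  have h2 : Real.exp (-r) ^ 3 ≤ 1 := pow_le_one₀ (Real.exp_pos _).le this
  linarith

lemma Mo_tau (y : ℂ × ℂ) (hy : y ∈ Y0) (hray : ∀ (u : ℝ) (hu : 0 ≤ u), fm (pt y hy u hu) ∈ chS 0)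
    (v : G2) : Mo (tau y hy) v v := by
  obtain ⟨r, hF⟩ := exists_Far ‖y‖
  rw [tau_eq _ _ r hF]
  unfold tau'
  refine Mo.trans (Mo_seg0 _ _ _ (fun p hp => ?_) v) (Mo.trans (Mo_seg0 _ _ _ (fun p hp => ?_) v)
    (Mo_seg0 _ _ _ (fun p hp => ?_) v))
  · have hp' : p.1 ∈ segment ℝ (sh 0 0) (sh 0 r) := by rw [sh_zero]; exact hp
    obtain ⟨u, hu, e⟩ := seg_sh le_rfl hF.1 hp'
    apply chS0_of_norm
    rw [e]
    exact norm_ray0 hu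
  · have := (cvx_far ‖y‖ r).segment_subset (far_mem (y := 0) (by simp) le_rfl)
      (far_mem le_rfl le_rfl) hp
    obtain ⟨q, hq, u, hu, e⟩ := this
    apply chS0_of_norm
    rw [e]
    exact hF.2 q (by simpa using hq) u hu
  · have hp' : p.1 ∈ segment ℝ (sh y r) (sh y 0) := by rw [sh_zero]; exact hp
    obtain ⟨u, hu, e⟩ := seg_sh hF.1 le_rfl hp'
    have : p = pt y hy u hu := Subtype.ext e
    rw [this]
    exact hray u hu

lemma f_slice_re (η : ℂ) : (f (0, η)).re = Real.exp (3 * η.re) * Real.cos (3 * η.im) := by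
  rw [f_zero, ← Complex.exp_nat_mul, Complex.exp_re]; simp
lemma f_slice_im (η : ℂ) : (f (0, η)).im = Real.exp (3 * η.re) * Real.sin (3 * η.im) := by
  rw [f_zero, ← Complex.exp_nat_mul, Complex.exp_im]; simp

lemma ray_slice (η : ℂ) (hy : (0, η) ∈ Y0) (h1 : Real.sin (3 * η.im) ≠ 0)
    (h2 : Real.cos (3 * η.im) ≠ 0) (u : ℝ) (hu : 0 ≤ u) : fm (pt (0, η) hy u hu) ∈ chS 0 := by
  have e : sh (0, η) u = (0, η - u) := rfl
  change ¬ ((f (sh (0, η) u)).im = 0 ∧ _) ∧ ¬ ((f (sh (0, η) u)).re = 0 ∧ _)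
  rw [e, f_slice_re, f_slice_im]
  have i1 : (η - u).im = η.im := by simp
  rw [i1]
  constructor
  · rintro ⟨hh, -⟩
    rcases mul_eq_zero.1 hh with h | h
    · exact (Real.exp_pos _).ne' h
    · exact h1 h
  · rintro ⟨hh, -⟩
    rcases mul_eq_zero.1 hh with h | h
    · exact (Real.exp_pos _).ne' h
    · exact h2 h

noncomputable def LL : ℝ := Real.log 16 / 3
noncomputable def tt : ℝ := Real.pi / 18

lemma exp_LL : Real.exp (3 * LL) = 16 := by
  rw [LL, mul_div_cancel₀ _ (by norm_num), Real.exp_log (by norm_num)]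

lemma LL_lt : L0 < LL := by
  unfold L0 LL
  have := Real.log_lt_log (x := 4) (y := 16) (by norm_num) (by norm_num)
  linarith

lemma tt_pos : 0 < tt := by unfold tt; positivity
lemma tt_lt : tt < Real.pi / 6 := by unfold tt; linarith [Real.pi_pos]

lemma kp_Y0 {ψ s : ℝ} (hA : Ang ψ) (hs : s ≠ 0) (hs2 : |s| < Real.pi / 6) : kp LL (ψ + s) ∈ Y0 := by
  apply slice_Y0
  · simpa using (hA s hs hs2).1
  · simpa using (hA s hs hs2).2

lemma kp_seg {ψ : ℝ} {p : ℂ × ℂ} (hp : p ∈ segment ℝ (kp LL (ψ + tt)) (kp LL (ψ - tt))) :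
    ∃ s : ℝ, |s| ≤ tt ∧ p = (0, (LL : ℂ) + ((ψ + s : ℝ) : ℂ) * I) := by
  obtain ⟨a, b, ha, hb, hab, rfl⟩ := hp
  have hb' : b = 1 - a := by linarith
  subst hb'
  refine ⟨(2 * a - 1) * tt, ?_, ?_⟩
  · rw [abs_mul, abs_of_pos tt_pos]
    have : |2 * a - 1| ≤ 1 := by rw [abs_le]; constructor <;> linarith
    nlinarith [tt_pos]
  · ext
    · simp [kp]
    · simp [kp]; ring

lemma trig_bd {s : ℝ} (hs : |s| ≤ tt) : 4 / 5 ≤ Real.cos (3 * s) ∧ |Real.sin (3 * s)| ≤ 1 / 2 := by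
  have hp := Real.pi_pos
  unfold tt at hs
  rw [abs_le] at hs
  have h3 : |3 * s| ≤ Real.pi / 6 := by rw [abs_le]; constructor <;> linarith
  have a1 : Real.cos (Real.pi / 6) ≤ Real.cos |3 * s| :=
    Real.cos_le_cos_of_nonneg_of_le_pi (abs_nonneg _) (by linarith) h3
  rw [Real.cos_pi_div_six, Real.cos_abs] at a1
  have a2 : (8 / 5 : ℝ) ≤ √3 := Real.le_sqrt_of_sq_le (by norm_num)
  rw [abs_le] at h3
  have s1 : Real.sin (3 * s) ≤ Real.sin (Real.pi / 6) :=
    Real.sin_le_sin_of_le_of_le_pi_div_two (by linarith) (by linarith) h3.2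
  have s2 : Real.sin (-(Real.pi / 6)) ≤ Real.sin (3 * s) :=
    Real.sin_le_sin_of_le_of_le_pi_div_two (by linarith) (by linarith) h3.1
  rw [Real.sin_neg] at s2
  rw [Real.sin_pi_div_six] at s1 s2
  exact ⟨by linarith, abs_le.2 ⟨s2, s1⟩⟩

lemma sin_tt : 0 < Real.sin (3 * tt) :=
  Real.sin_pos_of_pos_of_lt_pi (by linarith [tt_pos]) (by linarith [tt_lt, Real.pi_pos])

lemma kp_segY {ψ : ℝ} : segment ℝ (kp LL (ψ + tt)) (kp LL (ψ - tt)) ⊆ Y := by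
  intro p hp
  obtain ⟨s, -, rfl⟩ := kp_seg hp
  apply slice_big
  simpa using LL_lt

lemma kpY0 {ψ : ℝ} (hA : Ang ψ) : kp LL (ψ + tt) ∈ Y0 ∧ kp LL (ψ - tt) ∈ Y0 := by
  have h1 := tt_pos
  have h2 := tt_lt
  refine ⟨kp_Y0 hA h1.ne' (by rwa [abs_of_pos h1]), ?_⟩
  rw [sub_eq_add_neg]
  exact kp_Y0 hA (neg_ne_zero.2 h1.ne') (by rwa [abs_neg, abs_of_pos h1])

noncomputable def de (ψ : ℝ) (hA : Ang ψ) : PQ bp bp :=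
  dd (kp LL (ψ + tt)) (kp LL (ψ - tt)) (kpY0 hA).1 (kpY0 hA).2 kp_segY

lemma kp_ray {ψ s : ℝ} (hA : Ang ψ) (hy : kp LL (ψ + s) ∈ Y0) (hs : s ≠ 0) (hs2 : |s| < Real.pi / 6)
    (u : ℝ) (hu : 0 ≤ u) : fm (pt (kp LL (ψ + s)) hy u hu) ∈ chS 0 := by
  apply ray_slice
  · simpa using (hA s hs hs2).1
  · simpa using (hA s hs hs2).2

lemma Mo_de (ψ : ℝ) (hA : Ang ψ) (i : Fin 3)
    (hh : ∀ p : Y, ∀ s : ℝ, |s| ≤ tt → p.1 = (0, (LL : ℂ) + ((ψ + s : ℝ) : ℂ) * I) → fm p ∈ chS i) :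
    Mo (de ψ hA) 1 (chg i (fm (p0 _ (kpY0 hA).1)) * (chg i (fm (p0 _ (kpY0 hA).2)))⁻¹) := by
  have h1 := tt_pos
  have h2 := tt_lt
  have r1 := kp_ray hA (kpY0 hA).1 h1.ne' (by rwa [abs_of_pos h1])
  have r2 : ∀ (u : ℝ) (hu : 0 ≤ u), fm (pt (kp LL (ψ - tt)) (kpY0 hA).2 u hu) ∈ chS 0 := by
    have h3 := (kpY0 hA).2
    have e : ψ - tt = ψ + -tt := sub_eq_add_neg _ _
    rw [e] at h3
    have := kp_ray hA h3 (neg_ne_zero.2 h1.ne') (by rwa [abs_neg, abs_of_pos h1])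
    simpa only [e] using this
  have z1 := r1 0 le_rfl
  have z2 := r2 0 le_rfl
  simp only [pt, sh_zero] at z1 z2
  have m := Mo_seg i (p0 _ (kpY0 hA).1) (p0 _ (kpY0 hA).2) kp_segY z1 z2 (fun p hp => by
    obtain ⟨s, hs, e⟩ := kp_seg hp
    exact hh p s hs e) 1
  rw [one_mul] at m
  exact (Mo_tau _ _ r1 1).trans (m.trans (Mo_tau _ _ r2 _).symm)

lemma Mo_de0 : Mo (de 0 ang0) 1 (FreeGroup.of 0) := by
  have m := Mo_de 0 ang0 1 (by
    intro p s hs e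
    change 4 < (f p.1).re ∧ (f p.1).im < (f p.1).re
    rw [e, f_slice_re, f_slice_im]
    have e1 : ((LL : ℂ) + ((0 + s : ℝ) : ℂ) * I).re = LL := by simp
    have e2 : ((LL : ℂ) + ((0 + s : ℝ) : ℂ) * I).im = s := by simp
    rw [e1, e2, exp_LL]
    obtain ⟨h1, h2⟩ := trig_bd hs
    have := le_abs_self (Real.sin (3 * s))
    constructor <;> linarith)
  have c1 : chg 1 (fm (p0 _ (kpY0 ang0).1)) = 1 := by
    have : ¬ (f (kp LL (0 + tt))).im < 0 := by
      rw [kp, f_slice_im]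
      have e2 : ((LL : ℂ) + ((0 + tt : ℝ) : ℂ) * I).im = tt := by simp
      rw [e2, not_lt]
      exact (mul_pos (Real.exp_pos _) sin_tt).le
    exact if_neg this
  have c2 : chg 1 (fm (p0 _ (kpY0 ang0).2)) = (FreeGroup.of 0)⁻¹ := by
    have : (f (kp LL (0 - tt))).im < 0 := by
      rw [kp, f_slice_im]
      have e2 : ((LL : ℂ) + ((0 - tt : ℝ) : ℂ) * I).im = -tt := by simp
      rw [e2, mul_neg, Real.sin_neg, mul_neg, neg_lt_zero]
      exact mul_pos (Real.exp_pos _) sin_tt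
    exact if_pos this
  rw [c1, c2] at m
  simpa using m

lemma trig_shift (s : ℝ) : Real.cos (3 * (-(Real.pi / 2) + s)) = - Real.sin (3 * s) ∧
    Real.sin (3 * (-(Real.pi / 2) + s)) = Real.cos (3 * s) := by
  have e : 3 * (-(Real.pi / 2) + s) = (3 * s + Real.pi / 2) - 2 * Real.pi := by ring
  rw [e, Real.cos_sub_two_pi, Real.sin_sub_two_pi, Real.cos_add_pi_div_two, Real.sin_add_pi_div_two]
  exact ⟨rfl, rfl⟩

lemma Mo_de1 : Mo (de (-(Real.pi / 2)) ang1) 1 (FreeGroup.of 1) := by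
  have m := Mo_de (-(Real.pi / 2)) ang1 2 (by
    intro p s hs e
    change 4 < (f p.1).im ∧ (f p.1).re < (f p.1).im
    rw [e, f_slice_re, f_slice_im]
    have e1 : ((LL : ℂ) + ((-(Real.pi / 2) + s : ℝ) : ℂ) * I).re = LL := by
      rw [Complex.add_re, Complex.re_ofReal_mul, Complex.I_re]; simp
    have e2 : ((LL : ℂ) + ((-(Real.pi / 2) + s : ℝ) : ℂ) * I).im = -(Real.pi / 2) + s := by
      rw [Complex.add_im, Complex.im_ofReal_mul, Complex.I_im]; simp
    rw [e1, e2, exp_LL, (trig_shift s).1, (trig_shift s).2]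
    obtain ⟨h1, h2⟩ := trig_bd hs
    have := neg_abs_le (Real.sin (3 * s))
    constructor <;> linarith)
  have c1 : chg 2 (fm (p0 _ (kpY0 ang1).1)) = FreeGroup.of 1 := by
    have : (f (kp LL (-(Real.pi / 2) + tt))).re < 0 := by
      rw [kp, f_slice_re]
      have e2 : ((LL : ℂ) + ((-(Real.pi / 2) + tt : ℝ) : ℂ) * I).im = -(Real.pi / 2) + tt := by
        rw [Complex.add_im, Complex.im_ofReal_mul, Complex.I_im]; simp
      rw [e2, (trig_shift tt).1, mul_neg, neg_lt_zero]
      exact mul_pos (Real.exp_pos _) sin_tt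
    exact if_pos this
  have c2 : chg 2 (fm (p0 _ (kpY0 ang1).2)) = 1 := by
    have : ¬ (f (kp LL (-(Real.pi / 2) - tt))).re < 0 := by
      rw [kp, f_slice_re]
      have e2 : ((LL : ℂ) + ((-(Real.pi / 2) - tt : ℝ) : ℂ) * I).im = -(Real.pi / 2) + -tt := by
        rw [Complex.add_im, Complex.im_ofReal_mul, Complex.I_im]; simp; ring
      rw [e2, (trig_shift (-tt)).1, mul_neg 3 tt, Real.sin_neg, neg_neg, not_lt]
      exact (mul_pos (Real.exp_pos _) sin_tt).le
    exact if_neg this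
  rw [c1, c2] at m
  simpa using m

/-- the two loops generate -/
theorem gens : Subgroup.closure {FundamentalGroup.fromPath (de 0 ang0),
    FundamentalGroup.fromPath (de (-(Real.pi / 2)) ang1)} = (⊤ : Subgroup GY) := by
  rw [eq_top_iff]
  intro g _
  refine all_mem _ (EofR_eq (rels_RH _) LL_lt tt_pos tt_lt ?_ ?_) g
  · exact ⟨(kpY0 ang0).1, (kpY0 ang0).2, kp_segY, Subgroup.subset_closure (Or.inl rfl)⟩
  · exact ⟨(kpY0 ang1).1, (kpY0 ang1).2, kp_segY, Subgroup.subset_closure (Or.inr rfl)⟩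

end S15

namespace S15

open Set Filter Topology

local notation "PQ" => Path.Homotopic.Quotient

section gen
variable {E X G V : Type*} [TopologicalSpace E] [TopologicalSpace X] [TopologicalSpace V] [Group G]
  [MulAction G E] {p : E → X}

lemma fgt_iff (hp : IsQuotientCoveringMap p G) (F : C(V, X)) {w : V} (e : p ⁻¹' {F w}) (γ : Path w w)
    (g : G) : hp.fundamentalGroupToMulOpposite e (FundamentalGroup.map F w
      (FundamentalGroup.fromPath (Path.Homotopic.Quotient.mk γ))) = MulOpposite.op g ↔
      ∃ Γ : Path e.1 (g • e.1), ∀ t, p (Γ t) = F (γ t) := by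
  rw [hp.fundamentalGroupToMulOpposite_apply_eq_Iff]
  change g • e.1 = (hp.isCoveringMap.monodromy (Path.Homotopic.Quotient.mk (γ.map F.continuous)) e).1 ↔ _
  constructor
  · intro h
    have h0 : (γ.map F.continuous : C(unitInterval, X)) 0 = p e.1 := by
      have := e.2
      simp only [mem_preimage, mem_singleton_iff] at this
      simp [this]
    refine ⟨⟨hp.isCoveringMap.liftPath (γ.map F.continuous) e.1 h0,
      hp.isCoveringMap.liftPath_zero .., h.symm⟩, fun t => ?_⟩
    exact congrFun (hp.isCoveringMap.liftPath_lifts (γ.map F.continuous) e.1 h0) t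
  · rintro ⟨Γ, hΓ⟩
    have hy : g • e.1 ∈ p ⁻¹' {F w} := by
      have := hΓ 1
      simpa using this
    have := hp.isCoveringMap.monodromy_eq_of_map_eq
      (γ := Path.Homotopic.Quotient.mk (γ.map F.continuous)) (ex := e) (ey := ⟨g • e.1, hy⟩)
      (Path.Homotopic.Quotient.mk Γ) (by
        refine congrArg Path.Homotopic.Quotient.mk ?_
        ext t
        exact hΓ t)
    rw [this]
end gen

abbrev WW := W ({4, 4 * Complex.I} : Set ℂ)
abbrev CC := {z : ℂ // z ≠ 0}
noncomputable abbrev KK := AddSubgroup.zmultiples (2 * Real.pi * Complex.I)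
abbrev MK := Multiplicative KK
noncomputable abbrev ec (z : ℂ) : CC := ⟨Complex.exp z, Complex.exp_ne_zero z⟩

lemma hexp : IsQuotientCoveringMap ec MK := Complex.isAddQuotientCoveringMap_exp.toMultiplicative

noncomputable def em0 (p : ℂ × ℂ) : ℂ × ℂ :=
  ((Complex.exp (p.2 + p.1) - Complex.exp (p.2 - p.1)) / 4, Complex.exp (p.2 + p.1))

lemma h_em0 (p : ℂ × ℂ) : h (em0 p) = f p := by
  unfold h em0 f fA fB
  simp only [Complex.cosh, Complex.sinh, Complex.exp_add, sub_eq_add_neg]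
  have : Complex.exp p.1 * Complex.exp (-p.1) = 1 := by rw [← Complex.exp_add]; simp
  generalize Complex.exp p.1 = a at *
  generalize Complex.exp (-p.1) = b at *
  generalize Complex.exp p.2 = c at *
  linear_combination (-3 / 8 * c ^ 3 * (a + b)) * this * (-1)

lemma em0_mem {p : ℂ × ℂ} : em0 p ∈ WW ↔ p ∈ Y := by
  have h1 : em0 p ∉ ell₁ := by
    simp only [ell₁, em0, mem_ofPred_eq]
    intro h
    exact Complex.exp_ne_zero (p.2 - p.1) (by linear_combination h)
  have h2 : em0 p ∉ ell₂ := by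
    simp only [ell₂, em0, mem_ofPred_eq]
    exact Complex.exp_ne_zero _
  simp [WW, W, Y, h_em0, h1, h2]

noncomputable def emap : C(Y, WW) := ⟨fun p => ⟨em0 p.1, em0_mem.2 p.2⟩, by
  unfold em0
  apply Continuous.subtype_mk
  fun_prop⟩

noncomputable def hmap : C(WW, XX) := ⟨fun w => ⟨h w.1, by
  have := w.2.1
  simpa using this⟩, by
  unfold h
  apply Continuous.subtype_mk
  fun_prop⟩

lemma hmap_emap (y : Y) : hmap (emap y) = fm y := Subtype.ext (h_em0 _)

def Am : C(WW, CC) := ⟨fun w => ⟨w.1.2 - 4 * w.1.1, fun h => w.2.2.1 (sub_eq_zero.1 h)⟩, by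
  apply Continuous.subtype_mk
  fun_prop⟩
def Bm : C(WW, CC) := ⟨fun w => ⟨w.1.2, w.2.2.2⟩, by
  apply Continuous.subtype_mk
  fun_prop⟩

lemma Am_emap (y : Y) : Am (emap y) = ec (y.1.2 - y.1.1) := by
  apply Subtype.ext
  change Complex.exp (y.1.2 + y.1.1) - 4 * ((Complex.exp (y.1.2 + y.1.1) - Complex.exp (y.1.2 - y.1.1)) / 4) = Complex.exp (y.1.2 - y.1.1)
  ring
lemma Bm_emap (y : Y) : Bm (emap y) = ec (y.1.2 + y.1.1) := rfl

lemma WW_ext {w w' : WW} (h1 : Am w = Am w') (h2 : Bm w = Bm w') : w = w' := by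
  have h1 := congrArg Subtype.val h1
  have h2 : w.1.2 = w'.1.2 := congrArg Subtype.val h2
  change w.1.2 - 4 * w.1.1 = w'.1.2 - 4 * w'.1.1 at h1
  apply Subtype.ext
  apply Prod.ext
  · linear_combination (h2 - h1) / 4
  · exact h2

noncomputable def w0 : WW := emap bp

lemma Am_w0 : ec 0 = Am w0 := by
  have := Am_emap bp
  rw [w0, this]; simp
lemma Bm_w0 : ec 0 = Bm w0 := by
  have := Bm_emap bp
  rw [w0, this]; simp

lemma ec_K (k : KK) : ec k.1 = ec 0 := by
  obtain ⟨k, n, rfl⟩ := k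
  apply Subtype.ext
  change Complex.exp (n • (2 * Real.pi * Complex.I)) = Complex.exp 0
  rw [zsmul_eq_mul, Complex.exp_int_mul_two_pi_mul_I, Complex.exp_zero]

/-- a pair of logarithms gives a point -/
lemma exists_lift (w : WW) {a b : ℂ} (ha : ec a = Am w) (hb : ec b = Bm w) :
    ((b - a) / 2, (a + b) / 2) ∈ Y ∧ em0 ((b - a) / 2, (a + b) / 2) = w.1 := by
  have e : em0 ((b - a) / 2, (a + b) / 2) = w.1 := by
    have ha : Complex.exp a = w.1.2 - 4 * w.1.1 := congrArg Subtype.val ha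
    have hb : Complex.exp b = w.1.2 := congrArg Subtype.val hb
    unfold em0
    apply Prod.ext
    · simp only
      rw [show (a + b) / 2 + (b - a) / 2 = b by ring, show (a + b) / 2 - (b - a) / 2 = a by ring,
        ha, hb]; ring
    · simp only
      rw [show (a + b) / 2 + (b - a) / 2 = b by ring, hb]
  exact ⟨em0_mem.1 (e ▸ w.2), e⟩

noncomputable def th : GY →* G2ᵐᵒᵖ :=
  (qcov.fundamentalGroupToMulOpposite ⟨mkE (fm bp) 1, rfl⟩).comp (FundamentalGroup.map fm bp)

lemma th_of (q : PQ bp bp) (g : G2) (hq : Mo q 1 g) :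
    th (FundamentalGroup.fromPath q) = MulOpposite.op g := by
  refine qcov.fundamentalGroupToMulOpposite_apply_eq_Iff.2 ?_
  have : qcov.isCoveringMap.monodromy (FundamentalGroup.map fm bp (FundamentalGroup.fromPath q)) ⟨mkE (fm bp) 1, rfl⟩ = ⟨mkE (fm bp) g, rfl⟩ := hq
  refine Eq.trans ?_ (congrArg Subtype.val this).symm
  simp [smul_mkE]

noncomputable def ddx : Fin 2 → GY := ![FundamentalGroup.fromPath (de 0 ang0),
  FundamentalGroup.fromPath (de (-(Real.pi / 2)) ang1)]

lemma th_ddx (i : Fin 2) : th (ddx i) = MulOpposite.op (FreeGroup.of i) := by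
  fin_cases i
  · exact th_of _ _ Mo_de0
  · exact th_of _ _ Mo_de1

lemma th_bij : Function.Bijective th := by
  let s : G2 →* GY := FreeGroup.lift fun i => (ddx i)⁻¹
  let τ : GY →* G2 := (MulEquiv.inv' G2).symm.toMonoidHom.comp th
  have hτs : τ.comp s = MonoidHom.id _ := by
    ext i
    simp [τ, s, th_ddx]
  have hs : Function.Surjective s := by
    rw [← MonoidHom.range_eq_top, eq_top_iff, ← gens, Subgroup.closure_le]
    rintro x (rfl | rfl)
    · exact ⟨(FreeGroup.of 0)⁻¹, by simp [s, ddx]⟩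
    · exact ⟨(FreeGroup.of 1)⁻¹, by simp [s, ddx]⟩
  have hl : ∀ x, τ (s x) = x := fun x => DFunLike.congr_fun hτs x
  have hτ : Function.Bijective τ := by
    constructor
    · intro a b hab
      obtain ⟨a, rfl⟩ := hs a
      obtain ⟨b, rfl⟩ := hs b
      rw [hl, hl] at hab
      rw [hab]
    · intro x; exact ⟨s x, hl x⟩
  have : (τ : GY → G2) = (MulEquiv.inv' G2).symm ∘ th := rfl
  rw [this] at hτ
  exact (Function.Bijective.of_comp_iff' (MulEquiv.inv' G2).symm.bijective _).1 hτ

abbrev GW := FundamentalGroup WW w0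

noncomputable def wA : GW →* MKᵐᵒᵖ :=
  (hexp.fundamentalGroupToMulOpposite ⟨0, Am_w0⟩).comp (FundamentalGroup.map Am w0)
noncomputable def wB : GW →* MKᵐᵒᵖ :=
  (hexp.fundamentalGroupToMulOpposite ⟨0, Bm_w0⟩).comp (FundamentalGroup.map Bm w0)
noncomputable def wC : GW →* G2ᵐᵒᵖ :=
  (qcov.fundamentalGroupToMulOpposite ⟨mkE (hmap w0) 1, rfl⟩).comp (FundamentalGroup.map hmap w0)

lemma smul0 (g : MK) : g • (0 : ℂ) = (Multiplicative.toAdd g).1 := add_zero _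

lemma wA_iff (γ : Path w0 w0) (g : MK) :
    wA (FundamentalGroup.fromPath (Path.Homotopic.Quotient.mk γ)) = MulOpposite.op g ↔
      ∃ Γ : Path (0 : ℂ) (Multiplicative.toAdd g).1, ∀ t, ec (Γ t) = Am (γ t) := by
  rw [← smul0]
  exact fgt_iff hexp Am ⟨0, Am_w0⟩ γ g
lemma wB_iff (γ : Path w0 w0) (g : MK) :
    wB (FundamentalGroup.fromPath (Path.Homotopic.Quotient.mk γ)) = MulOpposite.op g ↔
      ∃ Γ : Path (0 : ℂ) (Multiplicative.toAdd g).1, ∀ t, ec (Γ t) = Bm (γ t) := by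
  rw [← smul0]
  exact fgt_iff hexp Bm ⟨0, Bm_w0⟩ γ g

lemma wC_iff (γ : Path w0 w0) (g : G2) :
    wC (FundamentalGroup.fromPath (Path.Homotopic.Quotient.mk γ)) = MulOpposite.op g ↔
      ∃ Γ : Path (mkE (hmap w0) 1) (g • mkE (hmap w0) 1), ∀ t, prE (Γ t) = hmap (γ t) :=
  fgt_iff qcov hmap ⟨mkE (hmap w0) 1, rfl⟩ γ g
lemma th_iff (γ : Path bp bp) (g : G2) :
    th (FundamentalGroup.fromPath (Path.Homotopic.Quotient.mk γ)) = MulOpposite.op g ↔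
      ∃ Γ : Path (mkE (fm bp) 1) (g • mkE (fm bp) 1), ∀ t, prE (Γ t) = fm (γ t) :=
  fgt_iff qcov fm ⟨mkE (fm bp) 1, rfl⟩ γ g

lemma wC_th (γ : Path w0 w0) (δ : Path bp bp) (hd : ∀ t, emap (δ t) = γ t) :
    wC (FundamentalGroup.fromPath (Path.Homotopic.Quotient.mk γ)) =
      th (FundamentalGroup.fromPath (Path.Homotopic.Quotient.mk δ)) := by
  obtain ⟨g, hg⟩ : ∃ g, th (FundamentalGroup.fromPath (Path.Homotopic.Quotient.mk δ)) =
    MulOpposite.op g := ⟨MulOpposite.unop _, rfl⟩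
  rw [hg, wC_iff]
  obtain ⟨Γ, hΓ⟩ := (th_iff δ g).1 hg
  have hb : hmap w0 = fm bp := hmap_emap bp
  rw [hb]
  exact ⟨Γ, fun t => by rw [hΓ, ← hd, hmap_emap]⟩

noncomputable def Ps : GW →* (MKᵐᵒᵖ × MKᵐᵒᵖ) × G2ᵐᵒᵖ := (wA.prod wB).prod wC

lemma Ps_inj : Function.Injective Ps := by
  rw [injective_iff_map_eq_one]
  intro q hq
  obtain ⟨γ, rfl⟩ := Path.Homotopic.Quotient.mk_surjective q
  simp only [Ps, MonoidHom.prod_apply, Prod.mk_eq_one] at hq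
  obtain ⟨⟨hA, hB⟩, hC⟩ := hq
  obtain ⟨α, hα⟩ := (wA_iff γ 1).1 hA
  obtain ⟨β, hβ⟩ := (wB_iff γ 1).1 hB
  have hα1 : α 1 = 0 := α.target
  have hβ1 : β 1 = 0 := β.target
  have hα0 : α 0 = 0 := α.source
  have hβ0 : β 0 = 0 := β.source
  let δ : Path bp bp :=
    { toFun := fun t => ⟨((β t - α t) / 2, (α t + β t) / 2), (exists_lift (γ t) (hα t) (hβ t)).1⟩
      continuous_toFun := by
        apply Continuous.subtype_mk
        fun_prop
      source' := by
        apply Subtype.ext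
        simp [hα0, hβ0]
      target' := by
        apply Subtype.ext
        simp [hα1, hβ1] }
  have hd : ∀ t, emap (δ t) = γ t := fun t =>
    Subtype.ext (exists_lift (γ t) (hα t) (hβ t)).2
  have h1 := wC_th γ δ hd
  have h2 : th (FundamentalGroup.fromPath (Path.Homotopic.Quotient.mk δ)) = 1 := h1.symm.trans hC
  have h3 : FundamentalGroup.fromPath (Path.Homotopic.Quotient.mk δ) = 1 :=
    th_bij.1 (h2.trans (map_one th).symm)
  have h4 : FundamentalGroup.map emap bp (FundamentalGroup.fromPath (Path.Homotopic.Quotient.mk δ)) = 1 := by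
    rw [h3, map_one]
  refine Eq.trans ?_ h4
  refine congrArg Path.Homotopic.Quotient.mk ?_
  ext1
  funext t
  exact (hd t).symm

lemma Ps_em (q : GY) : Ps (FundamentalGroup.map emap bp q : GW) = ((1, 1), th q) := by
  obtain ⟨δ, rfl⟩ := Path.Homotopic.Quotient.mk_surjective q
  refine Prod.ext (Prod.ext ?_ ?_) ?_
  · refine (wA_iff (δ.map emap.continuous) 1).2 ⟨⟨⟨fun t => (δ t).1.2 - (δ t).1.1, by fun_prop⟩, ?_, ?_⟩, ?_⟩
    · simp
    · simp
    · intro t; exact (Am_emap (δ t)).symm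
  · refine (wB_iff (δ.map emap.continuous) 1).2 ⟨⟨⟨fun t => (δ t).1.2 + (δ t).1.1, by fun_prop⟩, ?_, ?_⟩, ?_⟩
    · simp
    · simp
    · intro t; exact (Bm_emap (δ t)).symm
  · exact wC_th (δ.map emap.continuous) δ fun t => rfl

lemma Ps_surj : Function.Surjective Ps := by
  rintro ⟨⟨k, l⟩, g⟩
  obtain ⟨k, rfl⟩ := MulOpposite.op_surjective k
  obtain ⟨l, rfl⟩ := MulOpposite.op_surjective l
  obtain ⟨hy, he⟩ := exists_lift w0 (a := (Multiplicative.toAdd k).1) (b := (Multiplicative.toAdd l).1)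
    ((ec_K _).trans Am_w0) ((ec_K _).trans Bm_w0)
  obtain ⟨p⟩ := joined_bp ⟨_, hy⟩
  let γ : Path w0 w0 := (p.map emap.continuous).cast rfl (Subtype.ext he.symm)
  have hA : wA (FundamentalGroup.fromPath (Path.Homotopic.Quotient.mk γ)) = MulOpposite.op k := by
    refine (wA_iff γ k).2 ⟨⟨⟨fun t => (p t).1.2 - (p t).1.1, by fun_prop⟩, ?_, ?_⟩, ?_⟩
    · simp
    · simp; ring
    · intro t; exact (Am_emap (p t)).symm
  have hB : wB (FundamentalGroup.fromPath (Path.Homotopic.Quotient.mk γ)) = MulOpposite.op l := by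
    refine (wB_iff γ l).2 ⟨⟨⟨fun t => (p t).1.2 + (p t).1.1, by fun_prop⟩, ?_, ?_⟩, ?_⟩
    · simp
    · simp; ring
    · intro t; exact (Bm_emap (p t)).symm
  obtain ⟨d, hd⟩ := th_bij.2 ((wC (FundamentalGroup.fromPath (Path.Homotopic.Quotient.mk γ)))⁻¹ * g)
  let c : GW := FundamentalGroup.map emap bp d
  have hc : Ps c = ((1, 1), th d) := Ps_em d
  let c0 : GW := FundamentalGroup.fromPath (Path.Homotopic.Quotient.mk γ)
  refine ⟨c0 * c, ?_⟩
  rw [map_mul, hc, hd]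
  simp [Ps, c0, hA, hB]

lemma KK_equiv : Nonempty (MKᵐᵒᵖ ≃* Multiplicative ℤ) := by
  have hne : (2 * Real.pi * Complex.I : ℂ) ≠ 0 := Complex.two_pi_I_ne_zero
  let φ : ℤ →+ KK := (zmultiplesHom KK) ⟨_, AddSubgroup.mem_zmultiples _⟩
  have hφ : Function.Bijective φ := by
    constructor
    · intro a b hab
      have := congrArg Subtype.val hab
      simp only [φ, zmultiplesHom_apply, AddSubgroup.coe_zsmul, zsmul_eq_mul] at this
      exact_mod_cast mul_right_cancel₀ hne this
    · rintro ⟨k, n, rfl⟩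
      exact ⟨n, Subtype.ext (by simp [φ])⟩
  exact ⟨((AddEquiv.toMultiplicative (AddEquiv.ofBijective φ hφ)).trans MulOpposite.opMulEquiv).symm⟩

theorem main0 : Nonempty (GW ≃* (Multiplicative ℤ × Multiplicative ℤ) × FreeGroup (Fin 2)) := by
  obtain ⟨e⟩ := KK_equiv
  exact ⟨(MulEquiv.ofBijective Ps ⟨Ps_inj, Ps_surj⟩).trans
    (MulEquiv.prodCongr (MulEquiv.prodCongr e e) (MulEquiv.inv' G2).symm)⟩

theorem joined_w0 (x : WW) : Nonempty (Path x w0) := by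
  obtain ⟨hy, he⟩ := exists_lift x (a := Complex.log (Am x).1) (b := Complex.log (Bm x).1)
    (Subtype.ext (Complex.exp_log (Am x).2)) (Subtype.ext (Complex.exp_log (Bm x).2))
  obtain ⟨p⟩ := joined_bp ⟨_, hy⟩
  exact ⟨((p.map emap.continuous).cast rfl (Subtype.ext he.symm)).symm⟩

end S15

/-- The fundamental group of `ℂ² \ (H_{B₂} ∪ ℓ₁ ∪ ℓ₂)` with `B₂ = {4, 4i}` (at any
basepoint) is isomorphic to `ℤ² × F₂`. -/
theorem stmt15 (x : W ({4, 4 * Complex.I} : Set ℂ)) :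
    Nonempty (FundamentalGroup (W ({4, 4 * Complex.I} : Set ℂ)) x ≃*
      (Multiplicative ℤ × Multiplicative ℤ) × FreeGroup (Fin 2)) := by
  obtain ⟨p⟩ := S15.joined_w0 x
  obtain ⟨e⟩ := S15.main0
  exact ⟨(FundamentalGroup.fundamentalGroupMulEquivOfPath p).trans e⟩
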